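/- arXiv:1712.02526 — 5 statements merged into one kernel-verified Lean document; each statement's English description precedes it below -/
import Mathlib

section
/- (Boros–Füredi) For every ε > 0 there exists N such that for all n ≥ N and every set P ⊆ ℝ² with |P| = n, there exists a point z ∈ ℝ² such that z lies in the convex hull of S for at least (2/9 − ε)·C(n,3) of the 3-element subsets S of P. -/
section

open MeasureTheory Filter Topology Real

theorem exists_continuous_solution {T : Type*} [TopologicalSpace T] {G : T → ℝ → ℝ} {α : ℝ}
    (hc : Continuous fun q : T × ℝ => G q.1 q.2) (hm : ∀ τ, StrictAnti (G τ))
    (hlo : ∀ τ, ∃ s, G τ s < α) (hhi : ∀ τ, ∃ s, α < G τ s) :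
    ∃ g : T → ℝ, Continuous g ∧ ∀ τ, G τ (g τ) = α := by
  have hex : ∀ τ, ∃ s, G τ s = α := fun τ => by
    obtain ⟨a, ha⟩ := hlo τ
    obtain ⟨b, hb⟩ := hhi τ
    exact mem_range_of_exists_le_of_exists_ge (hc.comp (Continuous.prodMk_right τ))
      ⟨a, ha.le⟩ ⟨b, hb.le⟩
  choose g hg using hex
  refine ⟨g, continuous_iff_continuousAt.2 fun τ => ?_, hg⟩
  have hs : ∀ s, Continuous fun τ => G τ s := fun s => hc.comp (Continuous.prodMk_left s)
  refine tendsto_order.2 ⟨fun a ha => ?_, fun b hb => ?_⟩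
  · have h : α < G τ a := hg τ ▸ hm τ ha
    filter_upwards [(hs a).continuousAt.eventually_const_lt h] with σ hσ
    exact (hm σ).lt_iff_gt.1 (by rwa [hg σ])
  · have h : G τ b < α := hg τ ▸ hm τ hb
    filter_upwards [(hs b).continuousAt.eventually_lt_const h] with σ hσ
    exact (hm σ).lt_iff_gt.1 (by rwa [hg σ])

/-- The solution `s` is odd under the half-turn `θ ↦ θ + π`. -/
theorem exists_balanced_transversal {A : ℝ → ℝ → ℝ → ℝ} {m α : ℝ}
    (hc : Continuous fun q : ℝ × ℝ × ℝ => A q.1 q.2.1 q.2.2)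
    (hs : ∀ θ t, StrictAnti fun s => A θ s t) (ht : ∀ θ s, StrictAnti (A θ s))
    (hs_top : ∀ θ t, Tendsto (fun s => A θ s t) atTop (𝓝 0))
    (hs_bot : ∀ θ t, Tendsto (fun s => A θ s t) atBot (𝓝 m))
    (ht_top : ∀ θ s, Tendsto (A θ s) atTop (𝓝 0))
    (ht_bot : ∀ θ s, Tendsto (A θ s) atBot (𝓝 m))
    (hper : ∀ θ, A (θ + π + π) = A θ) (hα : 0 < α) (hαm : α < m) :
    ∃ s t : ℝ → ℝ, Continuous s ∧ (∀ θ, s (θ + π) = -s θ) ∧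
      ∀ θ, A θ (s θ) (t θ) = α ∧ A (θ + π) (-s θ) (t θ) = α := by
  obtain ⟨a, hac, ha⟩ := exists_continuous_solution (T := ℝ × ℝ)
    (G := fun q t => A q.1 q.2 t) (α := α)
    (hc.comp (f := fun q : (ℝ × ℝ) × ℝ => (q.1.1, q.1.2, q.2)) (by fun_prop))
    (fun q => ht _ _) (fun q => ((ht_top q.1 q.2).eventually_lt_const hα).exists)
    (fun q => ((ht_bot q.1 q.2).eventually_const_lt hαm).exists)
  have ha' : ∀ θ s, A θ s (a (θ, s)) = α := fun θ s => ha (θ, s)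
  have hanti : ∀ θ, StrictAnti fun s => a (θ, s) := fun θ s s' h => by
    refine (ht θ s').lt_iff_gt.1 ?_
    rw [ha' θ s', ← ha' θ s]
    exact hs θ _ h
  obtain ⟨g, hgc, hg⟩ := exists_continuous_solution (T := ℝ)
    (G := fun θ s => A (θ + π) s (a (θ, -s))) (α := α)
    (hc.comp (f := fun q : ℝ × ℝ => (q.1 + π, q.2, a (q.1, -q.2))) (by fun_prop))
    (fun θ s s' h => (hs _ _ h).trans ((ht _ _) (hanti θ (neg_lt_neg h))))
    (fun θ => by
      have h1 := (hs_top (θ + π) 0).eventually_lt_const hα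
      have h2 := tendsto_neg_atTop_atBot.eventually ((hs_bot θ 0).eventually_const_lt hαm)
      obtain ⟨s, h1, h2⟩ := (h1.and h2).exists
      refine ⟨s, lt_of_lt_of_le' h1 ((ht _ _).antitone ?_)⟩
      rw [← ha' θ (-s)] at h2
      exact ((ht _ _).lt_iff_gt.1 h2).le)
    (fun θ => by
      have h1 := (hs_bot (θ + π) 0).eventually_const_lt hαm
      have h2 := tendsto_neg_atBot_atTop.eventually ((hs_top θ 0).eventually_lt_const hα)
      obtain ⟨s, h1, h2⟩ := (h1.and h2).exists
      refine ⟨s, lt_of_lt_of_le h1 ((ht _ _).antitone ?_)⟩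
      rw [← ha' θ (-s)] at h2
      exact ((ht _ _).lt_iff_gt.1 h2).le)
  have huniq : ∀ θ s t s' t', A θ s t = α → A (θ + π) (-s) t = α → A θ s' t' = α →
      A (θ + π) (-s') t' = α → s' ≤ s := by
    intro θ s t s' t' h1 h2 h3 h4
    by_contra! h
    have h5 : A θ s t < A θ s t' := by rw [h1, ← h3]; exact hs _ _ h
    have h6 : t' < t := (ht _ _).lt_iff_gt.1 h5
    have h7 := ht (θ + π) (-s) h6
    have h8 := hs (θ + π) t' (neg_lt_neg h)
    simp only at h8
    linarith
  have key : ∀ θ, A θ (-g θ) (a (θ, -g θ)) = α ∧ A (θ + π) (- -g θ) (a (θ, -g θ)) = α :=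
    fun θ => ⟨ha' _ _, by simpa using hg θ⟩
  refine ⟨fun θ => -g θ, fun θ => a (θ, -g θ), hgc.neg, fun θ => ?_, key⟩
  have k2 := key (θ + π)
  rw [hper, neg_neg] at k2
  have k1 := key θ
  have e1 := huniq θ _ _ _ _ k1.1 k1.2 k2.2 k2.1
  have e2 := huniq θ _ _ _ _ k2.2 k2.1 k1.1 k1.2
  linarith

theorem exists_concurrent_transversals {A : ℝ → ℝ → ℝ → ℝ} {m α β : ℝ}
    (hc : Continuous fun q : ℝ × ℝ × ℝ => A q.1 q.2.1 q.2.2)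
    (hs : ∀ θ t, StrictAnti fun s => A θ s t) (ht : ∀ θ s, StrictAnti (A θ s))
    (hs_top : ∀ θ t, Tendsto (fun s => A θ s t) atTop (𝓝 0))
    (hs_bot : ∀ θ t, Tendsto (fun s => A θ s t) atBot (𝓝 m))
    (ht_top : ∀ θ s, Tendsto (A θ s) atTop (𝓝 0))
    (ht_bot : ∀ θ s, Tendsto (A θ s) atBot (𝓝 m))
    (hper : ∀ θ, A (θ + π + π) = A θ) (hα : 0 < α) (hαβ : α < β) (hβm : β < m) :
    ∃ θ s t u, u < t ∧ A θ s t = α ∧ A (θ + π) (-s) t = α ∧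
      A θ s u = β ∧ A (θ + π) (-s) u = β := by
  obtain ⟨s, t, hsc, hso, hst⟩ := exists_balanced_transversal hc hs ht hs_top hs_bot ht_top ht_bot
    hper hα (hαβ.trans hβm)
  obtain ⟨s', u, hsc', hso', hsu⟩ := exists_balanced_transversal hc hs ht hs_top hs_bot ht_top
    ht_bot hper (hα.trans hαβ) hβm
  have hf : Continuous fun θ => s θ - s' θ := hsc.sub hsc'
  obtain ⟨θ, hθ⟩ : ∃ θ, s θ - s' θ = 0 := by
    have hπ : s (0 + π) - s' (0 + π) = -(s 0 - s' 0) := by rw [hso, hso']; ring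
    rcases le_total (s 0 - s' 0) 0 with h | h
    · exact mem_range_of_exists_le_of_exists_ge hf ⟨0, h⟩ ⟨0 + π, by rw [hπ]; linarith⟩
    · exact mem_range_of_exists_le_of_exists_ge hf ⟨0 + π, by rw [hπ]; linarith⟩ ⟨0, h⟩
  have hss : s' θ = s θ := by linarith
  have hu := hsu θ
  rw [hss] at hu
  refine ⟨θ, s θ, t θ, u θ, (ht θ (s θ)).lt_iff_gt.1 ?_, (hst θ).1, (hst θ).2, hu.1, hu.2⟩
  rw [(hst θ).1, hu.1]
  exact hαβ

theorem tendsto_measureReal_of_ae_eventually_mem_iff {Ω ι : Type*} [MeasurableSpace Ω]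
    {μ : Measure Ω} [IsFiniteMeasure μ] {L : Filter ι} [L.IsCountablyGenerated]
    {S : ι → Set Ω} {S₀ : Set Ω} (hS : ∀ i, MeasurableSet (S i)) (hS₀ : MeasurableSet S₀)
    (h : ∀ᵐ x ∂μ, ∀ᶠ i in L, x ∈ S i ↔ x ∈ S₀) :
    Tendsto (fun i => μ.real (S i)) L (𝓝 (μ.real S₀)) :=
  (ENNReal.tendsto_toReal (measure_ne_top μ S₀)).comp
    (tendsto_measure_of_ae_tendsto_indicator_of_isFiniteMeasure L hS₀ hS h)

theorem Continuous.eventually_pos_iff {T : Type*} [TopologicalSpace T] {f : T → ℝ}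
    (hf : Continuous f) {τ : T} (h : f τ ≠ 0) : ∀ᶠ σ in 𝓝 τ, 0 < f σ ↔ 0 < f τ := by
  rcases h.lt_or_gt with h | h
  · filter_upwards [hf.continuousAt.eventually_lt_const h] with σ hσ
    exact iff_of_false hσ.not_gt h.not_gt
  · filter_upwards [hf.continuousAt.eventually_const_lt h] with σ hσ
    exact iff_of_true hσ h

theorem continuous_measureReal_pos_inter {Ω T : Type*} [MeasurableSpace Ω] {μ : Measure Ω}
    [IsFiniteMeasure μ] [TopologicalSpace T] [FirstCountableTopology T] {f g : T → Ω → ℝ}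
    (hf : ∀ x, Continuous fun τ => f τ x) (hg : ∀ x, Continuous fun τ => g τ x)
    (hfm : ∀ τ, Measurable (f τ)) (hgm : ∀ τ, Measurable (g τ))
    (hf0 : ∀ τ, ∀ᵐ x ∂μ, f τ x ≠ 0) (hg0 : ∀ τ, ∀ᵐ x ∂μ, g τ x ≠ 0) :
    Continuous fun τ => μ.real {x | 0 < f τ x ∧ 0 < g τ x} := by
  have hm : ∀ τ, MeasurableSet {x | 0 < f τ x ∧ 0 < g τ x} := fun τ =>
    (measurableSet_lt measurable_const (hfm τ)).inter (measurableSet_lt measurable_const (hgm τ))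
  refine continuous_iff_continuousAt.2 fun τ =>
    tendsto_measureReal_of_ae_eventually_mem_iff hm (hm τ) ?_
  filter_upwards [hf0 τ, hg0 τ] with x hx hx'
  filter_upwards [(hf x).eventually_pos_iff hx, (hg x).eventually_pos_iff hx'] with σ h h'
  exact and_congr h h'

theorem measureReal_lt_of_isOpen_subset_diff {Ω : Type*} [MeasurableSpace Ω] [TopologicalSpace Ω]
    [OpensMeasurableSpace Ω] {μ : Measure Ω} [IsFiniteMeasure μ] [μ.IsOpenPosMeasure]
    {s t U : Set Ω} (hst : s ⊆ t) (hU : IsOpen U) (hne : U.Nonempty) (hUt : U ⊆ t)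
    (hUs : Disjoint s U) : μ.real s < μ.real t := by
  have h1 : 0 < μ.real U := ENNReal.toReal_pos (hU.measure_pos μ hne).ne' (measure_ne_top _ _)
  have h2 : μ.real (s ∪ U) = μ.real s + μ.real U := measureReal_union hUs hU.measurableSet
  have h3 : μ.real (s ∪ U) ≤ μ.real t := measureReal_mono (Set.union_subset hst hUt)
  linarith

theorem volume_setOf_linear_eq {a b : ℝ} (h : a ≠ 0 ∨ b ≠ 0) (c : ℝ) :
    volume {p : Fin 2 → ℝ | a * p 0 + b * p 1 = c} = 0 := by
  let L : (Fin 2 → ℝ) →ₗ[ℝ] ℝ := a • LinearMap.proj 0 + b • LinearMap.proj 1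
  have hL : ∀ p, L p = a * p 0 + b * p 1 := fun p => by simp [L]
  rcases Set.eq_empty_or_nonempty {p : Fin 2 → ℝ | a * p 0 + b * p 1 = c} with he | ⟨p₀, hp₀⟩
  · rw [he, measure_empty]
  have hker : L.ker ≠ ⊤ := by
    intro hk
    have hz : L = 0 := LinearMap.ker_eq_top.1 hk
    rcases h with h | h
    · exact h (by simpa [hz] using (hL ![1, 0]).symm)
    · exact h (by simpa [hz] using (hL ![0, 1]).symm)
  have hset : {p : Fin 2 → ℝ | a * p 0 + b * p 1 = c} =
      (fun p => p + -p₀) ⁻¹' (L.ker : Set (Fin 2 → ℝ)) := by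
    ext p
    have h0 : L p₀ = c := (hL p₀).trans hp₀
    rw [Set.mem_preimage, SetLike.mem_coe, LinearMap.mem_ker, map_add, map_neg, h0, hL,
      Set.mem_ofPred_eq, ← sub_eq_add_neg, sub_eq_zero]
  rw [hset, measure_preimage_add_right]
  exact Measure.addHaar_submodule volume _ hker

/-- First coordinate of `p` in the frame rotated by `θ`. -/
noncomputable def rotX (θ : ℝ) (p : Fin 2 → ℝ) : ℝ := cos θ * p 0 + sin θ * p 1

/-- Second coordinate of `p` in the frame rotated by `θ`. -/
noncomputable def rotY (θ : ℝ) (p : Fin 2 → ℝ) : ℝ := -sin θ * p 0 + cos θ * p 1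

/-- The point with coordinates `x`, `y` in the frame rotated by `θ`. -/
noncomputable def rotPoint (θ x y : ℝ) : Fin 2 → ℝ :=
  ![cos θ * x - sin θ * y, sin θ * x + cos θ * y]

@[simp] theorem rotX_rotPoint (θ x y : ℝ) : rotX θ (rotPoint θ x y) = x := by
  simp only [rotX, rotPoint, Matrix.cons_val_zero, Matrix.cons_val_one]
  linear_combination x * cos_sq_add_sin_sq θ

@[simp] theorem rotY_rotPoint (θ x y : ℝ) : rotY θ (rotPoint θ x y) = y := by
  simp only [rotY, rotPoint, Matrix.cons_val_zero, Matrix.cons_val_one]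
  linear_combination y * cos_sq_add_sin_sq θ

theorem rotPoint_rotX_rotY (θ : ℝ) (p : Fin 2 → ℝ) : rotPoint θ (rotX θ p) (rotY θ p) = p := by
  ext i
  fin_cases i
  · simp only [rotX, rotY, rotPoint, Fin.zero_eta, Matrix.cons_val_zero]
    linear_combination p 0 * cos_sq_add_sin_sq θ
  · simp only [rotX, rotY, rotPoint, Fin.mk_one, Matrix.cons_val_one, Matrix.cons_val_fin_one]
    linear_combination p 1 * cos_sq_add_sin_sq θ

theorem rotX_add_pi (θ : ℝ) (p : Fin 2 → ℝ) : rotX (θ + π) p = -rotX θ p := by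
  simp only [rotX, cos_add_pi, sin_add_pi]; ring

theorem rotY_add_pi (θ : ℝ) (p : Fin 2 → ℝ) : rotY (θ + π) p = -rotY θ p := by
  simp only [rotY, cos_add_pi, sin_add_pi]; ring

@[fun_prop] theorem Continuous.rotX {T : Type*} [TopologicalSpace T] {f : T → ℝ}
    {g : T → Fin 2 → ℝ} (hf : Continuous f) (hg : Continuous g) :
    Continuous fun τ => rotX (f τ) (g τ) := by
  unfold _root_.rotX; fun_prop

@[fun_prop] theorem Continuous.rotY {T : Type*} [TopologicalSpace T] {f : T → ℝ}
    {g : T → Fin 2 → ℝ} (hf : Continuous f) (hg : Continuous g) :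
    Continuous fun τ => rotY (f τ) (g τ) := by
  unfold _root_.rotY; fun_prop

section Equipartition

variable {μ : Measure (Fin 2 → ℝ)}

theorem ae_rotY_ne (hμ : μ ≪ volume) (θ c : ℝ) : ∀ᵐ p ∂μ, rotY θ p - c ≠ 0 := by
  refine hμ.ae_le (measure_mono_null (t := {p | -sin θ * p 0 + cos θ * p 1 = c}) ?_
    (volume_setOf_linear_eq ?_ c))
  · intro p hp
    simp only [Set.mem_compl_iff, Set.mem_ofPred_eq, not_not, rotY] at hp
    exact sub_eq_zero.1 hp
  · by_contra! h
    nlinarith [cos_sq_add_sin_sq θ]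

theorem ae_transversal_ne (hμ : μ ≪ volume) (θ c s t : ℝ) :
    ∀ᵐ p ∂μ, rotX θ p - s - t * (rotY θ p - c) ≠ 0 := by
  refine hμ.ae_le (measure_mono_null (t := {p | (cos θ + t * sin θ) * p 0 +
    (sin θ - t * cos θ) * p 1 = s - t * c}) ?_ (volume_setOf_linear_eq ?_ _))
  · intro p hp
    simp only [Set.mem_compl_iff, Set.mem_ofPred_eq, not_not, rotX, rotY] at hp ⊢
    linarith
  · by_contra! h
    nlinarith [cos_sq_add_sin_sq θ, h.1, h.2, congrArg (· * cos θ) h.1, congrArg (· * sin θ) h.2]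

theorem strictAnti_measureReal_rotY [IsFiniteMeasure μ] [μ.IsOpenPosMeasure] (θ : ℝ) :
    StrictAnti fun c => μ.real {p | 0 < rotY θ p - c} := by
  intro c d h
  refine measureReal_lt_of_isOpen_subset_diff (U := {p | 0 < rotY θ p - c ∧ 0 < d - rotY θ p})
    (fun p hp => ?_) ?_ ⟨rotPoint θ 0 ((c + d) / 2), ?_⟩ (fun p hp => hp.1)
    (Set.disjoint_left.2 fun p hp hp' => ?_)
  · simp only [Set.mem_ofPred_eq] at hp ⊢; linarith
  · exact IsOpen.and (isOpen_lt (by fun_prop) (by fun_prop)) (isOpen_lt (by fun_prop) (by fun_prop))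
  · simp only [Set.mem_ofPred_eq, rotY_rotPoint]; constructor <;> linarith
  · simp only [Set.mem_ofPred_eq] at hp hp'; linarith

/-- A continuous choice of bisecting lines, one for each direction. -/
theorem exists_bisecting_lines [IsProbabilityMeasure μ] [μ.IsOpenPosMeasure] (hμ : μ ≪ volume) :
    ∃ c : ℝ → ℝ, Continuous c ∧ (∀ θ, μ.real {p | 0 < rotY θ p - c θ} = 1 / 2) ∧
      ∀ θ, c (θ + π) = -c θ := by
  have hmeas : ∀ θ c, MeasurableSet {p | 0 < rotY θ p - c} := fun θ c =>
    (isOpen_lt (by fun_prop) (by fun_prop)).measurableSet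
  obtain ⟨c, hc, hc'⟩ := exists_continuous_solution (T := ℝ) (α := 1 / 2)
    (G := fun θ c => μ.real {p | 0 < rotY θ p - c})
    (by
      simpa using continuous_measureReal_pos_inter (μ := μ) (T := ℝ × ℝ)
        (f := fun q p => rotY q.1 p - q.2) (g := fun _ _ => 1) (fun p => by fun_prop)
        (fun p => by fun_prop) (fun q => Continuous.measurable (by fun_prop))
        (fun q => measurable_const) (fun q => ae_rotY_ne hμ q.1 q.2)
        (fun q => ae_of_all _ fun _ => one_ne_zero))
    strictAnti_measureReal_rotY
    (fun θ => by
      have h : Tendsto (fun c => μ.real {p | 0 < rotY θ p - c}) atTop (𝓝 (μ.real ∅)) := by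
        refine tendsto_measureReal_of_ae_eventually_mem_iff (hmeas θ) MeasurableSet.empty
          (ae_of_all _ fun p => ?_)
        filter_upwards [eventually_gt_atTop (rotY θ p)] with c hc
        simp only [Set.mem_empty_iff_false, iff_false, not_lt]; linarith
      rw [measureReal_empty] at h
      exact (h.eventually_lt_const (by norm_num)).exists)
    (fun θ => by
      have h : Tendsto (fun c => μ.real {p | 0 < rotY θ p - c}) atBot (𝓝 (μ.real Set.univ)) := by
        refine tendsto_measureReal_of_ae_eventually_mem_iff (hmeas θ) MeasurableSet.univ
          (ae_of_all _ fun p => ?_)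
        filter_upwards [eventually_lt_atBot (rotY θ p)] with c hc
        simp only [Set.mem_univ, iff_true]; linarith
      rw [probReal_univ] at h
      exact (h.eventually_const_lt (by norm_num)).exists)
  refine ⟨c, hc, hc', fun θ => (strictAnti_measureReal_rotY (μ := μ) (θ + π)).injective ?_⟩
  have hcompl := probReal_compl_eq_one_sub (μ := μ) (hmeas θ (c θ))
  have heq : μ.real {p | 0 < rotY (θ + π) p - -c θ} = μ.real {p | 0 < rotY θ p - c θ}ᶜ := by
    refine measureReal_congr ?_
    filter_upwards [ae_rotY_ne hμ θ (c θ)] with p hp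
    refine propext ?_
    change 0 < rotY (θ + π) p - -c θ ↔ ¬ 0 < rotY θ p - c θ
    rw [rotY_add_pi]
    constructor
    · intro h; linarith
    · intro h; linarith [lt_of_le_of_ne (not_lt.1 h) hp]
  simp only [hc', heq, hcompl]
  norm_num

/-- Three concurrent lines cutting the plane into six sectors of equal measure, in the coordinates
centred at their common point whose first axis is one of the lines. -/
theorem exists_six_sector_equipartition [IsProbabilityMeasure μ] [μ.IsOpenPosMeasure]
    (hμ : μ ≪ volume) :
    ∃ θ s c t u, u < t ∧
      μ.real {p | 0 < rotY θ p - c} = 1 / 2 ∧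
      μ.real {p | 0 < rotY θ p - c ∧ t < (rotX θ p - s) / (rotY θ p - c)} = 1 / 6 ∧
      μ.real {p | 0 < rotY θ p - c ∧ u < (rotX θ p - s) / (rotY θ p - c)} = 1 / 3 ∧
      μ.real {p | rotY θ p - c < 0} = 1 / 2 ∧
      μ.real {p | rotY θ p - c < 0 ∧ t < (rotX θ p - s) / (rotY θ p - c)} = 1 / 6 ∧
      μ.real {p | rotY θ p - c < 0 ∧ u < (rotX θ p - s) / (rotY θ p - c)} = 1 / 3 := by
  obtain ⟨c, hcc, hc, hcπ⟩ := exists_bisecting_lines hμ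
  let W : ℝ → ℝ → ℝ → Set (Fin 2 → ℝ) := fun θ s t =>
    {p | 0 < rotY θ p - c θ ∧ 0 < rotX θ p - s - t * (rotY θ p - c θ)}
  have hWm : ∀ θ s t, MeasurableSet (W θ s t) := fun θ s t =>
    (IsOpen.and (isOpen_lt (by fun_prop) (by fun_prop))
      (isOpen_lt (by fun_prop) (by fun_prop))).measurableSet
  have hHm : ∀ θ, MeasurableSet {p | 0 < rotY θ p - c θ} := fun θ =>
    (isOpen_lt (by fun_prop) (by fun_prop)).measurableSet
  have htop : ∀ {f : ℝ → Set (Fin 2 → ℝ)}, (∀ s, MeasurableSet (f s)) →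
      (∀ p, ∀ᶠ s in atTop, p ∉ f s) → Tendsto (fun s => μ.real (f s)) atTop (𝓝 0) := by
    intro f hf h
    rw [← measureReal_empty (μ := μ)]
    refine tendsto_measureReal_of_ae_eventually_mem_iff hf MeasurableSet.empty
      (ae_of_all _ fun p => ?_)
    filter_upwards [h p] with s hs
    simpa using hs
  have hbot : ∀ θ {f : ℝ → Set (Fin 2 → ℝ)}, (∀ s, MeasurableSet (f s)) →
      (∀ s, f s ⊆ {p | 0 < rotY θ p - c θ}) →
      (∀ p, 0 < rotY θ p - c θ → ∀ᶠ s in atBot, p ∈ f s) →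
      Tendsto (fun s => μ.real (f s)) atBot (𝓝 (1 / 2)) := by
    intro θ f hf hsub h
    rw [← hc θ]
    refine tendsto_measureReal_of_ae_eventually_mem_iff hf (hHm θ) (ae_of_all _ fun p => ?_)
    by_cases hp : 0 < rotY θ p - c θ
    · filter_upwards [h p hp] with s hs
      exact iff_of_true hs hp
    · exact Eventually.of_forall fun s => iff_of_false (fun h' => hp (hsub s h')) hp
  have hhalf : ∀ θ s t, {p | rotY θ p - c θ < 0 ∧ t < (rotX θ p - s) / (rotY θ p - c θ)} =
      W (θ + π) (-s) t := by
    intro θ s t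
    ext p
    simp only [W, Set.mem_ofPred_eq, rotX_add_pi, rotY_add_pi, hcπ]
    constructor
    · rintro ⟨h1, h2⟩
      rw [lt_div_iff_of_neg h1] at h2
      constructor <;> linarith
    · rintro ⟨h1, h2⟩
      have h1' : rotY θ p - c θ < 0 := by linarith
      rw [lt_div_iff_of_neg h1']
      constructor <;> linarith
  have hhalf' : ∀ θ s t, {p | 0 < rotY θ p - c θ ∧ t < (rotX θ p - s) / (rotY θ p - c θ)} =
      W θ s t := by
    intro θ s t
    ext p
    refine and_congr_right fun h => ?_
    rw [lt_div_iff₀ h, sub_pos]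
  obtain ⟨θ, s, t, u, hut, h1, h2, h3, h4⟩ := exists_concurrent_transversals
    (A := fun θ s t => μ.real (W θ s t)) (m := 1 / 2) (α := 1 / 6) (β := 1 / 3)
    (continuous_measureReal_pos_inter (fun p => by fun_prop) (fun p => by fun_prop)
      (fun q => Continuous.measurable (by fun_prop)) (fun q => Continuous.measurable (by fun_prop))
      (fun q => ae_rotY_ne hμ _ _) (fun q => ae_transversal_ne hμ _ _ _ _))
    (fun θ t s s' h => by
      refine measureReal_lt_of_isOpen_subset_diff (U := {p | 0 < rotY θ p - c θ ∧
        0 < rotX θ p - s - t * (rotY θ p - c θ) ∧ rotX θ p - s' - t * (rotY θ p - c θ) < 0})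
        (fun p hp => ⟨hp.1, by linarith [hp.2]⟩) ?_ ⟨rotPoint θ ((s + s') / 2 + t) (c θ + 1), ?_⟩
        (fun p hp => ⟨hp.1, hp.2.1⟩) (Set.disjoint_left.2 fun p hp hp' => hp.2.not_gt hp'.2.2)
      · exact IsOpen.and (isOpen_lt (by fun_prop) (by fun_prop)) (IsOpen.and
          (isOpen_lt (by fun_prop) (by fun_prop)) (isOpen_lt (by fun_prop) (by fun_prop)))
      · simp only [Set.mem_ofPred_eq, rotX_rotPoint, rotY_rotPoint]
        refine ⟨?_, ?_, ?_⟩ <;> linarith)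
    (fun θ s t t' h => by
      refine measureReal_lt_of_isOpen_subset_diff (U := {p | 0 < rotY θ p - c θ ∧
        0 < rotX θ p - s - t * (rotY θ p - c θ) ∧ rotX θ p - s - t' * (rotY θ p - c θ) < 0})
        (fun p hp => ⟨hp.1, ?_⟩) ?_ ⟨rotPoint θ (s + (t + t') / 2) (c θ + 1), ?_⟩
        (fun p hp => ⟨hp.1, hp.2.1⟩) (Set.disjoint_left.2 fun p hp hp' => hp.2.not_gt hp'.2.2)
      · nlinarith [hp.1, hp.2]
      · exact IsOpen.and (isOpen_lt (by fun_prop) (by fun_prop)) (IsOpen.and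
          (isOpen_lt (by fun_prop) (by fun_prop)) (isOpen_lt (by fun_prop) (by fun_prop)))
      · simp only [Set.mem_ofPred_eq, rotX_rotPoint, rotY_rotPoint]
        refine ⟨?_, ?_, ?_⟩ <;> linarith)
    (fun θ t => htop (fun s => hWm θ s t) fun p => by
      filter_upwards [eventually_gt_atTop (rotX θ p - t * (rotY θ p - c θ))] with s hs hp
      linarith [hp.2])
    (fun θ t => hbot θ (fun s => hWm θ s t) (fun s p hp => hp.1) fun p hp => by
      filter_upwards [eventually_lt_atBot (rotX θ p - t * (rotY θ p - c θ))] with s hs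
      exact ⟨hp, by linarith⟩)
    (fun θ s => htop (fun t => hWm θ s t) fun p => by
      filter_upwards [eventually_gt_atTop ((rotX θ p - s) / (rotY θ p - c θ))] with t ht hp
      rw [div_lt_iff₀ hp.1] at ht
      linarith [hp.2])
    (fun θ s => hbot θ (fun t => hWm θ s t) (fun t p hp => hp.1) fun p hp => by
      filter_upwards [eventually_lt_atBot ((rotX θ p - s) / (rotY θ p - c θ))] with t ht
      rw [lt_div_iff₀ hp] at ht
      exact ⟨hp, by linarith⟩)
    (fun θ => by simp only [W, rotX_add_pi, rotY_add_pi, hcπ, neg_neg])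
    (by norm_num) (by norm_num) (by norm_num)
  refine ⟨θ, s, c θ, t, u, hut, hc θ, ?_, ?_, ?_, ?_, ?_⟩
  · rw [hhalf']; exact h1
  · rw [hhalf']; exact h3
  · rw [← hc (θ + π)]
    congr 1
    ext p
    simp only [Set.mem_ofPred_eq, rotY_add_pi, hcπ]
    constructor <;> intro h <;> linarith
  · rw [hhalf]; exact h2
  · rw [hhalf]; exact h4

end Equipartition

theorem rotPoint_mem_convexHull_of_alternating {θ s c σ : ℝ} {p : Fin 3 → Fin 2 → ℝ}
    (h0 : 0 < σ * (rotY θ (p 0) - c)) (h1 : σ * (rotY θ (p 1) - c) < 0)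
    (h2 : 0 < σ * (rotY θ (p 2) - c))
    (h01 : (rotX θ (p 1) - s) / (rotY θ (p 1) - c) ≤ (rotX θ (p 0) - s) / (rotY θ (p 0) - c))
    (h12 : (rotX θ (p 2) - s) / (rotY θ (p 2) - c) ≤ (rotX θ (p 1) - s) / (rotY θ (p 1) - c)) :
    rotPoint θ s c ∈ convexHull ℝ (Set.range p) := by
  set Y : Fin 3 → ℝ := fun i => rotY θ (p i) - c with hY
  set q : Fin 3 → ℝ := fun i => (rotX θ (p i) - s) / Y i with hq
  change 0 < σ * Y 0 at h0
  change σ * Y 1 < 0 at h1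
  change 0 < σ * Y 2 at h2
  have hY0 : ∀ i, Y i ≠ 0 := fun i hi => by fin_cases i <;> simp_all
  have hσ : σ ≠ 0 := by rintro rfl; simp at h0
  have hp : ∀ i, p i = rotPoint θ (s + q i * Y i) (c + Y i) := fun i => by
    rw [hq, div_mul_cancel₀ _ (hY0 i), hY, add_sub_cancel, add_sub_cancel, rotPoint_rotX_rotY]
  obtain ⟨a, b, ha, hb, hab, hq1⟩ : q 1 ∈ segment ℝ (q 0) (q 2) := by
    rw [segment_symm, segment_eq_Icc (h12.trans h01)]
    exact ⟨h12, h01⟩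
  simp only [smul_eq_mul] at hq1
  let w : Fin 3 → ℝ := ![a / (σ * Y 0), -1 / (σ * Y 1), b / (σ * Y 2)]
  have hw1 : 0 < -1 / (σ * Y 1) := div_pos_of_neg_of_neg (by norm_num) h1
  have hw0 : 0 ≤ a / (σ * Y 0) := by positivity
  have hw2 : 0 ≤ b / (σ * Y 2) := by positivity
  have hw : ∀ i, 0 ≤ w i := fun i => by
    fin_cases i
    exacts [hw0, hw1.le, hw2]
  have hsum : 0 < ∑ i, w i := by
    rw [Fin.sum_univ_three]
    change 0 < a / (σ * Y 0) + -1 / (σ * Y 1) + b / (σ * Y 2)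
    linarith
  have e0 : w 0 * Y 0 = a / σ := by
    change a / (σ * Y 0) * Y 0 = _
    have := hY0 0
    field_simp
  have e1 : w 1 * Y 1 = -1 / σ := by
    change -1 / (σ * Y 1) * Y 1 = _
    have := hY0 1
    field_simp
  have e2 : w 2 * Y 2 = b / σ := by
    change b / (σ * Y 2) * Y 2 = _
    have := hY0 2
    field_simp
  have hwY : w 0 * Y 0 + w 1 * Y 1 + w 2 * Y 2 = 0 := by
    rw [e0, e1, e2, ← add_div, ← add_div, show a + -1 + b = 0 by linarith, zero_div]
  have hwX : w 0 * (q 0 * Y 0) + w 1 * (q 1 * Y 1) + w 2 * (q 2 * Y 2) = 0 := by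
    linear_combination q 0 * e0 + q 1 * e1 + q 2 * e2 + (1 / σ) * hq1
  have hmem := Finset.centerMass_mem_convexHull (R := ℝ) Finset.univ (w := w) (z := p)
    (fun i _ => hw i) hsum (fun i _ => Set.mem_range_self i)
  convert hmem using 1
  rw [Finset.centerMass, eq_inv_smul_iff₀ hsum.ne', Fin.sum_univ_three, Fin.sum_univ_three,
    hp 0, hp 1, hp 2]
  ext i
  fin_cases i
  · simp only [rotPoint, Pi.add_apply, Pi.smul_apply, smul_eq_mul, Fin.zero_eta,
      Matrix.cons_val_zero]
    linear_combination sin θ * hwY - cos θ * hwX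
  · simp only [rotPoint, Pi.add_apply, Pi.smul_apply, smul_eq_mul, Fin.mk_one,
      Matrix.cons_val_one, Matrix.cons_val_fin_one]
    linear_combination -cos θ * hwY - sin θ * hwX

section Cells

variable {Ω : Type*} [MeasurableSpace Ω] {Q : Measure Ω} [IsProbabilityMeasure Q]

theorem measureReal_inter_swap_left {E : Set (Ω × Ω × Ω)}
    (hE : ∀ x y w, (x, y, w) ∈ E → (y, x, w) ∈ E) (A B C : Set Ω) :
    (Q.prod (Q.prod Q)).real (A ×ˢ B ×ˢ C ∩ E) = (Q.prod (Q.prod Q)).real (B ×ˢ A ×ˢ C ∩ E) := by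
  let e : Ω × Ω × Ω ≃ᵐ Ω × Ω × Ω := (MeasurableEquiv.prodAssoc.symm.trans
    (MeasurableEquiv.prodComm.prodCongr (MeasurableEquiv.refl Ω))).trans MeasurableEquiv.prodAssoc
  have he : MeasurePreserving e (Q.prod (Q.prod Q)) (Q.prod (Q.prod Q)) :=
    (measurePreserving_prodAssoc Q Q Q).comp
      ((Measure.measurePreserving_swap.prod (MeasurePreserving.id Q)).comp
        ((measurePreserving_prodAssoc Q Q Q).symm _))
  rw [measureReal_def, ← he.measure_preimage_equiv, ← measureReal_def]
  congr 1
  ext ⟨x, y, w⟩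
  change (((y ∈ A ∧ x ∈ B ∧ w ∈ C) ∧ (y, x, w) ∈ E) ↔ ((x ∈ B ∧ y ∈ A ∧ w ∈ C) ∧ (x, y, w) ∈ E))
  have := hE x y w
  have := hE y x w
  tauto

theorem measureReal_inter_swap_right {E : Set (Ω × Ω × Ω)}
    (hE : ∀ x y w, (x, y, w) ∈ E → (x, w, y) ∈ E) (A B C : Set Ω) :
    (Q.prod (Q.prod Q)).real (A ×ˢ B ×ˢ C ∩ E) = (Q.prod (Q.prod Q)).real (A ×ˢ C ×ˢ B ∩ E) := by
  let e : Ω × Ω × Ω ≃ᵐ Ω × Ω × Ω := (MeasurableEquiv.refl Ω).prodCongr MeasurableEquiv.prodComm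
  have he : MeasurePreserving e (Q.prod (Q.prod Q)) (Q.prod (Q.prod Q)) :=
    (MeasurePreserving.id Q).prod Measure.measurePreserving_swap
  rw [measureReal_def, ← he.measure_preimage_equiv, ← measureReal_def]
  congr 1
  ext ⟨x, y, w⟩
  change (((x ∈ A ∧ w ∈ B ∧ y ∈ C) ∧ (x, w, y) ∈ E) ↔ ((x ∈ A ∧ y ∈ C ∧ w ∈ B) ∧ (x, y, w) ∈ E))
  have := hE x y w
  have := hE x w y
  tauto

variable {S : Fin 3 → Bool → Set Ω} {q : Ω → ℝ} {E : Set (Ω × Ω × Ω)}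

/-- The pairs in `S c b × S c (!b)` split by the order of their slopes; each part completes to
triples of `E` with one of the two cells of slope class `d`. -/
theorem le_measureReal_pair_class (hS : ∀ i b, MeasurableSet (S i b))
    (hQ : ∀ i b, Q.real (S i b) = 1 / 6)
    (hdisj : ∀ i b j b', (i, b) ≠ (j, b') → Disjoint (S i b) (S j b')) (hqm : Measurable q)
    (hq : ∀ i j b b' x y, i < j → x ∈ S i b → y ∈ S j b' → q y ≤ q x)
    (hsymm : ∀ x y w, (x, y, w) ∈ E → (y, x, w) ∈ E)
    (hsymm' : ∀ x y w, (x, y, w) ∈ E → (x, w, y) ∈ E)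
    (hE : ∀ i j k b x y w, x ∈ S i b → y ∈ S j (!b) → w ∈ S k b → q y ≤ q x → q w ≤ q y →
      (x, y, w) ∈ E) {c d : Fin 3} (hcd : d ≠ c) (b : Bool) :
    1 / 216 ≤ (Q.prod (Q.prod Q)).real
      ((S d true ∪ S d false) ×ˢ S c b ×ˢ S c (!b) ∩ E) := by
  have hmR : MeasurableSet (S c b ×ˢ S c (!b)) := (hS c b).prod (hS c !b)
  let V : Set (Ω × Ω) := {y | q y.2 ≤ q y.1}
  have hmV : MeasurableSet V :=
    measurableSet_le (hqm.comp measurable_snd) (hqm.comp measurable_fst)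
  have hU : ∀ β : Bool, S d β ⊆ S d true ∪ S d false := fun β => by
    cases β
    exacts [Set.subset_union_right, Set.subset_union_left]
  obtain ⟨β, hβ, hβ'⟩ : ∃ β, (∀ x y w, x ∈ S d β → y ∈ S c b → w ∈ S c (!b) → q w ≤ q y →
      (x, y, w) ∈ E) ∧ (∀ x y w, x ∈ S d (!β) → y ∈ S c b → w ∈ S c (!b) → q y ≤ q w →
      (x, y, w) ∈ E) := by
    rcases lt_or_gt_of_ne hcd with h | h
    · refine ⟨!b, fun x y w hx hy hw hyw => ?_, fun x y w hx hy hw hyw => ?_⟩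
      · exact hE d c c _ x y w hx (by simpa using hy) hw (hq _ _ _ _ _ _ h hx hy) hyw
      · rw [Bool.not_not] at hx
        exact hsymm' _ _ _ (hE d c c _ x w y hx hw hy (hq _ _ _ _ _ _ h hx hw) hyw)
    · refine ⟨b, fun x y w hx hy hw hyw => ?_, fun x y w hx hy hw hyw => ?_⟩
      · exact hsymm _ _ _ (hsymm' _ _ _ (hE c c d _ y w x hy hw hx hyw (hq _ _ _ _ _ _ h hw hx)))
      · exact hsymm _ _ _ (hsymm' _ _ _ (hsymm _ _ _
          (hE c c d _ w y x hw (by simpa using hy) hx hyw (hq _ _ _ _ _ _ h hy hx))))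
  have hsub : S d β ×ˢ (S c b ×ˢ S c (!b) ∩ V) ∪ S d (!β) ×ˢ ((S c b ×ˢ S c (!b)) \ V) ⊆
      (S d true ∪ S d false) ×ˢ S c b ×ˢ S c (!b) ∩ E := by
    rintro ⟨x, y, w⟩ (⟨hx, ⟨hy, hw⟩, hyw⟩ | ⟨hx, ⟨hy, hw⟩, hyw⟩)
    · exact ⟨⟨hU _ hx, hy, hw⟩, hβ _ _ _ hx hy hw hyw⟩
    · exact ⟨⟨hU _ hx, hy, hw⟩, hβ' _ _ _ hx hy hw (not_le.1 hyw).le⟩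
  refine le_trans (le_of_eq ?_) (measureReal_mono hsub)
  rw [measureReal_union _ ((hS d !β).prod (hmR.diff hmV)), measureReal_prod_prod,
    measureReal_prod_prod, hQ, hQ, ← mul_add, measureReal_inter_add_sdiff (ht := hmV),
    measureReal_prod_prod, hQ, hQ]
  · norm_num
  · exact Set.disjoint_prod.2 (Or.inl (hdisj _ _ _ _ (by simp)))

/-- If three concurrent lines cut a probability measure into six equal sectors, grouped here into
three slope classes of two opposite sectors each, then triples whose signs alternate in the
order of slopes have probability at least `2 / 9`. -/
theorem two_ninths_le_measureReal_of_cells (hS : ∀ i b, MeasurableSet (S i b))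
    (hQ : ∀ i b, Q.real (S i b) = 1 / 6)
    (hdisj : ∀ i b j b', (i, b) ≠ (j, b') → Disjoint (S i b) (S j b')) (hqm : Measurable q)
    (hq : ∀ i j b b' x y, i < j → x ∈ S i b → y ∈ S j b' → q y ≤ q x)
    (hsymm : ∀ x y w, (x, y, w) ∈ E → (y, x, w) ∈ E)
    (hsymm' : ∀ x y w, (x, y, w) ∈ E → (x, w, y) ∈ E)
    (hE : ∀ i j k b x y w, x ∈ S i b → y ∈ S j (!b) → w ∈ S k b → q y ≤ q x → q w ≤ q y →
      (x, y, w) ∈ E) :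
    2 / 9 ≤ (Q.prod (Q.prod Q)).real E := by
  let T : Fin 3 → Set Ω := fun i => S i true ∪ S i false
  have hT : ∀ i, MeasurableSet (T i) := fun i => (hS i true).union (hS i false)
  have hTd : ∀ i j, i ≠ j → Disjoint (T i) (T j) := fun i j h => by
    simp only [T, Set.disjoint_union_left, Set.disjoint_union_right]
    refine ⟨⟨?_, ?_⟩, ?_, ?_⟩ <;> exact hdisj _ _ _ _ (by simp [h])
  let M : Measure (Ω × Ω × Ω) := (Q.prod (Q.prod Q)).restrict E
  let m : Fin 3 → Fin 3 → Fin 3 → ℝ := fun i j k => M.real (T i ×ˢ T j ×ˢ T k)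
  have hTTT : ∀ i j k, MeasurableSet (T i ×ˢ T j ×ˢ T k) := fun i j k =>
    (hT i).prod ((hT j).prod (hT k))
  have hm : ∀ i j k, m i j k = (Q.prod (Q.prod Q)).real (T i ×ˢ T j ×ˢ T k ∩ E) := fun i j k =>
    measureReal_restrict_apply (hTTT i j k)
  have hleft : ∀ i j k, m i j k = m j i k := fun i j k => by
    rw [hm, hm, measureReal_inter_swap_left hsymm]
  have hright : ∀ i j k, m i j k = m i k j := fun i j k => by
    rw [hm, hm, measureReal_inter_swap_right hsymm']
  have htwo : ∀ (A : Bool → Set (Ω × Ω × Ω)) (i j k : Fin 3), (∀ b, MeasurableSet (A b)) →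
      Disjoint (A true) (A false) → (∀ b, A b ⊆ T i ×ˢ T j ×ˢ T k) →
      (∀ b, 1 / 216 ≤ (Q.prod (Q.prod Q)).real (A b ∩ E)) → 1 / 108 ≤ m i j k := by
    intro A i j k hA hAd hsub hle
    have h1 : M.real (A true ∪ A false) = M.real (A true) + M.real (A false) :=
      measureReal_union hAd (hA false)
    have h2 : M.real (A true ∪ A false) ≤ m i j k :=
      measureReal_mono (Set.union_subset (hsub true) (hsub false))
    have h3 := hle true
    have h4 := hle false
    rw [← measureReal_restrict_apply (hA _)] at h3 h4
    change _ ≤ M.real _ at h3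
    change _ ≤ M.real _ at h4
    linarith
  have hST : ∀ i b, S i b ⊆ T i := fun i b => by
    cases b
    exacts [Set.subset_union_right, Set.subset_union_left]
  have hpair : ∀ d c, d ≠ c → 1 / 108 ≤ m d c c := fun d c hdc => by
    refine htwo (fun b => T d ×ˢ S c b ×ˢ S c (!b)) d c c
      (fun b => (hT d).prod ((hS c b).prod (hS c !b))) ?_
      (fun b => Set.prod_mono le_rfl (Set.prod_mono (hST _ _) (hST _ _)))
      (fun b => le_measureReal_pair_class hS hQ hdisj hqm hq hsymm hsymm' hE hdc b)
    exact Set.disjoint_prod.2 (Or.inr (Set.disjoint_prod.2 (Or.inl (hdisj _ _ _ _ (by simp)))))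
  have hdistinct : 1 / 108 ≤ m 0 1 2 := by
    refine htwo (fun b => S 0 b ×ˢ S 1 (!b) ×ˢ S 2 b) 0 1 2
      (fun b => (hS _ _).prod ((hS _ _).prod (hS _ _)))
      (Set.disjoint_prod.2 (Or.inl (hdisj _ _ _ _ (by simp))))
      (fun b => Set.prod_mono (hST _ _) (Set.prod_mono (hST _ _) (hST _ _))) (fun b => ?_)
    rw [Set.inter_eq_left.2, measureReal_prod_prod, measureReal_prod_prod, hQ, hQ, hQ]
    · norm_num
    · rintro ⟨x, y, w⟩ ⟨hx, hy, hw⟩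
      exact hE 0 1 2 b x y w hx hy hw (hq _ _ _ _ _ _ (by decide) hx hy)
        (hq _ _ _ _ _ _ (by decide) hy hw)
  have hall : ∀ i j k, (if i = j ∧ j = k then 0 else 1 / 108) ≤ m i j k := by
    intro i j k
    split_ifs with h
    · exact measureReal_nonneg
    by_cases hjk : j = k
    · subst hjk
      exact hpair i j fun h' => h ⟨h', rfl⟩
    by_cases hij : i = j
    · subst hij
      rw [hright, hleft]
      exact hpair k i (Ne.symm hjk)
    by_cases hik : i = k
    · subst hik
      rw [hleft]
      exact hpair j i (Ne.symm hij)
    fin_cases i <;> fin_cases j <;> fin_cases k <;> simp at hij hjk hik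
    · exact hdistinct
    · rw [hright]; exact hdistinct
    · rw [hleft]; exact hdistinct
    · rw [hright, hleft]; exact hdistinct
    · rw [hleft, hright]; exact hdistinct
    · rw [hleft, hright, hleft]; exact hdistinct
  have hsum : ∑ ι : Fin 3 × Fin 3 × Fin 3, m ι.1 ι.2.1 ι.2.2 ≤ (Q.prod (Q.prod Q)).real E := by
    have h1 : M.real (⋃ ι ∈ (Finset.univ : Finset (Fin 3 × Fin 3 × Fin 3)),
        T ι.1 ×ˢ T ι.2.1 ×ˢ T ι.2.2) = ∑ ι : Fin 3 × Fin 3 × Fin 3, m ι.1 ι.2.1 ι.2.2 := by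
      refine measureReal_biUnion_finset ?_ fun ι _ => hTTT _ _ _
      rintro ⟨i, j, k⟩ - ⟨i', j', k'⟩ - h
      change Disjoint (T i ×ˢ T j ×ˢ T k) (T i' ×ˢ T j' ×ˢ T k')
      rw [Set.disjoint_prod, Set.disjoint_prod]
      by_contra! hn
      refine h ?_
      rw [not_imp_comm.1 (hTd i i') hn.1, not_imp_comm.1 (hTd j j') hn.2.1,
        not_imp_comm.1 (hTd k k') hn.2.2]
    rw [← h1]
    exact (measureReal_mono (Set.subset_univ _)).trans_eq (measureReal_restrict_apply_univ _)
  refine le_trans ?_ hsum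
  refine le_trans ?_ (Finset.sum_le_sum fun ι _ => hall ι.1 ι.2.1 ι.2.2)
  simp only [Fintype.sum_prod_type, Fin.sum_univ_three, Fin.ext_iff]
  norm_num

end Cells

/-- The range of `q` is cut at `u < t` into an upper, a middle and a lower part. -/
def cutClass {α : Type*} (q : α → ℝ) (t u : ℝ) : Fin 3 → Set α :=
  ![{p | t < q p}, {p | q p ≤ t ∧ u < q p}, {p | q p ≤ u}]

theorem measurableSet_cutClass {α : Type*} [MeasurableSpace α] {q : α → ℝ} (hq : Measurable q)
    (t u : ℝ) (i : Fin 3) : MeasurableSet (cutClass q t u i) := by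
  have h1 : ∀ a, MeasurableSet {p | a < q p} := fun a => measurableSet_lt measurable_const hq
  have h2 : ∀ a, MeasurableSet {p | q p ≤ a} := fun a => measurableSet_le hq measurable_const
  fin_cases i
  exacts [h1 t, (h2 t).inter (h1 u), h2 u]

theorem le_of_mem_cutClass {α : Type*} {q : α → ℝ} {t u : ℝ} (hut : u < t) {i j : Fin 3}
    (hij : i < j) {x y : α} (hx : x ∈ cutClass q t u i) (hy : y ∈ cutClass q t u j) :
    q y < q x := by
  fin_cases i <;> fin_cases j <;> simp [cutClass] at hij hx hy <;> linarith

theorem disjoint_cutClass {α : Type*} {q : α → ℝ} {t u : ℝ} (hut : u < t) {i j : Fin 3}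
    (hij : i ≠ j) : Disjoint (cutClass q t u i) (cutClass q t u j) := by
  refine Set.disjoint_left.2 fun x hx hy => ?_
  rcases hij.lt_or_gt with h | h
  exacts [(le_of_mem_cutClass hut h hx hy).false, (le_of_mem_cutClass hut h hy hx).false]

theorem measureReal_inter_cutClass {α : Type*} [MeasurableSpace α] {μ : Measure α}
    [IsFiniteMeasure μ] {A : Set α} {q : α → ℝ} (hq : Measurable q) {t u : ℝ} (hut : u < t)
    (hA : μ.real A = 1 / 2) (ht : μ.real {p | p ∈ A ∧ t < q p} = 1 / 6)
    (hu : μ.real {p | p ∈ A ∧ u < q p} = 1 / 3) (i : Fin 3) :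
    μ.real (A ∩ cutClass q t u i) = 1 / 6 := by
  have hm : ∀ a, MeasurableSet {p | a < q p} := fun a => measurableSet_lt measurable_const hq
  fin_cases i
  · exact ht
  · have h := measureReal_inter_add_sdiff (μ := μ) (s := {p | p ∈ A ∧ u < q p}) (hm t)
    have h1 : {p | p ∈ A ∧ u < q p} ∩ {p | t < q p} = {p | p ∈ A ∧ t < q p} := by
      ext p
      exact ⟨fun h => ⟨h.1.1, h.2⟩, fun h => ⟨⟨h.1, hut.trans h.2⟩, h.2⟩⟩
    have h2 : {p | p ∈ A ∧ u < q p} \ {p | t < q p} = A ∩ {p | q p ≤ t ∧ u < q p} := by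
      ext p
      exact ⟨fun h => ⟨h.1.1, not_lt.1 h.2, h.1.2⟩, fun h => ⟨⟨h.1, h.2.2⟩, not_lt.2 h.2.1⟩⟩
    rw [h1, h2, ht, hu] at h
    change μ.real (A ∩ {p | q p ≤ t ∧ u < q p}) = 1 / 6
    linarith
  · have h := measureReal_inter_add_sdiff (μ := μ) (s := A) (hm u)
    have h2 : A \ {p | u < q p} = A ∩ {p | q p ≤ u} := by
      ext p
      simp
    change μ.real {p | p ∈ A ∧ u < q p} + _ = _ at h
    rw [h2, hA, hu] at h
    change μ.real (A ∩ {p | q p ≤ u}) = 1 / 6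
    linarith

theorem exists_two_ninths_le_measureReal_mem_convexHull {Ω : Type*} [MeasurableSpace Ω]
    {Q : Measure Ω} [IsProbabilityMeasure Q] {T : Ω → Fin 2 → ℝ} (hT : Measurable T)
    [(Q.map T).IsOpenPosMeasure] (hac : Q.map T ≪ volume) :
    ∃ z, 2 / 9 ≤ (Q.prod (Q.prod Q)).real
      {ω | z ∈ convexHull ℝ {T ω.1, T ω.2.1, T ω.2.2}} := by
  have : IsProbabilityMeasure (Q.map T) := Measure.isProbabilityMeasure_map hT.aemeasurable
  obtain ⟨θ, s, c, t, u, hut, hp, hpt, hpu, hn, hnt, hnu⟩ := exists_six_sector_equipartition hac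
  let σ : Bool → ℝ := fun b => if b then 1 else -1
  let A : Bool → Set (Fin 2 → ℝ) := fun b => {p | 0 < σ b * (rotY θ p - c)}
  let q : (Fin 2 → ℝ) → ℝ := fun p => (rotX θ p - s) / (rotY θ p - c)
  have hqm : Measurable q :=
    Measurable.div (Continuous.measurable (by fun_prop)) (Continuous.measurable (by fun_prop))
  have hAm : ∀ b, MeasurableSet (A b) := fun b =>
    (isOpen_lt (by fun_prop) (by fun_prop)).measurableSet
  have hSm : ∀ i b, MeasurableSet (A b ∩ cutClass q t u i) := fun i b =>
    (hAm b).inter (measurableSet_cutClass hqm t u i)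
  have hAneg : ∀ b p, p ∈ A b → σ (!b) * (rotY θ p - c) < 0 := by
    rintro (_ | _) p h <;> simp [A, σ] at h ⊢ <;> linarith
  have hAtrue : A true = {p | 0 < rotY θ p - c} := by simp [A, σ]
  have hAfalse : A false = {p | rotY θ p - c < 0} := by simp [A, σ]
  refine ⟨rotPoint θ s c, two_ninths_le_measureReal_of_cells
    (S := fun i b => T ⁻¹' (A b ∩ cutClass q t u i)) (q := fun ω => q (T ω))
    (fun i b => hT (hSm i b)) (fun i b => ?_) (fun i b j b' h => ?_) (hqm.comp hT)
    (fun i j b b' x y hij hx hy => (le_of_mem_cutClass hut hij hx.2 hy.2).le)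
    (fun x y w h => ?_) (fun x y w h => ?_) (fun i j k b x y w hx hy hw hyx hwy => ?_)⟩
  · rw [← map_measureReal_apply hT (hSm i b)]
    cases b
    · refine measureReal_inter_cutClass hqm hut ?_ ?_ ?_ i <;> rw [hAfalse]
      exacts [hn, hnt, hnu]
    · refine measureReal_inter_cutClass hqm hut ?_ ?_ ?_ i <;> rw [hAtrue]
      exacts [hp, hpt, hpu]
  · refine Disjoint.preimage T (Set.disjoint_left.2 fun p h1 h2 => h ?_)
    by_cases hb : b = b'
    · subst hb
      by_contra hij
      exact Set.disjoint_left.1 (disjoint_cutClass hut fun h' => hij (by rw [h'])) h1.2 h2.2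
    · obtain rfl : b = !b' := by cases b <;> cases b' <;> simp_all
      exact absurd h1.1 (hAneg _ _ h2.1).not_gt
  · rw [Set.mem_ofPred_eq, Set.insert_comm]
    exact h
  · rw [Set.mem_ofPred_eq, Set.pair_comm]
    exact h
  · have h := rotPoint_mem_convexHull_of_alternating (θ := θ) (s := s) (c := c) (σ := σ b)
      (p := ![T x, T y, T w]) hx.1 (by simpa using hAneg _ _ hy.1) hw.1 hyx hwy
    rwa [Matrix.range_cons, Matrix.range_cons, Matrix.range_cons, Matrix.range_empty,
      Set.union_empty] at h

theorem exists_two_ninths_sub_le_card_cthickening {ι : Type*} [Fintype ι] [Nonempty ι]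
    (p : ι → Fin 2 → ℝ) {r : ℝ} (hr : 0 < r) :
    ∃ z, ∃ F : Finset (ι × ι × ι), (2 / 9 - r) * (Fintype.card ι : ℝ) ^ 3 ≤ (F.card : ℝ) ∧
      ∀ f ∈ F, z ∈ Metric.cthickening r (convexHull ℝ {p f.1, p f.2.1, p f.2.2}) := by
  classical
  let _ : MeasurableSpace ι := ⊤
  let γ : Measure (Fin 2 → ℝ) := (volume : Measure (Fin 2 → ℝ)).toFinite
  have hγ : γ ≪ volume := toFinite_absolutelyContinuous _
  have hγ' : volume ≪ γ := absolutelyContinuous_toFinite _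
  have : γ.IsOpenPosMeasure := hγ'.isOpenPosMeasure
  have : IsProbabilityMeasure γ := inferInstance
  obtain ⟨K, hK⟩ : ∃ K : ℕ, γ.real {g | (K : ℝ) < ‖g‖} < r / 3 := by
    have h : Tendsto (fun K : ℕ => γ.real {g | (K : ℝ) < ‖g‖}) atTop (𝓝 (γ.real ∅)) := by
      refine tendsto_measureReal_of_ae_eventually_mem_iff
        (fun K => (isOpen_lt (by fun_prop) (by fun_prop)).measurableSet) MeasurableSet.empty
        (ae_of_all _ fun g => ?_)
      filter_upwards [eventually_ge_atTop ⌈‖g‖⌉₊] with K hK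
      simpa using Nat.ceil_le.1 hK
    rw [measureReal_empty] at h
    exact (h.eventually_lt_const (by positivity)).exists
  let δ : ℝ := r / (K + 1)
  have hδ : 0 < δ := by positivity
  let ν : Measure ι := (PMF.uniformOfFintype ι).toMeasure
  have hν : ∀ i, ν.real {i} = (Fintype.card ι : ℝ)⁻¹ := fun i => by
    simp [ν, measureReal_def]
  let T : ι × (Fin 2 → ℝ) → Fin 2 → ℝ := fun x => p x.1 + δ • x.2
  have hT : Measurable T := by
    have : Measurable p := measurable_from_top
    fun_prop
  let Q := ν.prod γ
  have hnull : ∀ {A : Set (Fin 2 → ℝ)}, MeasurableSet A →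
      (Q.map T A = 0 ↔ ∀ᵐ i ∂ν, γ {g | p i + δ • g ∈ A} = 0) := fun hA => by
    rw [Measure.map_apply hT hA, Measure.measure_prod_null (hT hA)]
    rfl
  have hac : Q.map T ≪ volume := by
    refine Measure.AbsolutelyContinuous.mk fun A hA h0 => (hnull hA).2 (ae_of_all _ fun i => ?_)
    refine hγ ?_
    change volume ((δ • ·) ⁻¹' ((p i + ·) ⁻¹' A)) = 0
    rw [Measure.addHaar_preimage_smul _ hδ.ne', measure_preimage_add, h0, mul_zero]
  have : (Q.map T).IsOpenPosMeasure := by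
    refine ⟨fun U hU hne h0 => ?_⟩
    obtain ⟨i, hi⟩ := ((hnull hU.measurableSet).1 h0).exists
    have hopen : IsOpen {g | p i + δ • g ∈ U} := hU.preimage (by fun_prop)
    obtain ⟨x, hx⟩ := hne
    refine (hopen.measure_pos γ ⟨δ⁻¹ • (x - p i), ?_⟩).ne' hi
    rw [Set.mem_ofPred_eq, smul_inv_smul₀ hδ.ne', add_sub_cancel]
    exact hx
  obtain ⟨z, hz⟩ := exists_two_ninths_le_measureReal_mem_convexHull hT hac
  let F : Finset (ι × ι × ι) :=
    {f | z ∈ Metric.cthickening r (convexHull ℝ {p f.1, p f.2.1, p f.2.2})}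
  refine ⟨z, F, ?_, fun f hf => (Finset.mem_filter.1 hf).2⟩
  let B : Set (ι × (Fin 2 → ℝ)) := Set.univ ×ˢ {g | (K : ℝ) < ‖g‖}
  have hB : Q.real B < r / 3 := by
    rw [measureReal_prod_prod, probReal_univ, one_mul]
    exact hK
  let R : ι × ι × ι → Set ((ι × (Fin 2 → ℝ)) × (ι × (Fin 2 → ℝ)) × (ι × (Fin 2 → ℝ))) := fun f =>
    ({f.1} ×ˢ Set.univ) ×ˢ ({f.2.1} ×ˢ Set.univ) ×ˢ ({f.2.2} ×ˢ Set.univ)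
  have hR : ∀ f, (Q.prod (Q.prod Q)).real (R f) = ((Fintype.card ι : ℝ)⁻¹) ^ 3 := fun f => by
    simp only [R, Q, measureReal_prod_prod, hν, probReal_univ]
    ring
  have hmove : ∀ {i x} {S : Set (Fin 2 → ℝ)}, (i, x) ∉ B → p i ∈ S →
      T (i, x) ∈ Metric.cthickening r (convexHull ℝ S) := by
    intro i x S hx hi
    refine Metric.mem_cthickening_of_dist_le _ (p i) _ _ (subset_convexHull ℝ _ hi) ?_
    have hx' : ‖x‖ ≤ K := by simpa [B] using hx
    rw [dist_eq_norm, add_sub_cancel_left, norm_smul, Real.norm_of_nonneg hδ.le, div_mul_eq_mul_div,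
      div_le_iff₀ (by positivity)]
    gcongr
    linarith
  have hsub : {ω | z ∈ convexHull ℝ {T ω.1, T ω.2.1, T ω.2.2}} ⊆
      (⋃ f ∈ F, R f) ∪ (B ×ˢ Set.univ ∪ (Set.univ ×ˢ (B ×ˢ Set.univ) ∪
        Set.univ ×ˢ (Set.univ ×ˢ B))) := by
    rintro ⟨⟨i, x⟩, ⟨j, y⟩, ⟨k, w⟩⟩ hω
    by_contra hn
    simp only [Set.mem_union, Set.mem_prod, Set.mem_univ, true_and, and_true, not_or] at hn
    obtain ⟨hn, hx, hy, hw⟩ := hn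
    refine hn (Set.mem_biUnion (x := (i, j, k)) (Finset.mem_coe.2 (Finset.mem_filter.2
      ⟨Finset.mem_univ _, ?_⟩)) (by simp [R]))
    refine convexHull_min ?_ ((convex_convexHull ℝ _).cthickening r) hω
    rintro _ (rfl | rfl | rfl)
    exacts [hmove hx (by simp), hmove hy (by simp), hmove hw (by simp)]
  have hle := hz.trans ((measureReal_mono hsub).trans (measureReal_union_le _ _))
  have h1 : (Q.prod (Q.prod Q)).real (⋃ f ∈ F, R f) ≤ F.card * ((Fintype.card ι : ℝ)⁻¹) ^ 3 := by
    refine (measureReal_biUnion_finset_le _ _).trans ?_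
    simp [hR]
  have h2 := (measureReal_union_le (μ := Q.prod (Q.prod Q)) (B ×ˢ Set.univ)
    (Set.univ ×ˢ (B ×ˢ Set.univ) ∪ Set.univ ×ˢ (Set.univ ×ˢ B)))
  have h3 := (measureReal_union_le (μ := Q.prod (Q.prod Q)) (Set.univ ×ˢ (B ×ˢ Set.univ))
    (Set.univ ×ˢ (Set.univ ×ˢ B)))
  simp only [measureReal_prod_prod, probReal_univ, one_mul, mul_one] at h2 h3
  have hn : (0 : ℝ) < Fintype.card ι := by exact_mod_cast Fintype.card_pos
  rw [← le_div_iff₀ (by positivity), div_eq_mul_inv (F.card : ℝ), ← inv_pow]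
  linarith

theorem exists_two_ninths_le_card_mem_convexHull {ι : Type*} [Fintype ι] [Nonempty ι]
    (p : ι → Fin 2 → ℝ) :
    ∃ z, ∃ F : Finset (ι × ι × ι), 2 / 9 * (Fintype.card ι : ℝ) ^ 3 ≤ (F.card : ℝ) ∧
      ∀ f ∈ F, z ∈ convexHull ℝ {p f.1, p f.2.1, p f.2.2} := by
  classical
  let r : ℕ → ℝ := fun k => 1 / ((k : ℝ) + 5)
  have hr : ∀ k, 0 < r k := fun k => by positivity
  have hr1 : ∀ k, r k ≤ 1 := fun k => by
    rw [div_le_one (by positivity)]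
    linarith [(Nat.cast_nonneg k : (0 : ℝ) ≤ k)]
  have hr0 : Tendsto r atTop (𝓝 0) :=
    tendsto_const_nhds.div_atTop (tendsto_natCast_atTop_atTop.atTop_add tendsto_const_nhds)
  choose z F hF hz using fun k => exists_two_ninths_sub_le_card_cthickening p (hr k)
  have hn : (0 : ℝ) < Fintype.card ι := by exact_mod_cast Fintype.card_pos
  have hC : IsCompact (Metric.cthickening 1 (convexHull ℝ (Set.range p))) :=
    ((Set.finite_range p).isCompact_convexHull ℝ).cthickening
  have hzC : ∀ k, z k ∈ Metric.cthickening 1 (convexHull ℝ (Set.range p)) := fun k => by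
    have hpos : (0 : ℝ) < (F k).card := by
      refine lt_of_lt_of_le (mul_pos ?_ (by positivity)) (hF k)
      have : r k ≤ 1 / 5 :=
        one_div_le_one_div_of_le (by norm_num) (by linarith [(Nat.cast_nonneg k : (0 : ℝ) ≤ k)])
      linarith
    obtain ⟨f, hf⟩ := Finset.card_pos.1 (Nat.cast_pos.1 hpos)
    refine Metric.cthickening_mono (hr1 k) _
      (Metric.cthickening_subset_of_subset _ (convexHull_mono ?_) (hz k f hf))
    rintro _ (rfl | rfl | rfl) <;> exact Set.mem_range_self _
  obtain ⟨x, -, φ, hφ, hx⟩ := hC.tendsto_subseq hzC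
  refine ⟨x, Finset.univ.filter fun f : ι × ι × ι =>
    x ∈ convexHull ℝ {p f.1, p f.2.1, p f.2.2}, ?_, fun f hf => (Finset.mem_filter.1 hf).2⟩
  have hev : ∀ f : ι × ι × ι, ∀ᶠ k in atTop, f ∈ F (φ k) →
      x ∈ convexHull ℝ {p f.1, p f.2.1, p f.2.2} := fun f => by
    by_cases hxf : x ∈ convexHull ℝ {p f.1, p f.2.1, p f.2.2}
    · exact Eventually.of_forall fun _ _ => hxf
    have hclosed : IsClosed (convexHull ℝ {p f.1, p f.2.1, p f.2.2}) :=
      ((Set.toFinite _).isCompact_convexHull ℝ).isClosed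
    have hxf' := hxf
    rw [← hclosed.closure_eq, Metric.closure_eq_iInter_cthickening] at hxf'
    simp only [Set.mem_iInter, not_forall] at hxf'
    obtain ⟨ε, hε, hxε⟩ := hxf'
    filter_upwards [hx.eventually (Metric.isClosed_cthickening.isOpen_compl.mem_nhds hxε),
      (hr0.comp hφ.tendsto_atTop).eventually (ge_mem_nhds hε)] with k hk hrk hf
    exact absurd (Metric.cthickening_mono hrk _ (hz _ f hf)) hk
  have hlim : Tendsto (fun k => (2 / 9 - r (φ k)) * (Fintype.card ι : ℝ) ^ 3) atTop
      (𝓝 ((2 / 9 - 0) * (Fintype.card ι : ℝ) ^ 3)) :=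
    (tendsto_const_nhds.sub (hr0.comp hφ.tendsto_atTop)).mul_const _
  rw [sub_zero] at hlim
  refine le_of_tendsto hlim ?_
  filter_upwards [eventually_all.2 hev] with k hk
  refine (hF (φ k)).trans (Nat.cast_le.2 (Finset.card_le_card fun f hf => ?_))
  exact Finset.mem_filter.2 ⟨Finset.mem_univ _, hk f hf⟩

theorem card_le_add_card_filter_pairwise_ne {α : Type*} [DecidableEq α] (P : Finset α)
    (F : Finset (α × α × α)) (hF : F ⊆ P ×ˢ P ×ˢ P) :
    F.card ≤ 3 * P.card ^ 2 +
      (F.filter fun f => f.1 ≠ f.2.1 ∧ f.1 ≠ f.2.2 ∧ f.2.1 ≠ f.2.2).card := by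
  let D : Finset (α × α × α) := (P ×ˢ P).image (fun x => (x.1, x.1, x.2)) ∪
    ((P ×ˢ P).image (fun x => (x.1, x.2, x.1)) ∪ (P ×ˢ P).image (fun x => (x.1, x.2, x.2)))
  have hD : D.card ≤ 3 * P.card ^ 2 := by
    have h : ∀ g : α × α → α × α × α, ((P ×ˢ P).image g).card ≤ P.card ^ 2 := fun g =>
      Finset.card_image_le.trans_eq (by rw [Finset.card_product, sq])
    refine (Finset.card_union_le _ _).trans ?_
    have := (Finset.card_union_le ((P ×ˢ P).image (fun x => (x.1, x.2, x.1)))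
      ((P ×ˢ P).image (fun x => (x.1, x.2, x.2))))
    have h1 := h (fun x => (x.1, x.1, x.2))
    have h2 := h (fun x => (x.1, x.2, x.1))
    have h3 := h (fun x => (x.1, x.2, x.2))
    omega
  refine le_trans (Finset.card_le_card (t := D ∪ _) ?_) ((Finset.card_union_le _ _).trans
    (Nat.add_le_add_right hD _))
  rintro ⟨x, y, w⟩ hf
  have h := hF hf
  simp only [Finset.mem_product] at h
  obtain ⟨hx, hy, hw⟩ := h
  simp only [D, Finset.mem_union, Finset.mem_image, Finset.mem_product, Prod.exists,
    Finset.mem_filter, Prod.mk.injEq]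
  by_cases h1 : x = y
  · exact Or.inl (Or.inl ⟨x, w, ⟨hx, hw⟩, rfl, h1, rfl⟩)
  by_cases h2 : x = w
  · exact Or.inl (Or.inr (Or.inl ⟨x, y, ⟨hx, hy⟩, rfl, rfl, h2⟩))
  by_cases h3 : y = w
  · exact Or.inl (Or.inr (Or.inr ⟨x, y, ⟨hx, hy⟩, rfl, rfl, h3⟩))
  exact Or.inr ⟨hf, h1, h2, h3⟩

theorem card_pairwise_ne_le_six_mul {α : Type*} [DecidableEq α] {F : Finset (α × α × α)}
    (hF : ∀ f ∈ F, f.1 ≠ f.2.1 ∧ f.1 ≠ f.2.2 ∧ f.2.1 ≠ f.2.2) :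
    F.card ≤ 6 * (F.image fun f => ({f.1, f.2.1, f.2.2} : Finset α)).card := by
  refine Finset.card_le_mul_card_image F 6 fun S hS => ?_
  obtain ⟨⟨a, b, c⟩, hf, rfl⟩ := Finset.mem_image.1 hS
  refine (Finset.card_le_card (t := {(a, b, c), (a, c, b), (b, a, c), (b, c, a), (c, a, b),
    (c, b, a)}) ?_).trans Finset.card_le_six
  rintro ⟨x, y, w⟩ hf'
  obtain ⟨hf', he⟩ := Finset.mem_filter.1 hf'
  obtain ⟨h1, h2, h3⟩ := hF _ hf'
  have hx : x ∈ ({a, b, c} : Finset α) := he ▸ by simp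
  have hy : y ∈ ({a, b, c} : Finset α) := he ▸ by simp
  have hw : w ∈ ({a, b, c} : Finset α) := he ▸ by simp
  simp only [Finset.mem_insert, Finset.mem_singleton, Prod.mk.injEq] at hx hy hw ⊢
  rcases hx with rfl | rfl | rfl <;> rcases hy with rfl | rfl | rfl <;>
    rcases hw with rfl | rfl | rfl <;> simp_all

theorem exists_two_ninths_cube_le_ncard (P : Finset (Fin 2 → ℝ)) (hP : P.Nonempty) :
    ∃ z : Fin 2 → ℝ, 2 / 9 * (P.card : ℝ) ^ 3 ≤ 3 * (P.card : ℝ) ^ 2 +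
      6 * ({S : Finset (Fin 2 → ℝ) | S ⊆ P ∧ S.card = 3 ∧
        z ∈ convexHull ℝ (S : Set (Fin 2 → ℝ))}).ncard := by
  have : Nonempty P := hP.to_subtype
  obtain ⟨z, F, hF, hz⟩ := exists_two_ninths_le_card_mem_convexHull (Subtype.val : P → Fin 2 → ℝ)
  refine ⟨z, ?_⟩
  let g : P × P × P → (Fin 2 → ℝ) × (Fin 2 → ℝ) × (Fin 2 → ℝ) :=
    Prod.map Subtype.val (Prod.map Subtype.val Subtype.val)
  have hg : Function.Injective g :=
    Subtype.val_injective.prodMap (Subtype.val_injective.prodMap Subtype.val_injective)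
  rw [Fintype.card_coe, ← Finset.card_image_of_injective F hg] at hF
  have hFP : F.image g ⊆ P ×ˢ P ×ˢ P := by
    refine Finset.image_subset_iff.2 fun f _ => ?_
    simp only [g, Finset.mem_product]
    exact ⟨f.1.2, f.2.1.2, f.2.2.2⟩
  have h1 := card_le_add_card_filter_pairwise_ne P _ hFP
  have h2 := card_pairwise_ne_le_six_mul (F := (F.image g).filter fun f =>
    f.1 ≠ f.2.1 ∧ f.1 ≠ f.2.2 ∧ f.2.1 ≠ f.2.2) fun f hf => (Finset.mem_filter.1 hf).2
  have hfin : ({S : Finset (Fin 2 → ℝ) | S ⊆ P ∧ S.card = 3 ∧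
      z ∈ convexHull ℝ (S : Set (Fin 2 → ℝ))}).Finite :=
    P.powerset.finite_toSet.subset fun S hS => Finset.mem_coe.2 (Finset.mem_powerset.2 hS.1)
  have h3 : (((F.image g).filter fun f => f.1 ≠ f.2.1 ∧ f.1 ≠ f.2.2 ∧ f.2.1 ≠ f.2.2).image
      fun f => ({f.1, f.2.1, f.2.2} : Finset (Fin 2 → ℝ))).card ≤
      ({S : Finset (Fin 2 → ℝ) | S ⊆ P ∧ S.card = 3 ∧
        z ∈ convexHull ℝ (S : Set (Fin 2 → ℝ))}).ncard := by
    rw [← Set.ncard_coe_finset]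
    refine Set.ncard_le_ncard (fun S hS => ?_) hfin
    obtain ⟨f, hf, rfl⟩ := Finset.mem_image.1 (Finset.mem_coe.1 hS)
    obtain ⟨hf, hne1, hne2, hne3⟩ := Finset.mem_filter.1 hf
    have hfP := hFP hf
    obtain ⟨f', hf', rfl⟩ := Finset.mem_image.1 hf
    simp only [Finset.mem_product] at hfP
    refine ⟨?_, Finset.card_eq_three.2 ⟨_, _, _, hne1, hne2, hne3, rfl⟩, ?_⟩
    · simp only [Finset.insert_subset_iff, Finset.singleton_subset_iff]
      exact hfP
    · rw [Finset.coe_insert, Finset.coe_insert, Finset.coe_singleton]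
      exact hz f' hf'
  have h : ((F.image g).card : ℝ) ≤ ((3 * P.card ^ 2 + 6 * ({S : Finset (Fin 2 → ℝ) |
      S ⊆ P ∧ S.card = 3 ∧ z ∈ convexHull ℝ (S : Set (Fin 2 → ℝ))}).ncard : ℕ) : ℝ) :=
    Nat.cast_le.2 (by omega)
  push_cast at h
  exact hF.trans h

end

/-- Boros–Füredi: for every `ε > 0` there is `N` such that for all
`n ≥ N` and every set `P` of `n` points in the plane, some point `z ∈ ℝ²` lies in the
convex hull of at least `(2/9 - ε)·C(n,3)` of the 3-element subsets of `P`. -/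
theorem boros_furedi (ε : ℝ) (hε : 0 < ε) :
    ∃ N : ℕ, ∀ n : ℕ, N ≤ n →
      ∀ P : Finset (Fin 2 → ℝ), P.card = n →
        ∃ z : Fin 2 → ℝ,
          (2 / 9 - ε) * (n.choose 3 : ℝ) ≤
            ({S : Finset (Fin 2 → ℝ) | S ⊆ P ∧ S.card = 3 ∧
                z ∈ convexHull ℝ (S : Set (Fin 2 → ℝ))}).ncard := by
  refine ⟨⌈3 / ε⌉₊, ?_⟩
  rintro _ hn P rfl
  have hn' : 3 / ε ≤ P.card := Nat.ceil_le.1 hn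
  rw [div_le_iff₀ hε] at hn'
  have hP : P.Nonempty := by
    rw [Finset.nonempty_iff_ne_empty]
    rintro rfl
    norm_num at hn'
  obtain ⟨z, hz⟩ := exists_two_ninths_cube_le_ncard P hP
  refine ⟨z, ?_⟩
  have hchoose : (P.card.choose 3 : ℝ) ≤ (P.card : ℝ) ^ 3 / 6 := by
    simpa [Nat.factorial] using Nat.choose_le_pow_div (α := ℝ) 3 P.card
  rcases le_total (2 / 9 - ε) 0 with h | h
  · exact (mul_nonpos_of_nonpos_of_nonneg h (Nat.cast_nonneg _)).trans (Nat.cast_nonneg _)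
  · have h1 := mul_le_mul_of_nonneg_left hchoose h
    have h2 := mul_le_mul_of_nonneg_right hn' (sq_nonneg (P.card : ℝ))
    linarith
end

section
/- Let X = (V,E) be a finite connected simple graph with |V| ≥ 2, and let f : |X| → ℝ be a continuous map on its geometric realization. Then there exists z ∈ ℝ such that z ∈ f(|e|) for at least h(X)·⌊|V|/2⌋ of the edges e ∈ E. -/
open Finset
open scoped Classical

/-- The Cheeger constant of a finite graph: the minimum of `|E(A,B)|/min(|A|,|B|)`
over partitions `V = A ∪ B` into two nonempty disjoint sets. -/
noncomputable def cheegerConst {V : Type} [Fintype V] [DecidableEq V]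
    (G : SimpleGraph V) [DecidableRel G.Adj] : ℝ :=
  sInf {r : ℝ | ∃ A B : Finset V, A.Nonempty ∧ B.Nonempty ∧ Disjoint A B ∧
      A ∪ B = Finset.univ ∧
      r = (((A ×ˢ B).filter fun p => G.Adj p.1 p.2).card : ℝ) /
        min (A.card : ℝ) (B.card : ℝ)}

/-- The geometric realization of a graph viewed as a 1-dimensional simplicial complex:
convex coefficient vectors supported on a vertex or on an edge. -/
def graphRealization {V : Type} [Fintype V] (G : SimpleGraph V) : Set (V → ℝ) :=
  {x | (∀ v, 0 ≤ x v) ∧ (∑ v, x v) = 1 ∧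
    ((Finset.univ.filter fun v => x v ≠ 0).card ≤ 1 ∨
      ∃ u w : V, G.Adj u w ∧ (Finset.univ.filter fun v => x v ≠ 0) = {u, w})}

/-- `|e|`: the points of the realization supported on the edge `e`. -/
def edgeReal {V : Type} [Fintype V] (G : SimpleGraph V) (e : Sym2 V) : Set (V → ℝ) :=
  {x ∈ graphRealization G | ∀ v, x v ≠ 0 → v ∈ e}

/-- For any real function on a finite type, there is a set of any prescribed size consisting of
points with the smallest values. -/
theorem exists_finset_card_eq_forall_le {V : Type} [Fintype V] (g : V → ℝ) (k : ℕ)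
    (hk : k ≤ Fintype.card V) :
    ∃ A : Finset V, A.card = k ∧ ∀ a ∈ A, ∀ b ∉ A, g a ≤ g b := by
  induction k with
  | zero => exact ⟨∅, by simp⟩
  | succ k ih =>
    obtain ⟨A, hA, hle⟩ := ih (by omega)
    have hne : (Aᶜ).Nonempty := by
      rw [← Finset.card_pos, Finset.card_compl]
      omega
    obtain ⟨m, hm, hmin⟩ := Finset.exists_min_image Aᶜ g hne
    rw [Finset.mem_compl] at hm
    refine ⟨insert m A, by rw [Finset.card_insert_of_notMem hm, hA], ?_⟩
    intro a ha b hb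
    rw [Finset.mem_insert, not_or] at hb
    rcases Finset.mem_insert.1 ha with rfl | ha
    · exact hmin b (Finset.mem_compl.2 hb.2)
    · exact hle a ha b hb.2

/-- The straight segment between two adjacent vertices lies in the realization of their edge. -/
theorem segment_subset_edgeReal {V : Type} [Fintype V] [DecidableEq V] (G : SimpleGraph V) {u w : V}
    (h : G.Adj u w) :
    segment ℝ (Pi.single u 1 : V → ℝ) (Pi.single w 1) ⊆ edgeReal G s(u, w) := by
  rintro x ⟨a, b, ha, hb, hab, rfl⟩
  have hsupp : ∀ v, (a • Pi.single u 1 + b • Pi.single w 1 : V → ℝ) v ≠ 0 →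
      v = u ∨ v = w := by
    intro v hv
    by_contra! hne
    simp [hne.1, hne.2] at hv
  refine ⟨⟨fun v => ?_, ?_, ?_⟩, fun v hv => Sym2.mem_iff.2 (hsupp v hv)⟩
  · simp only [Pi.add_apply, Pi.smul_apply, smul_eq_mul, Pi.single_apply]
    positivity
  · simpa [Finset.sum_add_distrib, ← Finset.mul_sum] using hab
  · by_cases heq : (Finset.univ.filter fun v =>
        (a • Pi.single u 1 + b • Pi.single w 1 : V → ℝ) v ≠ 0) = {u, w}
    · exact Or.inr ⟨u, w, h, by convert heq⟩
    · have hlt := Finset.card_lt_card (Finset.ssubset_iff_subset_ne.2 ⟨fun v hv => by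
        simpa using hsupp v (Finset.mem_filter.1 hv).2, heq⟩)
      have := Finset.card_le_two (a := u) (b := w)
      exact Or.inl (by omega)

/-- On an edge, a continuous function attains every value between its values at the endpoints. -/
theorem mem_image_edgeReal {V : Type} [Fintype V] [DecidableEq V] (G : SimpleGraph V) {u w : V}
    (h : G.Adj u w) {f : (V → ℝ) → ℝ} (hf : ContinuousOn f (graphRealization G)) {z : ℝ}
    (hu : f (Pi.single u 1) ≤ z) (hw : z ≤ f (Pi.single w 1)) :
    z ∈ f '' edgeReal G s(u, w) := by
  have hsub := segment_subset_edgeReal G h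
  have hcont : ContinuousOn f (segment ℝ (Pi.single u 1 : V → ℝ) (Pi.single w 1)) :=
    hf.mono (hsub.trans fun _ hx => hx.1)
  exact Set.image_mono hsub ((convex_segment _ _).isPreconnected.intermediate_value
    (left_mem_segment ℝ _ _) (right_mem_segment ℝ _ _) hcont ⟨hu, hw⟩)

/-- The Cheeger constant times the size of the smaller part bounds the size of every cut. -/
theorem cheegerConst_mul_min_le {V : Type} [Fintype V] [DecidableEq V]
    (G : SimpleGraph V) [DecidableRel G.Adj] {A : Finset V} (hA : A.Nonempty)
    (hAc : Aᶜ.Nonempty) :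
    cheegerConst G * min (A.card : ℝ) (Aᶜ.card : ℝ) ≤
      ((A ×ˢ Aᶜ).filter fun p => G.Adj p.1 p.2).card := by
  have hpos : 0 < min (A.card : ℝ) (Aᶜ.card : ℝ) :=
    lt_min (by exact_mod_cast hA.card_pos) (by exact_mod_cast hAc.card_pos)
  rw [← le_div_iff₀ hpos]
  refine csInf_le ⟨0, ?_⟩ ⟨A, Aᶜ, hA, hAc, disjoint_compl_right, Finset.union_compl A, rfl⟩
  rintro r ⟨B, C, -, -, -, -, rfl⟩
  positivity

/-- for a finite connected graph `X` with `|V| ≥ 2` and any continuous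
`f : |X| → ℝ`, some `z ∈ ℝ` is covered by the images of at least `h(X)·⌊|V|/2⌋` edges. -/
theorem graph_topological_overlap {V : Type} [Fintype V] [DecidableEq V]
    (G : SimpleGraph V) [DecidableRel G.Adj]
    (hconn : G.Connected) (hcard : 2 ≤ Fintype.card V)
    (f : (V → ℝ) → ℝ) (hf : ContinuousOn f (graphRealization G)) :
    ∃ z : ℝ,
      cheegerConst G * ((Fintype.card V / 2 : ℕ) : ℝ) ≤
        ({e : Sym2 V | e ∈ G.edgeSet ∧ z ∈ f '' edgeReal G e}).ncard := by
  obtain ⟨A, hA, hle⟩ := exists_finset_card_eq_forall_le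
    (fun v => f (Pi.single v 1)) (Fintype.card V / 2) (by omega)
  have hAc : Aᶜ.card = Fintype.card V - Fintype.card V / 2 := by rw [Finset.card_compl, hA]
  have hAne : A.Nonempty := Finset.card_pos.1 (by omega)
  obtain ⟨m, hm, hmax⟩ := Finset.exists_max_image A (fun v => f (Pi.single v 1)) hAne
  refine ⟨f (Pi.single m 1), ?_⟩
  have hcut := cheegerConst_mul_min_le G hAne (Finset.card_pos.1 (by omega))
  rw [min_eq_left (by exact_mod_cast (by omega : A.card ≤ Aᶜ.card)), hA] at hcut
  refine hcut.trans ?_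
  rw [← Set.ncard_coe_finset]
  refine Nat.cast_le.2 (Set.ncard_le_ncard_of_injOn (fun p => s(p.1, p.2)) ?_ ?_
    (Set.toFinite _))
  · rintro ⟨u, w⟩ hp
    simp only [Finset.coe_filter, Finset.mem_product, Finset.mem_compl,
      Set.mem_ofPred_eq] at hp
    exact ⟨hp.2, mem_image_edgeReal G hp.2 hf (hmax u hp.1.1) (hle m hm w hp.1.2)⟩
  · rintro ⟨u, w⟩ hp ⟨u', w'⟩ hq heq
    simp only [Finset.coe_filter, Finset.mem_product, Finset.mem_compl,
      Set.mem_ofPred_eq] at hp hq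
    rcases Sym2.eq_iff.1 heq with ⟨rfl, rfl⟩ | ⟨rfl, rfl⟩
    · rfl
    · exact absurd hp.1.1 hq.1.2
end

section
/- (Fox–Gromov–Lafforgue–Naor–Pach) For every d ≥ 1 there exists k₀ = k₀(d) ∈ ℕ such that for every k ≥ k₀ there exists ε > 0 with the following property: for Y drawn from the random model Y^d(n,k) (with d+1 dividing n), the probability that Y is an ε-geometric expander tends to 1 as n → ∞ along multiples of d+1. -/
open Finset
open scoped Classical

/-- `P` is a partition of `{1,…,n}` into blocks of size `d+1`. -/
def IsPartitionInto (n d : ℕ) (P : Finset (Finset (Fin n))) : Prop :=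
  (∀ B ∈ P, B.card = d + 1) ∧ ∀ v : Fin n, ∃! B, B ∈ P ∧ v ∈ B

/-- The set of `d`-cells of the complex determined by the `k` chosen partitions:
all blocks that occur. -/
def blocksOf {n d k : ℕ}
    (ω : Fin k → {P : Finset (Finset (Fin n)) // IsPartitionInto n d P}) :
    Finset (Finset (Fin n)) :=
  Finset.univ.biUnion fun i => (ω i).1

/-- A pure `d`-dimensional complex with set of `d`-cells `cellsd` (on vertex set `Fin n`)
is an `ε`-geometric expander: for every map of the vertices to `ℝ^d` some point `z` lies
in the convex hull of the images of at least `ε·|cellsd|` of the `d`-cells. -/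
def IsGeomExpander {n : ℕ} (d : ℕ) (ε : ℝ) (cellsd : Finset (Finset (Fin n))) : Prop :=
  ∀ g : Fin n → (Fin d → ℝ), ∃ z : Fin d → ℝ,
    ε * (cellsd.card : ℝ) ≤
      ((cellsd.filter fun σ => z ∈ convexHull ℝ (g '' (σ : Set (Fin n)))).card : ℝ)

/-- The probability, under the model `Y^d(n,k)` (k independent uniformly random
partitions of `{1,…,n}` into blocks of size `d+1`), that the resulting complex is an
`ε`-geometric expander. -/
noncomputable def probGeomExpander (d k n : ℕ) (ε : ℝ) : ℝ :=
  ((Finset.univ.filter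
      fun ω : Fin k → {P : Finset (Finset (Fin n)) // IsPartitionInto n d P} =>
        IsGeomExpander d ε (blocksOf ω)).card : ℝ) /
    (Fintype.card (Fin k → {P : Finset (Finset (Fin n)) // IsPartitionInto n d P}) : ℝ)

/-- Centerpoint theorem: some point `c` is so deep that each closed halfspace containing `c`
contains at least a `1/(d+1)` fraction of the given points. -/
lemma exists_centerpoint {d : ℕ} {ι : Type*} (s : Finset ι) (hs : s.Nonempty)
    (g : ι → Fin d → ℝ) :
    ∃ c : Fin d → ℝ, ∀ ψ : Module.Dual ℝ ((Fin d → ℝ) × ℝ), 0 ≤ ψ (c, 1) →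
      s.card ≤ (d + 1) * (s.filter fun v => 0 ≤ ψ (g v, 1)).card := by
  have hs' : 0 < s.card := hs.card_pos
  obtain ⟨c, hc⟩ := Convex.helly_theorem' (𝕜 := ℝ)
    (s := s.powerset.filter fun T => (d + 1) * (s \ T).card < s.card)
    (F := fun T : Finset ι => convexHull ℝ (g '' (T : Set ι)))
    (fun _ _ => convex_convexHull ℝ _) (by
      intro I hI hcard
      simp only [Module.finrank_fintype_fun_eq_card, Fintype.card_fin] at hcard
      have hlt : (I.biUnion fun T => s \ T).card < s.card := by
        have h1 : (d + 1) * (I.biUnion fun T => s \ T).card ≤ (d + 1) * (s.card - 1) :=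
          calc (d + 1) * (I.biUnion fun T => s \ T).card
              ≤ (d + 1) * ∑ T ∈ I, (s \ T).card := Nat.mul_le_mul_left _ card_biUnion_le
            _ = ∑ T ∈ I, (d + 1) * (s \ T).card := by rw [mul_sum]
            _ ≤ ∑ T ∈ I, (s.card - 1) := sum_le_sum fun T hT => by
                have := (mem_filter.1 (hI hT)).2
                omega
            _ = I.card * (s.card - 1) := by simp
            _ ≤ (d + 1) * (s.card - 1) := Nat.mul_le_mul_right _ hcard
        have := Nat.le_of_mul_le_mul_left h1 (Nat.succ_pos d)
        omega
      obtain ⟨v, hv, hv'⟩ := exists_mem_notMem_of_card_lt_card hlt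
      refine ⟨g v, ?_⟩
      simp only [Set.mem_iInter]
      intro T hT
      refine subset_convexHull ℝ _ ⟨v, ?_, rfl⟩
      by_contra hvT
      exact hv' (mem_biUnion.2 ⟨T, hT, mem_sdiff.2 ⟨hv, hvT⟩⟩))
  refine ⟨c, fun ψ hψ => ?_⟩
  by_contra! hlt
  have hT : s.filter (fun v => ψ (g v, 1) < 0) ∈
      s.powerset.filter fun T => (d + 1) * (s \ T).card < s.card := by
    refine mem_filter.2 ⟨mem_powerset.2 (filter_subset _ _), ?_⟩
    have : s \ s.filter (fun v => ψ (g v, 1) < 0) = s.filter fun v => 0 ≤ ψ (g v, 1) := by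
      ext v
      simp only [mem_sdiff, mem_filter, not_and, not_lt]
      tauto
    rwa [this]
  have hcT := Set.mem_iInter₂.1 hc _ hT
  have hconv : Convex ℝ {x : Fin d → ℝ | ψ (x, 1) < 0} := by
    intro x hx y hy a b ha hb hab
    have : ψ (a • x + b • y, 1) = a * ψ (x, 1) + b * ψ (y, 1) := by
      rw [← smul_eq_mul, ← smul_eq_mul, ← map_smul, ← map_smul, ← map_add]
      simp [hab]
    simp only [Set.mem_ofPred_eq] at *
    rw [this]
    rcases ha.eq_or_lt with rfl | ha
    · simp at hab; subst hab; simpa using hy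
    · nlinarith [mul_neg_of_pos_of_neg ha hx, mul_nonneg hb (neg_nonneg.2 hy.le)]
  have := convexHull_min (s := g '' ((s.filter fun v => ψ (g v, 1) < 0 : Finset ι) : Set ι))
    (by rintro _ ⟨v, hv, rfl⟩; exact (mem_filter.1 hv).2) hconv hcT
  exact absurd hψ (not_le.2 this)

/-- At most `dim X` vectors lie in a common closed halfspace with the origin on its boundary. -/
lemma exists_dual_nonneg {X ι : Type*} [AddCommGroup X] [Module ℝ X] [FiniteDimensional ℝ X]
    [Fintype ι] (hX : 0 < Module.finrank ℝ X) (u : ι → X)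
    (hι : Fintype.card ι ≤ Module.finrank ℝ X) :
    ∃ φ : Module.Dual ℝ X, φ ≠ 0 ∧ ∀ i, 0 ≤ φ (u i) := by
  by_cases hspan : Submodule.span ℝ (Set.range u) = ⊤
  · have hcard : Fintype.card ι = Module.finrank ℝ X :=
      le_antisymm hι (finrank_le_of_span_eq_top hspan)
    let b := basisOfTopLeSpanOfCardEqFinrank u hspan.ge hcard
    have hb : ∀ i, b.constr ℝ (fun _ => (1 : ℝ)) (u i) = 1 := fun i => by
      have : b i = u i := by simp [b]
      rw [← this, Module.Basis.constr_basis]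
    refine ⟨b.constr ℝ (fun _ => (1 : ℝ)), fun h0 => ?_, fun i => by rw [hb i]; norm_num⟩
    obtain ⟨i⟩ : Nonempty ι := Fintype.card_pos_iff.1 (hcard ▸ hX)
    have := hb i
    rw [h0] at this
    simp at this
  · obtain ⟨φ, h0, hφ⟩ := Submodule.exists_le_ker_of_lt_top _ (lt_top_iff_ne_top.2 hspan)
    refine ⟨φ, h0, fun i => ?_⟩
    have : u i ∈ LinearMap.ker φ := hφ (Submodule.subset_span ⟨i, rfl⟩)
    exact (LinearMap.mem_ker.1 this).ge

/-- Points are in general position if no hyperplane contains more than `d` of them. -/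
def GeneralPosition {d : ℕ} {V : Type*} [Fintype V] (g : V → Fin d → ℝ) : Prop :=
  ∀ ψ : Module.Dual ℝ ((Fin d → ℝ) × ℝ), ψ ≠ 0 →
    (univ.filter fun v => ψ (g v, 1) = 0).card ≤ d

/-- A choice of signs on at most `dim X` clusters is realised, after shrinking all clusters by a
bounded factor, by a functional pulled back along a surjection onto `X`. -/
lemma exists_shrink_separated {d : ℕ} {V κ X : Type*} [Fintype V] [Fintype κ]
    [AddCommGroup X] [Module ℝ X] [FiniteDimensional ℝ X] (hX : 0 < Module.finrank ℝ X)
    (π : (Fin d → ℝ) × ℝ →ₗ[ℝ] X) (hπ : Function.Surjective π)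
    {g : V → Fin d → ℝ} (hg : GeneralPosition g) (r : κ → SignType)
    (hr : (univ.filter fun i => r i ≠ 0).card ≤ Module.finrank ℝ X)
    (P : κ → Finset V) (a : ℕ) (ha : d ≤ a) (ha' : 0 < a)
    (hP : ∀ i, 2 * (d + 1) * a ≤ (P i).card) :
    ∃ P' : κ → Finset V, (∀ i, P' i ⊆ P i) ∧ (∀ i, a ≤ (P' i).card) ∧
      ∃ φ : Module.Dual ℝ X, ∀ i, r i ≠ 0 → ∀ v ∈ P' i, 0 < (r i : ℝ) * φ (π (g v, 1)) := by
  have hne : ∀ i, (P i).Nonempty := fun i =>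
    card_pos.1 ((by positivity : 0 < 2 * (d + 1) * a).trans_le (hP i))
  choose c hc using fun i => exists_centerpoint (P i) (hne i) g
  obtain ⟨φ, hφ0, hφ⟩ := exists_dual_nonneg hX
    (fun i : {i // r i ≠ 0} => (r i : ℝ) • π (c i, 1)) (by rwa [Fintype.card_subtype])
  refine ⟨fun i => if r i = 0 then P i else
    (P i).filter fun v => 0 < (r i : ℝ) * φ (π (g v, 1)), ?_, ?_, φ, ?_⟩
  · intro i
    dsimp only
    split_ifs
    · exact subset_rfl
    · exact filter_subset _ _
  · intro i
    dsimp only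
    split_ifs with hi
    · nlinarith [hP i]
    · have hcast : (r i : ℝ) ≠ 0 := by
        cases h : r i <;> simp_all
      have h1 := hc i (((r i : ℝ) • φ).comp π) (by simpa using hφ ⟨i, hi⟩)
      have h2 : (univ.filter fun v => (φ.comp π) (g v, 1) = 0).card ≤ d := by
        refine hg _ fun h0 => hφ0 ?_
        ext x
        obtain ⟨y, rfl⟩ := hπ x
        exact LinearMap.congr_fun h0 y
      have h3 : (P i).filter (fun v => 0 ≤ (((r i : ℝ) • φ).comp π) (g v, 1)) ⊆
          (P i).filter (fun v => 0 < (r i : ℝ) * φ (π (g v, 1))) ∪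
            univ.filter fun v => (φ.comp π) (g v, 1) = 0 := by
        intro v hv
        simp only [mem_filter, mem_union, mem_univ, true_and, LinearMap.comp_apply,
          LinearMap.smul_apply, smul_eq_mul] at hv ⊢
        rcases hv.2.lt_or_eq with h | h
        · exact Or.inl ⟨hv.1, h⟩
        · exact Or.inr ((mul_eq_zero.1 h.symm).resolve_left hcast)
      have h4 := (card_le_card h3).trans (card_union_le _ _)
      have h5 : (d + 1) * (2 * a) ≤ (d + 1) *
          (((P i).filter (fun v => 0 < (r i : ℝ) * φ (π (g v, 1)))).card + d) := by
        calc (d + 1) * (2 * a) = 2 * (d + 1) * a := by ring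
          _ ≤ _ := hP i
          _ ≤ _ := h1
          _ ≤ _ := Nat.mul_le_mul_left _ (by omega)
      have := Nat.le_of_mul_le_mul_left h5 (Nat.succ_pos d)
      omega
  · intro i hi v hv
    simp only [hi, if_false, mem_filter] at hv
    exact hv.2

/-- Finitely many hereditary requirements, each of which can be met at bounded cost, can be met
simultaneously at bounded cost. -/
lemma exists_shrink_forall {κ V R : Type*} {C d : ℕ} (hC : 0 < C)
    (Q : R → (κ → Finset V) → Prop)
    (mono : ∀ r P P', (∀ i, P' i ⊆ P i) → Q r P → Q r P') (S : Finset R)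
    (step : ∀ r ∈ S, ∀ (P : κ → Finset V) (a : ℕ), d ≤ a → (∀ i, C * a ≤ (P i).card) →
      ∃ P' : κ → Finset V, (∀ i, P' i ⊆ P i) ∧ (∀ i, a ≤ (P' i).card) ∧ Q r P')
    (P : κ → Finset V) (a : ℕ) (ha : d ≤ a) (hP : ∀ i, C ^ S.card * a ≤ (P i).card) :
    ∃ P' : κ → Finset V, (∀ i, P' i ⊆ P i) ∧ (∀ i, a ≤ (P' i).card) ∧ ∀ r ∈ S, Q r P' := by
  induction S using Finset.induction_on generalizing P with
  | empty => exact ⟨P, fun _ => subset_rfl, by simpa using hP, by simp⟩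
  | insert r S hr ih =>
    rw [card_insert_of_notMem hr] at hP
    obtain ⟨P₁, h₁, hc₁, hQ₁⟩ := step r (mem_insert_self _ _) P (C ^ S.card * a)
      (ha.trans (Nat.le_mul_of_pos_left _ (by positivity)))
      (fun i => le_trans (by rw [pow_succ]; nlinarith) (hP i))
    obtain ⟨P₂, h₂, hc₂, hQ₂⟩ := ih (fun r hr => step r (mem_insert_of_mem hr)) P₁ hc₁
    refine ⟨P₂, fun i => (h₂ i).trans (h₁ i), hc₂, fun q hq => ?_⟩
    rcases mem_insert.1 hq with rfl | hq
    · exact mono _ _ _ h₂ hQ₁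
    · exact hQ₂ q hq

/-- If any `d + 1` of more than `d (d + 1)` clusters are separated, then some point lies in the
convex hull of every transversal. -/
lemma exists_mem_convexHull_transversals {d : ℕ} {V κ : Type*} [Fintype κ]
    (g : V → Fin d → ℝ) (P : κ → Finset V) (hne : ∀ i, (P i).Nonempty)
    (hκ : (d + 1) * d < Fintype.card κ)
    (hsep : ∀ r : κ → SignType, (univ.filter fun i => r i ≠ 0).card ≤ d + 1 →
      ∃ φ : Module.Dual ℝ ((Fin d → ℝ) × ℝ), ∀ i, r i ≠ 0 → ∀ v ∈ P i,
        0 < (r i : ℝ) * φ (g v, 1)) :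
    ∃ z : Fin d → ℝ, ∀ x : κ → V, (∀ i, x i ∈ P i) →
      z ∈ convexHull ℝ (Set.range fun i => g (x i)) := by
  choose p hp using hne
  have hκ' : 0 < Fintype.card κ := by omega
  obtain ⟨z, hz⟩ := exists_centerpoint (univ : Finset κ) (card_pos.1 hκ') (fun i => g (p i))
  have deep : ∀ ψ : Module.Dual ℝ ((Fin d → ℝ) × ℝ), 0 ≤ ψ (z, 1) →
      ∃ i, ∀ v ∈ P i, 0 ≤ ψ (g v, 1) := by
    intro ψ hψ
    by_contra! hcon
    choose q hqP hq using hcon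
    have hcard := hz ψ hψ
    obtain ⟨T, hTsub, hTcard⟩ := exists_subset_card_eq
      (s := univ.filter fun i => 0 ≤ ψ (g (p i), 1)) (n := d + 1) (by
        rw [card_univ] at hcard
        have := lt_of_mul_lt_mul_left (hκ.trans_le hcard) (Nat.zero_le _)
        omega)
    have hT : ∀ i ∈ T, 0 ≤ ψ (g (p i), 1) := fun i hi => (mem_filter.1 (hTsub hi)).2
    let y : T → LinearMap.ker ψ := fun i =>
      ⟨(-ψ (g (q i), 1)) • (g (p i), (1 : ℝ)) + ψ (g (p i), 1) • (g (q i), (1 : ℝ)), by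
        rw [LinearMap.mem_ker, map_add, map_smul, map_smul, smul_eq_mul, smul_eq_mul]; ring⟩
    have hψ0 : ψ ≠ 0 := by
      obtain ⟨i⟩ : Nonempty κ := Fintype.card_pos_iff.1 hκ'
      rintro rfl
      simpa using hq i
    have hker : Module.finrank ℝ (LinearMap.ker ψ) < Fintype.card T := by
      have h1 := LinearMap.finrank_range_add_finrank_ker ψ
      have h2 : LinearMap.range ψ = ⊤ := LinearMap.range_eq_top.2 (LinearMap.surjective hψ0)
      rw [h2, finrank_top] at h1
      simp at h1
      simp [hTcard]
      omega
    have hdep : ¬ LinearIndependent ℝ y := fun h =>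
      absurd h.fintype_card_le_finrank (not_le.2 hker)
    obtain ⟨w, hw, i₀, hi₀⟩ := Fintype.not_linearIndependent_iff.1 hdep
    let r : κ → SignType := fun i => if h : i ∈ T then SignType.sign (w ⟨i, h⟩) else 0
    obtain ⟨φ, hφ⟩ := hsep r (by
      rw [← hTcard]
      refine card_le_card fun i hi => ?_
      by_contra hiT
      simp [r, hiT] at hi)
    have hsum : ∑ i : T, w i * φ (y i : (Fin d → ℝ) × ℝ) = 0 := by
      have := congrArg (fun u : LinearMap.ker ψ => φ (u : (Fin d → ℝ) × ℝ)) hw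
      simpa using this
    have hpos : ∀ i : T, w i ≠ 0 → 0 < w i * φ (y i : (Fin d → ℝ) × ℝ) := by
      intro i hi
      have hri : r i = SignType.sign (w i) := by simp [r]
      have hr0 : r i ≠ 0 := by rw [hri]; simpa using hi
      have h1 := hφ i hr0 _ (hp i)
      have h2 := hφ i hr0 _ (hqP i)
      have h3 : 0 < (r i : ℝ) * φ (y i : (Fin d → ℝ) × ℝ) := by
        simp only [y, map_add, map_smul, smul_eq_mul]
        nlinarith [mul_pos (neg_pos.2 (hq i)) h1, mul_nonneg (hT i i.2) h2.le]
      rw [hri] at h3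
      calc (0 : ℝ) < |w i| * ((SignType.sign (w i) : ℝ) * φ (y i : (Fin d → ℝ) × ℝ)) :=
            mul_pos (abs_pos.2 hi) h3
        _ = _ := by rw [← mul_assoc, abs_mul_sign]
    have : 0 < ∑ i : T, w i * φ (y i : (Fin d → ℝ) × ℝ) := by
      refine sum_pos' (fun i _ => ?_) ⟨i₀, mem_univ _, hpos i₀ hi₀⟩
      by_cases hi : w i = 0
      · simp [hi]
      · exact (hpos i hi).le
    exact this.ne' hsum
  refine ⟨z, fun x hx => ?_⟩
  by_contra hzx
  obtain ⟨f, u, hfu, hf⟩ := geometric_hahn_banach_point_closed (convex_convexHull ℝ _)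
    ((Set.finite_range fun i => g (x i)).isCompact_convexHull ℝ).isClosed hzx
  obtain ⟨i, hi⟩ := deep
    ((LinearMap.snd ℝ (Fin d → ℝ) ℝ).smulRight (f z) -
      (f : (Fin d → ℝ) →ₗ[ℝ] ℝ).comp (LinearMap.fst ℝ (Fin d → ℝ) ℝ)) (by simp)
  have h1 := hi _ (hx i)
  have h2 := hf _ (subset_convexHull ℝ _ ⟨i, rfl⟩)
  simp at h1
  linarith

/-- Assume no `d` of the `d + 1` clusters indexed by `T` have the point `z` in the hull of their
union. If `z` is a convex combination of a transversal, this persists when one of the points is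
moved within its cluster. -/
lemma exists_convexCombination_update {d : ℕ} {V κ : Type*} [DecidableEq κ]
    {g : V → Fin d → ℝ} {z : Fin d → ℝ} {P : κ → Finset V} {T : Finset κ}
    (hT : T.card = d + 1)
    (hsep : ∀ i ∈ T, ∃ f : Module.Dual ℝ (Fin d → ℝ), ∀ l ∈ T.erase i, ∀ v ∈ P l,
      0 < f (g v - z))
    {x : κ → V} (hx : ∀ i, x i ∈ P i)
    (hxz : ∃ c : κ → ℝ, (∀ i ∈ T, 0 ≤ c i) ∧ ∑ i ∈ T, c i = 1 ∧
      ∑ i ∈ T, c i • (g (x i) - z) = 0)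
    {j : κ} (hj : j ∈ T) {v : V} (hv : v ∈ P j) :
    ∃ c : κ → ℝ, (∀ i ∈ T, 0 ≤ c i) ∧ ∑ i ∈ T, c i = 1 ∧
      ∑ i ∈ T, c i • (g (Function.update x j v i) - z) = 0 := by
  obtain ⟨c, hc0, hc1, hcz⟩ := hxz
  set y := Function.update x j v with hy
  have hyj : y j = v := by simp [hy]
  have hyi : ∀ i ≠ j, y i = x i := fun i hi => by simp [hy, hi]
  have hyP : ∀ i, y i ∈ P i := fun i => by
    by_cases hi : i = j
    · subst hi; rwa [hyj]
    · rw [hyi i hi]; exact hx i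
  have hcpos : ∀ i ∈ T, 0 < c i := by
    intro i hi
    refine (hc0 i hi).lt_of_ne fun h0 => ?_
    obtain ⟨f, hf⟩ := hsep i hi
    have hsum : ∑ l ∈ T.erase i, c l * f (g (x l) - z) = 0 := by
      have := congrArg f hcz
      rw [map_sum, ← add_sum_erase _ _ hi] at this
      simpa [← h0] using this
    rw [sum_eq_zero_iff_of_nonneg fun l hl =>
      mul_nonneg (hc0 l (mem_of_mem_erase hl)) (hf l hl _ (hx l)).le] at hsum
    have hall : ∀ l ∈ T, c l = 0 := by
      intro l hl
      by_cases hli : l = i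
      · rw [hli, ← h0]
      · have hl' := mem_erase.2 ⟨hli, hl⟩
        exact (mul_eq_zero.1 (hsum l hl')).resolve_right (hf l hl' _ (hx l)).ne'
    rw [sum_eq_zero hall] at hc1
    exact zero_ne_one hc1
  obtain ⟨w, hwz, ⟨i₁, hi₁T, hi₁⟩, hwj⟩ : ∃ w : κ → ℝ, ∑ i ∈ T, w i • (g (y i) - z) = 0 ∧
      (∃ i ∈ T, w i ≠ 0) ∧ 0 ≤ w j := by
    have hdep : ¬ LinearIndependent ℝ fun i : T => g (y i) - z := fun h => by
      have := h.fintype_card_le_finrank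
      simp [hT] at this
    obtain ⟨w, hw, i₀, hi₀⟩ := Fintype.not_linearIndependent_iff.1 hdep
    have key : ∃ w : κ → ℝ, ∑ i ∈ T, w i • (g (y i) - z) = 0 ∧ (∃ i ∈ T, w i ≠ 0) := by
      refine ⟨fun i => if h : i ∈ T then w ⟨i, h⟩ else 0, ?_, i₀, i₀.2, by simpa using hi₀⟩
      rw [← sum_coe_sort T]
      simpa using hw
    obtain ⟨w, hw, i, hi, hi0⟩ := key
    rcases le_total 0 (w j) with h | h
    · exact ⟨w, hw, ⟨i, hi, hi0⟩, h⟩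
    · refine ⟨fun i => -w i, ?_, ⟨i, hi, neg_ne_zero.2 hi0⟩, neg_nonneg.2 h⟩
      simp only [neg_smul, sum_neg_distrib, hw, neg_zero]
  by_cases hneg : ∃ i ∈ T, w i < 0
  · exfalso
    obtain ⟨k, hk, hkmin⟩ := exists_min_image (T.filter fun i => w i < 0)
      (fun i => c i / -w i) (by simpa [Finset.Nonempty] using hneg)
    obtain ⟨hkT, hkneg⟩ := mem_filter.1 hk
    set s := c k / -w k with hs
    have hspos : 0 < s := div_pos (hcpos k hkT) (neg_pos.2 hkneg)
    have hkj : k ≠ j := by rintro rfl; linarith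
    have hk0 : c k + s * w k = 0 := by
      rw [hs, div_neg, neg_mul, div_mul_cancel₀ _ hkneg.ne, add_neg_cancel]
    have hnn : ∀ i ∈ T, 0 ≤ c i + s * w i := by
      intro i hi
      by_cases hwi : w i < 0
      · have := hkmin i (mem_filter.2 ⟨hi, hwi⟩)
        rw [le_div_iff₀ (neg_pos.2 hwi)] at this
        linarith
      · have := mul_nonneg hspos.le (not_lt.1 hwi)
        linarith [hcpos i hi]
    obtain ⟨f, hf⟩ := hsep k hkT
    have hjk : j ∈ T.erase k := mem_erase.2 ⟨hkj.symm, hj⟩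
    have h1 : ∑ i ∈ T, (c i * f (g (x i) - z) + s * (w i * f (g (y i) - z))) = 0 := by
      have e1 := congrArg f hcz
      have e2 := congrArg f hwz
      simp only [map_sum, map_smul, smul_eq_mul, map_zero] at e1 e2
      rw [sum_add_distrib, ← mul_sum, e1, e2]
      simp
    rw [← add_sum_erase _ _ hkT, hyi k hkj] at h1
    have h2 : c k * f (g (x k) - z) + s * (w k * f (g (x k) - z)) = 0 := by
      linear_combination f (g (x k) - z) * hk0
    rw [h2, zero_add] at h1
    refine absurd h1 (sum_pos' (fun i hi => ?_) ⟨j, hjk, ?_⟩).ne'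
    · by_cases hij : i = j
      · subst hij
        exact add_nonneg (mul_nonneg (hcpos i hj).le (hf i hi _ (hx i)).le)
          (mul_nonneg hspos.le (mul_nonneg hwj (hf i hi _ (hyP i)).le))
      · rw [hyi i hij]
        have := mul_nonneg (hnn i (mem_of_mem_erase hi)) (hf i hi _ (hx i)).le
        linarith
    · exact add_pos_of_pos_of_nonneg (mul_pos (hcpos j hj) (hf j hjk _ (hx j)))
          (mul_nonneg hspos.le (mul_nonneg hwj (hf j hjk _ (hyP j)).le))
  · push Not at hneg
    have hpos : 0 < ∑ i ∈ T, w i :=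
      sum_pos' hneg ⟨i₁, hi₁T, (hneg i₁ hi₁T).lt_of_ne hi₁.symm⟩
    refine ⟨fun i => (∑ i ∈ T, w i)⁻¹ * w i, fun i hi =>
      mul_nonneg (inv_nonneg.2 hpos.le) (hneg i hi), ?_, ?_⟩
    · rw [← mul_sum, inv_mul_cancel₀ hpos.ne']
    · simp only [mul_smul, ← smul_sum, hwz, smul_zero]

lemma exists_disjoint_clusters {V : Type*} [Fintype V] {K b : ℕ} (h : K * b ≤ Fintype.card V) :
    ∃ P : Fin K → Finset V, (∀ i j, i ≠ j → Disjoint (P i) (P j)) ∧ ∀ i, (P i).card = b := by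
  obtain ⟨e⟩ : Nonempty (Fin K × Fin b ↪ V) :=
    Function.Embedding.nonempty_of_card_le (by simpa using h)
  refine ⟨fun i => univ.image fun l => e (i, l), fun i j hij => ?_, fun i => ?_⟩
  · rw [disjoint_left]
    intro v hv hv'
    simp only [mem_image, mem_univ, true_and] at hv hv'
    obtain ⟨l, rfl⟩ := hv
    obtain ⟨l', hl'⟩ := hv'
    exact hij (congrArg Prod.fst (e.injective hl')).symm
  · rw [card_image_of_injective _ fun l l' hl => congrArg Prod.snd (e.injective hl)]
    simp

/-- Pach's theorem for points in general position. -/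
lemma exists_homogeneous_clusters_of_generalPosition {d : ℕ} (hd : 1 ≤ d) :
    ∃ L : ℕ, 0 < L ∧ ∀ (V : Type) [Fintype V] (g : V → Fin d → ℝ), GeneralPosition g →
      ∀ a : ℕ, d ≤ a → L * a ≤ Fintype.card V →
        ∃ A : Fin (d + 1) → Finset V, (∀ i j, i ≠ j → Disjoint (A i) (A j)) ∧
          (∀ i, a ≤ (A i).card) ∧ ∃ z : Fin d → ℝ, ∀ x : Fin (d + 1) → V, (∀ j, x j ∈ A j) →
            z ∈ convexHull ℝ (Set.range fun j => g (x j)) := by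
  set K := (d + 1) * d + 1 with hK
  set C := 2 * (d + 1) with hC
  have hC0 : 0 < C := by omega
  set S₁ : Finset (Fin K → SignType) :=
    univ.filter fun r => (univ.filter fun i => r i ≠ 0).card ≤ d + 1 with hS₁
  set S₂ : Finset (Finset (Fin K)) := powersetCard d univ with hS₂
  refine ⟨K * (C ^ S₁.card * C ^ S₂.card), by positivity, fun V _ g hg a ha hcard => ?_⟩
  have ha₁ : d ≤ C ^ S₂.card * a := ha.trans (Nat.le_mul_of_pos_left _ (by positivity))
  obtain ⟨P₀, hP₀, hP₀c⟩ := exists_disjoint_clusters (V := V) (K := K)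
    (b := C ^ S₁.card * (C ^ S₂.card * a)) (by rwa [← mul_assoc (C ^ _), ← mul_assoc])
  obtain ⟨P₁, hP₁, hP₁c, hQ₁⟩ := exists_shrink_forall hC0
    (fun (r : Fin K → SignType) (P : Fin K → Finset V) =>
      ∃ φ : Module.Dual ℝ ((Fin d → ℝ) × ℝ), ∀ i, r i ≠ 0 → ∀ v ∈ P i,
        0 < (r i : ℝ) * φ (g v, 1))
    (fun r P P' h ⟨φ, hφ⟩ => ⟨φ, fun i hi v hv => hφ i hi v (h i hv)⟩) S₁
    (fun r hr P a ha hP => exists_shrink_separated (by simp) LinearMap.id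
      Function.surjective_id hg r (by simpa using (mem_filter.1 hr).2) P a ha (by omega) hP)
    P₀ _ ha₁ (fun i => (hP₀c i).ge)
  have hpos : 0 < C ^ S₂.card * a := by omega
  obtain ⟨z, hz⟩ := exists_mem_convexHull_transversals g P₁
    (fun i => card_pos.1 (hpos.trans_le (hP₁c i))) (by simp [hK])
    (fun r hr => hQ₁ r (mem_filter.2 ⟨mem_univ _, hr⟩))
  obtain ⟨P, hP, hPc, hQ⟩ := exists_shrink_forall hC0
    (fun (J : Finset (Fin K)) (P : Fin K → Finset V) =>
      ∃ f : Module.Dual ℝ (Fin d → ℝ), ∀ i ∈ J, ∀ v ∈ P i, 0 < f (g v - z))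
    (fun r P P' h ⟨φ, hφ⟩ => ⟨φ, fun i hi v hv => hφ i hi v (h i hv)⟩) S₂
    (fun J hJ P a ha hP => by
      obtain ⟨P', h1, h2, f, hf⟩ := exists_shrink_separated (X := Fin d → ℝ) (by simp; omega)
        (LinearMap.fst ℝ (Fin d → ℝ) ℝ - (LinearMap.snd ℝ (Fin d → ℝ) ℝ).smulRight z)
        (fun x => ⟨(x, 0), by simp⟩) hg (fun i => if i ∈ J then 1 else 0)
        (by simp [(mem_powersetCard.1 hJ).2]) P a ha (by omega) hP
      refine ⟨P', h1, h2, f, fun i hi v hv => ?_⟩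
      simpa [hi] using hf i (by simp [hi]) v hv)
    P₁ a ha hP₁c
  have hne : ∀ i, (P i).Nonempty := fun i => card_pos.1 (by have := hPc i; omega)
  choose p hp using hne
  obtain ⟨ι, _, y, w, hy, hyind, hw0, hw1, hwz⟩ :=
    eq_pos_convex_span_of_mem_convexHull (hz p fun i => hP i (hp i))
  choose e he using fun i => hy ⟨i, rfl⟩
  have he' : Function.Injective e := fun i j hij => hyind.injective (by rw [← he, ← he, hij])
  have hιcard : Fintype.card ι ≤ d + 1 := by
    refine hyind.card_le_finrank_succ.trans (Nat.succ_le_succ ?_)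
    simpa using Submodule.finrank_le (vectorSpan ℝ (Set.range y))
  obtain ⟨T, hTsub, -, hTcard⟩ := exists_subsuperset_card_eq (s := univ.image e) (t := univ)
    (n := d + 1) (subset_univ _) (by rwa [card_image_of_injective _ he', card_univ])
    (by rw [card_univ, Fintype.card_fin, hK]; nlinarith)
  have base : ∃ c : Fin K → ℝ, (∀ i ∈ T, 0 ≤ c i) ∧ ∑ i ∈ T, c i = 1 ∧
      ∑ i ∈ T, c i • (g (p i) - z) = 0 := by
    have hinv : ∀ i : ι, Function.extend e w 0 (e i) = w i := fun i => he'.extend_apply _ _ _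
    have hsum : ∀ {M : Type} [AddCommMonoid M] (F : Fin K → M),
        (∀ i ∉ univ.image e, F i = 0) → ∑ i ∈ T, F i = ∑ i, F (e i) := by
      intro M _ F hF
      rw [← sum_subset hTsub fun i _ hi => hF i hi, sum_image fun i _ j _ h => he' h]
    have hout : ∀ i ∉ univ.image e, Function.extend e w 0 i = 0 := by
      intro i hi
      rw [Function.extend_apply' _ _ _ (by rintro ⟨l, rfl⟩; simp at hi)]
      rfl
    refine ⟨Function.extend e w 0, fun i _ => ?_, ?_, ?_⟩
    · by_cases hi : i ∈ univ.image e
      · obtain ⟨l, -, rfl⟩ := mem_image.1 hi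
        rw [hinv]
        exact (hw0 l).le
      · rw [hout i hi]
    · rw [hsum _ hout]
      simpa only [hinv] using hw1
    · rw [hsum _ fun i hi => by rw [hout i hi, zero_smul]]
      simp only [hinv, smul_sub, sum_sub_distrib, ← sum_smul, hw1, one_smul]
      rw [← hwz, sub_eq_zero]
      exact sum_congr rfl fun i _ => by rw [← he]
  have hsep : ∀ i ∈ T, ∃ f : Module.Dual ℝ (Fin d → ℝ), ∀ l ∈ T.erase i, ∀ v ∈ P l,
      0 < f (g v - z) := fun i hi =>
    hQ _ (mem_powersetCard.2 ⟨subset_univ _, by rw [card_erase_of_mem hi, hTcard]; rfl⟩)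
  have all : ∀ (x : Fin K → V), (∀ i, x i ∈ P i) → ∀ S ⊆ T, ∃ c : Fin K → ℝ, (∀ i ∈ T, 0 ≤ c i) ∧
      ∑ i ∈ T, c i = 1 ∧ ∑ i ∈ T, c i • (g (S.piecewise x p i) - z) = 0 := by
    intro x hx S hS
    induction S using Finset.induction_on with
    | empty => simpa using base
    | insert j S hj ih =>
      rw [piecewise_insert]
      refine exists_convexCombination_update hTcard hsep (fun i => ?_)
        (ih ((subset_insert _ _).trans hS)) (hS (mem_insert_self _ _)) (hx j)
      by_cases hi : i ∈ S <;> simp [hi, hx, hp]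
  let t := T.equivFinOfCardEq hTcard
  refine ⟨fun j => P (t.symm j), fun i j hij => ?_, fun j => hPc _, z, fun x hx => ?_⟩
  · have hne : (t.symm i : Fin K) ≠ t.symm j := fun h => hij (t.symm.injective (Subtype.ext h))
    exact disjoint_of_subset_left ((hP _).trans (hP₁ _))
      (disjoint_of_subset_right ((hP _).trans (hP₁ _)) (hP₀ _ _ hne))
  · obtain ⟨c, hc0, hc1, hcz⟩ := all (fun i => if h : i ∈ T then x (t ⟨i, h⟩) else p i)
      (fun i => by
        by_cases h : i ∈ T
        · simpa [h] using hx (t ⟨i, h⟩)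
        · simpa [h] using hp i) T subset_rfl
    refine mem_convexHull_of_exists_fintype (ι := T) (fun i => c i) (fun i => g (x (t i)))
      (fun i => hc0 i i.2) ?_ (fun i => ⟨t i, rfl⟩) ?_
    · rw [← hc1, sum_coe_sort]
    · rw [← sum_coe_sort] at hcz hc1
      simp only [smul_sub, sum_sub_distrib, ← sum_smul, hc1, one_smul] at hcz
      rw [sub_eq_zero] at hcz
      rw [← hcz]
      exact sum_congr rfl fun i _ => by simp

/-- Moving points along a moment curve puts them in general position for all but finitely many
times. -/
lemma exists_perturbation_generalPosition {d : ℕ} {V : Type*} [Fintype V] (g : V → Fin d → ℝ) :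
    ∃ (γ : V → Fin d → ℝ) (F : Set ℝ), F.Finite ∧
      ∀ t : ℝ, 0 < t → t ∉ F → GeneralPosition fun v => g v + t • γ v := by
  let s : V → ℝ := fun v => ((Fintype.equivFin V v : ℕ) : ℝ)
  have hs : Function.Injective s := fun v w h =>
    (Fintype.equivFin V).injective (Fin.ext (Nat.cast_injective h))
  let A : (Fin (d + 1) → V) → Matrix (Fin (d + 1)) (Fin (d + 1)) ℝ := fun e =>
    Matrix.vandermonde (s ∘ e)
  let B : (Fin (d + 1) → V) → Matrix (Fin (d + 1)) (Fin (d + 1)) ℝ := fun e =>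
    Matrix.of fun i => Fin.cons 1 (g (e i))
  let p : (Fin (d + 1) → V) → Polynomial ℝ := fun e =>
    ((Polynomial.X : Polynomial ℝ) • (A e).map Polynomial.C + (B e).map Polynomial.C).det
  have hp : ∀ e, Function.Injective e → p e ≠ 0 := by
    intro e he h0
    have h1 : (p e).coeff (Fintype.card (Fin (d + 1))) = (A e).det :=
      Polynomial.coeff_det_X_add_C_card (A e) (B e)
    rw [h0, Polynomial.coeff_zero] at h1
    exact Matrix.det_vandermonde_ne_zero_iff.2 (hs.comp he) h1.symm
  have heval : ∀ e t, (p e).eval t = (t • A e + B e).det := by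
    intro e t
    rw [← Polynomial.coe_evalRingHom, RingHom.map_det]
    congr 1
    ext i j
    simp [mul_comm t]
  refine ⟨fun v j => s v ^ ((j : ℕ) + 1), ⋃ e : Fin (d + 1) → V, ((p e).roots.toFinset : Set ℝ),
    Set.finite_iUnion fun e => Finset.finite_toSet _, fun t ht htF ψ hψ => ?_⟩
  by_contra! hcard
  obtain ⟨e⟩ := Function.Embedding.nonempty_of_card_le (α := Fin (d + 1))
    (β := {v // ψ (g v + t • (fun j : Fin d => s v ^ ((j : ℕ) + 1)), 1) = 0}) (by
      rw [Fintype.card_subtype, Fintype.card_fin]; exact hcard)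
  have heinj : Function.Injective fun i => (e i : V) := Subtype.val_injective.comp e.injective
  have htdet : (t • A (fun i => (e i : V)) + B fun i => (e i : V)).det = 0 := by
    rw [← Matrix.exists_mulVec_eq_zero_iff]
    refine ⟨Fin.cons (ψ (0, 1) / (1 + t)) fun j => ψ (Pi.single j 1, 0), fun h0 => hψ ?_, ?_⟩
    · have h1 : ψ (0, 1) = 0 := by
        have := congrFun h0 0
        simp only [Fin.cons_zero, Pi.zero_apply, div_eq_zero_iff] at this
        exact this.resolve_right (by linarith)
      have h2 : ∀ j, ψ (Pi.single j 1, 0) = 0 := fun j => by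
        simpa using congrFun h0 j.succ
      ext x
      · simpa using h2 x
      · simpa using h1
    · ext i
      have hi := (e i).2
      have hdecomp : ∀ y : Fin d → ℝ, ψ (y, 1) = ψ (0, 1) + ∑ j, y j * ψ (Pi.single j 1, 0) := by
        intro y
        have h1 : (y, (1 : ℝ)) = (0, 1) + ∑ j, y j • (Pi.single j (1 : ℝ), (0 : ℝ)) := by
          ext l
          · simp [Prod.fst_sum, Finset.sum_apply, Pi.single_apply]
          · simp [Prod.snd_sum]
        conv_lhs => rw [h1]
        simp only [map_add, map_sum, map_smul, smul_eq_mul]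
      rw [hdecomp] at hi
      simp only [Matrix.mulVec, dotProduct, Fin.sum_univ_succ, Fin.cons_zero, Fin.cons_succ,
        Pi.zero_apply, A, B, Matrix.add_apply, Matrix.smul_apply, Matrix.vandermonde_apply,
        Matrix.of_apply, Function.comp_apply, smul_eq_mul, Fin.val_zero, pow_zero, mul_one,
        Fin.val_succ]
      refine Eq.trans ?_ hi
      congr 1
      · field_simp
        ring
      · refine sum_congr rfl fun j _ => ?_
        simp only [Pi.add_apply, Pi.smul_apply, smul_eq_mul]
        ring
  refine htF (Set.mem_iUnion.2 ⟨fun i => (e i : V), ?_⟩)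
  simp [hp _ heinj, heval, htdet]

/-- The convex hull of a finite family is the set of its convex combinations. -/
lemma convexHull_range_eq_image_stdSimplex {E J : Type*} [AddCommGroup E] [Module ℝ E] [Fintype J]
    (y : J → E) :
    convexHull ℝ (Set.range y) = (fun w : J → ℝ => ∑ j, w j • y j) '' stdSimplex ℝ J := by
  have h : (fun w : J → ℝ => ∑ j, w j • y j) = Fintype.linearCombination ℝ y := by
    ext w
    simp [Fintype.linearCombination_apply]
  rw [h, ← convexHull_rangle_single_eq_stdSimplex, LinearMap.image_convexHull, ← Set.range_comp]
  congr 2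
  ext j
  simp [Fintype.linearCombination_apply, Pi.single_apply]

/-- The times at which the hulls of all transversals have a common point form a closed set. -/
lemma isClosed_setOf_common_point {d : ℕ} {V J : Type*} [Fintype V] [Fintype J]
    (g γ : V → Fin d → ℝ) (R : Set (J → V)) (hR : R.Nonempty) :
    IsClosed {t : ℝ | t ∈ Set.Icc (0 : ℝ) 1 ∧ ∃ z : Fin d → ℝ, ∀ x ∈ R,
      z ∈ convexHull ℝ (Set.range fun j => g (x j) + t • γ (x j))} := by
  let comb : ℝ × (R → J → ℝ) → R → Fin d → ℝ := fun q x =>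
    ∑ j, q.2 x j • (g (x.1 j) + q.1 • γ (x.1 j))
  have hcomb : Continuous comb := by fun_prop
  have hcompact : IsCompact ((Set.Icc (0 : ℝ) 1 ×ˢ Set.pi Set.univ fun _ : R => stdSimplex ℝ J) ∩
      {q : ℝ × (R → J → ℝ) | ∀ x y, comb q x = comb q y}) := by
    refine (isCompact_Icc.prod (isCompact_univ_pi fun _ => isCompact_stdSimplex ℝ J)).inter_right ?_
    simp only [Set.ofPred_forall]
    exact isClosed_iInter fun x => isClosed_iInter fun y =>
      isClosed_eq (by fun_prop) (by fun_prop)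
  convert (hcompact.image continuous_fst).isClosed using 1
  ext t
  simp only [Set.mem_ofPred_eq, Set.mem_image, Set.mem_inter_iff, Set.mem_prod, Set.mem_pi,
    Set.mem_univ, true_implies, Prod.exists, exists_and_right, exists_eq_right]
  constructor
  · rintro ⟨ht, z, hz⟩
    have : ∀ x : R, ∃ w ∈ stdSimplex ℝ J, ∑ j, w j • (g (x.1 j) + t • γ (x.1 j)) = z := by
      intro x
      have hzx := hz x x.2
      rwa [convexHull_range_eq_image_stdSimplex] at hzx
    choose w hw hwz using this
    exact ⟨w, ⟨ht, hw⟩, fun x y => (hwz x).trans (hwz y).symm⟩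
  · rintro ⟨w, ⟨ht, hw⟩, hww⟩
    obtain ⟨x₀, hx₀⟩ := hR
    refine ⟨ht, comb (t, w) ⟨x₀, hx₀⟩, fun x hx => ?_⟩
    rw [hww _ ⟨x, hx⟩]
    exact mem_convexHull_of_exists_fintype (w ⟨x, hx⟩) (fun j => g (x j) + t • γ (x j))
      (hw ⟨x, hx⟩).1 (hw ⟨x, hx⟩).2 (fun j => ⟨j, rfl⟩) rfl

/-- Pach's theorem: any point set contains `d + 1` disjoint subsets, each comprising a positive
fraction of the points, such that the simplices spanned by their transversals have a common
point. -/
lemma exists_homogeneous_clusters {d : ℕ} (hd : 1 ≤ d) :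
    ∃ L : ℕ, 0 < L ∧ ∀ (V : Type) [Fintype V] (g : V → Fin d → ℝ),
      ∀ a : ℕ, d ≤ a → L * a ≤ Fintype.card V →
        ∃ A : Fin (d + 1) → Finset V, (∀ i j, i ≠ j → Disjoint (A i) (A j)) ∧
          (∀ i, a ≤ (A i).card) ∧ ∃ z : Fin d → ℝ, ∀ x : Fin (d + 1) → V, (∀ j, x j ∈ A j) →
            z ∈ convexHull ℝ (Set.range fun j => g (x j)) := by
  obtain ⟨L, hL, H⟩ := exists_homogeneous_clusters_of_generalPosition hd
  refine ⟨L, hL, fun V _ g a ha hcard => ?_⟩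
  obtain ⟨γ, F, hF, hgen⟩ := exists_perturbation_generalPosition g
  let 𝒜 : Set (Fin (d + 1) → Finset V) :=
    {A | (∀ i j, i ≠ j → Disjoint (A i) (A j)) ∧ ∀ i, a ≤ (A i).card}
  let good : (Fin (d + 1) → Finset V) → Set ℝ := fun A => {t : ℝ | t ∈ Set.Icc (0 : ℝ) 1 ∧
    ∃ z : Fin d → ℝ, ∀ x ∈ {x : Fin (d + 1) → V | ∀ j, x j ∈ A j},
      z ∈ convexHull ℝ (Set.range fun j => g (x j) + t • γ (x j))}
  have hclosed : IsClosed (⋃ A ∈ 𝒜, good A) := by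
    refine (Set.toFinite 𝒜).isClosed_biUnion fun A hA => isClosed_setOf_common_point g γ _ ?_
    choose x hx using fun i => card_pos.1 ((hd.trans ha).trans (hA.2 i))
    exact ⟨x, hx⟩
  have h0 : (0 : ℝ) ∈ ⋃ A ∈ 𝒜, good A := by
    rw [← hclosed.closure_eq]
    refine mem_closure_of_tendsto (b := nhdsWithin (0 : ℝ) (Set.Ioi 0)) (f := id)
      (Filter.tendsto_id.mono_left nhdsWithin_le_nhds) ?_
    have h1 : ∀ᶠ t in nhdsWithin (0 : ℝ) (Set.Ioi 0), t ∉ F \ {0} :=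
      nhdsWithin_le_nhds ((hF.subset Set.sdiff_subset).isClosed.isOpen_compl.mem_nhds (by simp))
    filter_upwards [h1, Ioo_mem_nhdsGT (zero_lt_one' ℝ)] with t htF ht
    obtain ⟨A, hA, hAc, z, hz⟩ := H V _
      (hgen t ht.1 fun h => htF ⟨h, ht.1.ne'⟩) a ha hcard
    exact Set.mem_iUnion₂.2 ⟨A, ⟨hA, hAc⟩, ⟨ht.1.le, ht.2.le⟩, z, hz⟩
  obtain ⟨A, hA, -, z, hz⟩ := Set.mem_iUnion₂.1 h0
  exact ⟨A, hA.1, hA.2, z, fun x hx => by simpa using hz x hx⟩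

/-- The partitions of the finite set `U` into blocks of size `d + 1`. -/
noncomputable def blockPartitions {V : Type*} (d : ℕ) (U : Finset V) :
    Finset (Finset (Finset V)) :=
  U.powerset.powerset.filter fun P =>
    (∀ B ∈ P, B.card = d + 1) ∧ ∀ v ∈ U, ∃! B, B ∈ P ∧ v ∈ B

lemma mem_blockPartitions {V : Type*} {d : ℕ} {U : Finset V} {P : Finset (Finset V)} :
    P ∈ blockPartitions d U ↔
      (∀ B ∈ P, B ⊆ U) ∧ (∀ B ∈ P, B.card = d + 1) ∧ ∀ v ∈ U, ∃! B, B ∈ P ∧ v ∈ B := by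
  simp only [blockPartitions, mem_filter, mem_powerset]
  refine and_congr_left fun _ => ⟨fun h B hB => mem_powerset.1 (h hB), fun h B hB =>
    mem_powerset.2 (h B hB)⟩

/-- The sets of size `d + 1` in `U` containing `v`. -/
noncomputable def blocksThrough {V : Type*} (d : ℕ) (U : Finset V) (v : V) :
    Finset (Finset V) :=
  (U.powersetCard (d + 1)).filter (v ∈ ·)

lemma mem_blocksThrough {V : Type*} {d : ℕ} {U : Finset V} {v : V} {B : Finset V} :
    B ∈ blocksThrough d U v ↔ (B ⊆ U ∧ B.card = d + 1) ∧ v ∈ B := by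
  simp [blocksThrough, mem_powersetCard]

lemma card_blocksThrough {V : Type*} {d : ℕ} {U : Finset V} {v : V} (hv : v ∈ U) :
    (blocksThrough d U v).card = (U.card - 1).choose d := by
  rw [← card_erase_of_mem hv, ← card_powersetCard]
  refine card_bij' (fun B _ => B.erase v) (fun B _ => insert v B) ?_ ?_ ?_ ?_
  · intro B hB
    obtain ⟨⟨hBU, hc⟩, hvB⟩ := mem_blocksThrough.1 hB
    refine mem_powersetCard.2 ⟨erase_subset_erase _ hBU, ?_⟩
    rw [card_erase_of_mem hvB, hc, Nat.add_sub_cancel]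
  · intro B hB
    obtain ⟨hBU, hc⟩ := mem_powersetCard.1 hB
    refine mem_blocksThrough.2 ⟨⟨insert_subset hv (hBU.trans (erase_subset _ _)), ?_⟩,
      mem_insert_self _ _⟩
    rw [card_insert_of_notMem fun h => notMem_erase v U (hBU h), hc]
  · intro B hB
    exact insert_erase (mem_blocksThrough.1 hB).2
  · intro B hB
    exact erase_insert fun h => notMem_erase v U ((mem_powersetCard.1 hB).1 h)

lemma notMem_of_mem_blockPartitions_sdiff {V : Type*} {d : ℕ} {U B : Finset V}
    {P : Finset (Finset V)} {v : V} (hv : v ∈ B) (hP : P ∈ blockPartitions d (U \ B)) :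
    B ∉ P := fun h =>
  (mem_sdiff.1 ((mem_blockPartitions.1 hP).1 B h hv)).2 hv

lemma insert_mem_blockPartitions {V : Type*} {d : ℕ} {U B : Finset V} {P : Finset (Finset V)}
    (hBU : B ⊆ U) (hB : B.card = d + 1) (hP : P ∈ blockPartitions d (U \ B)) :
    insert B P ∈ blockPartitions d U := by
  obtain ⟨h1, h2, h3⟩ := mem_blockPartitions.1 hP
  refine mem_blockPartitions.2 ⟨?_, ?_, fun v hv => ?_⟩
  · exact forall_mem_insert .. |>.2 ⟨hBU, fun C hC => (h1 C hC).trans sdiff_subset⟩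
  · exact forall_mem_insert .. |>.2 ⟨hB, h2⟩
  · by_cases hvB : v ∈ B
    · refine ⟨B, ⟨mem_insert_self _ _, hvB⟩, fun C hC => ?_⟩
      exact (mem_insert.1 hC.1).resolve_right fun h => (mem_sdiff.1 (h1 C h hC.2)).2 hvB
    · obtain ⟨C, hC, huniq⟩ := h3 v (mem_sdiff.2 ⟨hv, hvB⟩)
      refine ⟨C, ⟨mem_insert_of_mem hC.1, hC.2⟩, fun D hD => huniq D ⟨?_, hD.2⟩⟩
      exact (mem_insert.1 hD.1).resolve_left fun h => hvB (h ▸ hD.2)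

lemma erase_mem_blockPartitions {V : Type*} {d : ℕ} {U B : Finset V} {P : Finset (Finset V)}
    (hP : P ∈ blockPartitions d U) (hB : B ∈ P) : P.erase B ∈ blockPartitions d (U \ B) := by
  obtain ⟨h1, h2, h3⟩ := mem_blockPartitions.1 hP
  refine mem_blockPartitions.2 ⟨fun C hC v hv => ?_, fun C hC => h2 C (mem_of_mem_erase hC),
    fun v hv => ?_⟩
  · have hvU := h1 C (mem_of_mem_erase hC) hv
    exact mem_sdiff.2 ⟨hvU, fun hvB => ne_of_mem_erase hC
      ((h3 v hvU).unique ⟨mem_of_mem_erase hC, hv⟩ ⟨hB, hvB⟩)⟩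
  · obtain ⟨hvU, hvB⟩ := mem_sdiff.1 hv
    obtain ⟨C, hC, huniq⟩ := h3 v hvU
    exact ⟨C, ⟨mem_erase.2 ⟨fun h => hvB (h ▸ hC.2), hC.1⟩, hC.2⟩,
      fun D hD => huniq D ⟨mem_of_mem_erase hD.1, hD.2⟩⟩

/-- Summing over partitions by first choosing the block of a given point. -/
lemma sum_blockPartitions {V M : Type*} [AddCommMonoid M] {d : ℕ} {U : Finset V} {v : V}
    (hv : v ∈ U) (F : Finset (Finset V) → M) :
    ∑ P ∈ blockPartitions d U, F P =
      ∑ B ∈ blocksThrough d U v, ∑ P ∈ blockPartitions d (U \ B), F (insert B P) := by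
  rw [sum_sigma']
  symm
  refine sum_bij (fun q _ => insert q.1 q.2) ?_ ?_ ?_ fun _ _ => rfl
  · rintro ⟨B, P⟩ h
    obtain ⟨hB, hP⟩ := mem_sigma.1 h
    obtain ⟨⟨hBU, hc⟩, -⟩ := mem_blocksThrough.1 hB
    exact insert_mem_blockPartitions hBU hc hP
  · rintro ⟨B, P⟩ h ⟨C, Q⟩ h' heq
    obtain ⟨hB, hP⟩ := mem_sigma.1 h
    obtain ⟨hC, hQ⟩ := mem_sigma.1 h'
    obtain ⟨⟨hBU, hc⟩, hvB⟩ := mem_blocksThrough.1 hB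
    obtain ⟨-, hvC⟩ := mem_blocksThrough.1 hC
    simp only at hP hQ heq
    have hBC : B = C := ((mem_blockPartitions.1 (insert_mem_blockPartitions hBU hc hP)).2.2 v
      hv).unique ⟨mem_insert_self _ _, hvB⟩ ⟨heq ▸ mem_insert_self _ _, hvC⟩
    subst hBC
    have hPQ : P = Q := by
      rw [← erase_insert (notMem_of_mem_blockPartitions_sdiff hvB hP), heq,
        erase_insert (notMem_of_mem_blockPartitions_sdiff hvB hQ)]
    rw [hPQ]
  · intro P hP
    obtain ⟨h1, h2, h3⟩ := mem_blockPartitions.1 hP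
    obtain ⟨B, hB, -⟩ := h3 v hv
    exact ⟨⟨B, P.erase B⟩, mem_sigma.2 ⟨mem_blocksThrough.2 ⟨⟨h1 B hB.1, h2 B hB.1⟩, hB.2⟩,
      erase_mem_blockPartitions hP hB.1⟩, insert_erase hB.1⟩

/-- The number of partitions of a set of `(d + 1) * m` elements into blocks of size `d + 1`. -/
def numBlockPartitions (d : ℕ) : ℕ → ℕ
  | 0 => 1
  | m + 1 => ((d + 1) * (m + 1) - 1).choose d * numBlockPartitions d m

lemma numBlockPartitions_pos (d m : ℕ) : 0 < numBlockPartitions d m := by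
  induction m with
  | zero => exact Nat.one_pos
  | succ m ih =>
    refine Nat.mul_pos (Nat.choose_pos (Nat.le_sub_of_add_le ?_)) ih
    exact Nat.le_mul_of_pos_right _ m.succ_pos

lemma card_sdiff_of_mem_blocksThrough {V : Type*} {d m : ℕ} {U B : Finset V} {v : V}
    (hU : U.card = (d + 1) * (m + 1)) (hB : B ∈ blocksThrough d U v) :
    (U \ B).card = (d + 1) * m := by
  obtain ⟨⟨hBU, hc⟩, -⟩ := mem_blocksThrough.1 hB
  rw [card_sdiff_of_subset hBU, hU, hc, mul_add, mul_one, Nat.add_sub_cancel]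

lemma card_blockPartitions {V : Type*} {d m : ℕ} {U : Finset V} (hU : U.card = (d + 1) * m) :
    (blockPartitions d U).card = numBlockPartitions d m := by
  induction m generalizing U with
  | zero =>
    obtain rfl : U = ∅ := by simpa using hU
    have : blockPartitions d (∅ : Finset V) = {∅} := by
      ext P
      rw [mem_blockPartitions, mem_singleton]
      constructor
      · rintro ⟨h1, h2, -⟩
        refine eq_empty_of_forall_notMem fun B hB => ?_
        have := h2 B hB
        rw [subset_empty.1 (h1 B hB), card_empty] at this
        omega
      · rintro rfl
        simp
    rw [this, card_singleton, numBlockPartitions]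
  | succ m ih =>
    obtain ⟨v, hv⟩ : U.Nonempty := by
      rw [← card_pos, hU]
      positivity
    rw [card_eq_sum_ones, sum_blockPartitions hv]
    simp only [← card_eq_sum_ones]
    rw [sum_congr rfl fun B hB => ih (card_sdiff_of_mem_blocksThrough hU hB), sum_const,
      card_blocksThrough hv, hU, smul_eq_mul, numBlockPartitions]

/-- `B` consists of one point from each member of the family `A`. -/
def IsTransversal {V J : Type*} [Fintype J] (A : J → Finset V) (B : Finset V) : Prop :=
  ∃ x : J → V, (∀ j, x j ∈ A j) ∧ univ.image x = B

lemma IsTransversal.exists_eq_range {V J : Type*} [Fintype J] {A : J → Finset V} {B : Finset V}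
    (hB : IsTransversal A B) : ∃ x : J → V, (∀ j, x j ∈ A j) ∧ (B : Set V) = Set.range x := by
  obtain ⟨x, hx, rfl⟩ := hB
  exact ⟨x, hx, by simp⟩

lemma pow_le_card_filter_isTransversal {V : Type*} {d a : ℕ} {A : Fin (d + 1) → Finset V}
    (hA : ∀ i j, i ≠ j → Disjoint (A i) (A j)) {U : Finset V} {v : V} (hv : v ∈ A 0) (hvU : v ∈ U)
    (ha : ∀ j, a ≤ (A j ∩ U).card) :
    a ^ d ≤ ((blocksThrough d U v).filter (IsTransversal A)).card := by
  have hle : a ^ d ≤ (Fintype.piFinset fun j : Fin d => A j.succ ∩ U).card := by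
    rw [Fintype.card_piFinset]
    simpa using prod_le_prod' (s := (univ : Finset (Fin d))) fun j _ => ha j.succ
  have hmem : ∀ y ∈ Fintype.piFinset fun j : Fin d => A j.succ ∩ U, ∀ j,
      (Fin.cons v y : Fin (d + 1) → V) j ∈ A j ∩ U := by
    intro y hy j
    refine Fin.cases ?_ (fun j => ?_) j
    · exact mem_inter.2 ⟨hv, hvU⟩
    · exact Fintype.mem_piFinset.1 hy j
  have heq : ∀ x x' : Fin (d + 1) → V, (∀ j, x j ∈ A j ∩ U) → (∀ j, x' j ∈ A j ∩ U) →
      ∀ i j, x i = x' j → i = j := by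
    intro x x' hx hx' i j hij
    by_contra hne
    exact disjoint_left.1 (hA i j hne) (mem_inter.1 (hx i)).1 (hij ▸ (mem_inter.1 (hx' j)).1)
  refine hle.trans (card_le_card_of_injOn
    (fun y => univ.image (Fin.cons v y : Fin (d + 1) → V)) (fun y hy => ?_)
    fun y hy y' hy' hyy' => ?_)
  · have hm := hmem y hy
    refine mem_filter.2 ⟨mem_blocksThrough.2 ⟨⟨?_, ?_⟩, ?_⟩, ⟨_, fun j => (mem_inter.1 (hm j)).1,
      rfl⟩⟩
    · exact image_subset_iff.2 fun j _ => (mem_inter.1 (hm j)).2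
    · rw [card_image_of_injective _ fun i j => heq _ _ hm hm i j, card_univ, Fintype.card_fin]
    · exact mem_image.2 ⟨0, mem_univ _, rfl⟩
  · ext j
    have h : y j ∈ univ.image (Fin.cons v y' : Fin (d + 1) → V) := by
      simp only at hyy'
      rw [← hyy']
      exact mem_image.2 ⟨j.succ, mem_univ _, rfl⟩
    obtain ⟨i, -, hi⟩ := mem_image.1 h
    have hij := heq _ _ (hmem y' hy') (hmem y hy) i j.succ hi
    rw [← hi, hij, Fin.cons_succ]

/-- The exponential moment of the number of transversal blocks in a random partition decays
exponentially. -/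
lemma sum_pow_card_transversal_le {V : Type*} {d a n : ℕ} {A : Fin (d + 1) → Finset V}
    (hA : ∀ i j, i ≠ j → Disjoint (A i) (A j)) {p : ℝ} (hp : p ≤ 1) (ha : 1 ≤ a)
    (hpa : p * (n : ℝ) ^ d ≤ (a : ℝ) ^ d) (hp0 : 0 ≤ p) (M m : ℕ) (U : Finset V)
    (hU : U.card = (d + 1) * m) (hUn : U.card ≤ n) (hAU : ∀ j, a + (d + 1) * M ≤ (A j ∩ U).card) :
    ∑ P ∈ blockPartitions d U, (1 / 2 : ℝ) ^ (P.filter (IsTransversal A)).card ≤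
      (1 - p / 2) ^ M * numBlockPartitions d m := by
  induction M generalizing m U with
  | zero =>
    rw [pow_zero, one_mul, ← card_blockPartitions hU, card_eq_sum_ones, Nat.cast_sum]
    refine sum_le_sum fun P _ => ?_
    rw [Nat.cast_one]
    exact pow_le_one₀ (by norm_num) (by norm_num)
  | succ M ih =>
    obtain ⟨v, hv⟩ : (A 0 ∩ U).Nonempty := card_pos.1 (by have := hAU 0; omega)
    obtain ⟨hvA, hvU⟩ := mem_inter.1 hv
    obtain ⟨m, rfl⟩ : ∃ m', m = m' + 1 := Nat.exists_eq_succ_of_ne_zero (by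
      rintro rfl
      exact (card_pos.2 ⟨v, hvU⟩).ne' (by simpa using hU))
    have hr : 0 ≤ 1 - p / 2 := by linarith
    have hstep : ∀ B ∈ blocksThrough d U v,
        ∑ P ∈ blockPartitions d (U \ B),
          (1 / 2 : ℝ) ^ ((insert B P).filter (IsTransversal A)).card ≤
        (1 - if IsTransversal A B then 1 / 2 else 0) *
          ((1 - p / 2) ^ M * numBlockPartitions d m) := by
      intro B hB
      obtain ⟨⟨hBU, hc⟩, hvB⟩ := mem_blocksThrough.1 hB
      have hih := ih m (U \ B) (card_sdiff_of_mem_blocksThrough hU hB)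
        ((card_le_card sdiff_subset).trans hUn) fun j => by
          have h1 : (A j ∩ U).card ≤ (A j ∩ (U \ B)).card + B.card := by
            refine (card_le_card fun x hx => ?_).trans (card_union_le _ _)
            simp only [mem_union, mem_inter, mem_sdiff] at hx ⊢
            tauto
          have := hAU j
          rw [hc] at h1
          rw [mul_add] at this
          omega
      refine le_trans (le_of_eq ?_) (mul_le_mul_of_nonneg_left hih (by split_ifs <;> norm_num))
      rw [mul_sum]
      refine sum_congr rfl fun P hP => ?_
      have hBP := notMem_of_mem_blockPartitions_sdiff hvB hP
      rw [filter_insert]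
      split_ifs
      · rw [card_insert_of_notMem fun h => hBP (mem_filter.1 h).1, pow_succ]
        ring
      · ring
    rw [sum_blockPartitions hvU]
    refine (sum_le_sum hstep).trans ?_
    rw [← sum_mul, sum_sub_distrib, ← sum_filter, sum_const, sum_const, nsmul_eq_mul, nsmul_eq_mul,
      mul_one, numBlockPartitions, Nat.cast_mul, ← hU, ← card_blocksThrough hvU]
    have hG : (a : ℝ) ^ d ≤ ((blocksThrough d U v).filter (IsTransversal A)).card := by
      exact_mod_cast pow_le_card_filter_isTransversal hA hvA hvU fun j =>
        (Nat.le_add_right _ _).trans (hAU j)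
    have hC : ((blocksThrough d U v).card : ℝ) ≤ (n : ℝ) ^ d := by
      rw [card_blocksThrough hvU]
      exact_mod_cast (Nat.choose_le_pow _ _).trans
        (Nat.pow_le_pow_left ((Nat.sub_le _ _).trans hUn) d)
    have hpC := mul_le_mul_of_nonneg_left hC hp0
    calc _ ≤ ((1 - p / 2) * (blocksThrough d U v).card) *
          ((1 - p / 2) ^ M * numBlockPartitions d m) := by
          refine mul_le_mul_of_nonneg_right ?_ (by positivity)
          linarith
      _ = _ := by ring

/-- Few partitions contain few transversal blocks. -/
lemma card_filter_card_transversal_lt {V : Type*} {d a n : ℕ} {A : Fin (d + 1) → Finset V}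
    (hA : ∀ i j, i ≠ j → Disjoint (A i) (A j)) {p : ℝ} (hp : p ≤ 1) (ha : 1 ≤ a)
    (hpa : p * (n : ℝ) ^ d ≤ (a : ℝ) ^ d) (hp0 : 0 ≤ p) (M m s : ℕ) (U : Finset V)
    (hU : U.card = (d + 1) * m) (hUn : U.card ≤ n) (hAU : ∀ j, a + (d + 1) * M ≤ (A j ∩ U).card) :
    (((blockPartitions d U).filter fun P => (P.filter (IsTransversal A)).card < s).card : ℝ) ≤
      2 ^ s * (1 - p / 2) ^ M * numBlockPartitions d m := by
  have h := sum_pow_card_transversal_le hA hp ha hpa hp0 M m U hU hUn hAU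
  have h2 : (((blockPartitions d U).filter fun P => (P.filter (IsTransversal A)).card < s).card : ℝ)
      * (1 / 2) ^ s ≤
      ∑ P ∈ blockPartitions d U, (1 / 2 : ℝ) ^ (P.filter (IsTransversal A)).card := by
    rw [← nsmul_eq_mul, ← sum_const]
    refine (sum_le_sum fun P hP => ?_).trans
      (sum_le_sum_of_subset_of_nonneg (filter_subset _ _) fun P _ _ => by positivity)
    exact pow_le_pow_of_le_one (by norm_num) (by norm_num) (mem_filter.1 hP).2.le
  have h3 := mul_le_mul_of_nonneg_left (h2.trans h) (by positivity : (0 : ℝ) ≤ 2 ^ s)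
  have h4 : (2 : ℝ) ^ s * (1 / 2) ^ s = 1 := by rw [← mul_pow]; norm_num
  calc _ = 2 ^ s * ((((blockPartitions d U).filter fun P =>
        (P.filter (IsTransversal A)).card < s).card : ℝ) * (1 / 2) ^ s) := by
        rw [mul_left_comm, h4, mul_one]
    _ ≤ _ := by rw [mul_assoc]; exact h3

lemma card_of_mem_blockPartitions {V : Type*} {d m : ℕ} {U : Finset V} {P : Finset (Finset V)}
    (hU : U.card = (d + 1) * m) (hP : P ∈ blockPartitions d U) : P.card = m := by
  obtain ⟨h1, h2, h3⟩ := mem_blockPartitions.1 hP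
  have hunion : P.biUnion id = U := by
    ext v
    simp only [mem_biUnion, id]
    exact ⟨fun ⟨B, hB, hv⟩ => h1 B hB hv, fun hv => (h3 v hv).exists⟩
  have hdisj : ∀ B ∈ P, ∀ C ∈ P, B ≠ C → Disjoint (id B) (id C) := fun B hB C hC hne =>
    disjoint_left.2 fun v hvB hvC => hne ((h3 v (h1 B hB hvB)).unique ⟨hB, hvB⟩ ⟨hC, hvC⟩)
  have hcard := card_biUnion hdisj
  simp only [id] at hcard
  rw [hunion, hU, sum_congr rfl (g := fun _ => d + 1) h2, sum_const, smul_eq_mul, mul_comm] at hcard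
  exact (Nat.eq_of_mul_eq_mul_right d.succ_pos hcard).symm

lemma isPartitionInto_iff_mem_blockPartitions {n d : ℕ} {P : Finset (Finset (Fin n))} :
    IsPartitionInto n d P ↔ P ∈ blockPartitions d univ := by
  simp [IsPartitionInto, mem_blockPartitions]

/-- If the complex is not an expander, every one of the partitions has few blocks transversal to
some family of large disjoint clusters. -/
lemma exists_clusters_of_not_isGeomExpander {d L b k m s : ℕ} {ε : ℝ}
    (hL : ∀ (V : Type) [Fintype V] (g : V → Fin d → ℝ), ∀ a : ℕ, d ≤ a → L * a ≤ Fintype.card V →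
      ∃ A : Fin (d + 1) → Finset V, (∀ i j, i ≠ j → Disjoint (A i) (A j)) ∧
        (∀ i, a ≤ (A i).card) ∧ ∃ z : Fin d → ℝ, ∀ x : Fin (d + 1) → V, (∀ j, x j ∈ A j) →
          z ∈ convexHull ℝ (Set.range fun j => g (x j)))
    (hdb : d ≤ b) (hb : L * b ≤ (d + 1) * m) (hε : 0 ≤ ε) (hs : ε * (k * m : ℕ) ≤ s)
    {ω : Fin k → {P : Finset (Finset (Fin ((d + 1) * m))) // IsPartitionInto _ d P}}
    (hω : ¬ IsGeomExpander d ε (blocksOf ω)) :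
    ∃ A : Fin (d + 1) → Finset (Fin ((d + 1) * m)),
      ((∀ i j, i ≠ j → Disjoint (A i) (A j)) ∧ ∀ i, b ≤ (A i).card) ∧
        ∀ i, ((ω i).1.filter (IsTransversal A)).card < s := by
  obtain ⟨g, hg⟩ := not_forall.1 hω
  obtain ⟨A, hA, hAb, z, hz⟩ := hL _ g b hdb (by simpa using hb)
  refine ⟨A, ⟨hA, hAb⟩, fun i => ?_⟩
  by_contra! hi
  have hcells : (blocksOf ω).card ≤ k * m := by
    refine card_biUnion_le.trans (le_of_eq ?_)
    have hcard : ∀ i ∈ (univ : Finset (Fin k)), (ω i).1.card = m := fun i _ =>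
      card_of_mem_blockPartitions (by simp) (isPartitionInto_iff_mem_blockPartitions.1 (ω i).2)
    rw [sum_congr rfl hcard]
    simp
  refine hg ⟨z, ?_⟩
  have hcount : s ≤ (((ω i).1.filter (IsTransversal A)).image
      ((↑) : Finset (Fin ((d + 1) * m)) → Set (Fin ((d + 1) * m)))).card := by
    rwa [card_image_of_injective _ coe_injective]
  calc ε * ((blocksOf ω).card : ℝ) ≤ ε * (k * m : ℕ) :=
        mul_le_mul_of_nonneg_left (by exact_mod_cast hcells) hε
    _ ≤ s := hs
    _ ≤ _ := by
      refine Nat.cast_le.2 (hcount.trans (card_le_card fun σ hσ => ?_))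
      obtain ⟨B, hB, rfl⟩ := mem_image.1 hσ
      obtain ⟨hBi, hBt⟩ := mem_filter.1 hB
      obtain ⟨x, hx, hBx⟩ := hBt.exists_eq_range
      refine mem_filter.2 ⟨?_, ?_⟩
      · have hBω : B ∈ blocksOf ω := mem_biUnion.2 ⟨i, mem_univ _, hBi⟩
        simpa [bind_def, mem_sup] using hBω
      · rw [hBx, ← Set.range_comp]
        exact hz x hx

lemma card_isPartitionInto (d m : ℕ) :
    Fintype.card {P : Finset (Finset (Fin ((d + 1) * m))) // IsPartitionInto _ d P} =
      numBlockPartitions d m := by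
  rw [← card_blockPartitions (V := Fin ((d + 1) * m)) (U := univ) (by simp)]
  exact Fintype.card_of_subtype _ fun P => isPartitionInto_iff_mem_blockPartitions.symm

/-- Lower bound for the probability of expansion by a union bound over families of clusters. -/
lemma one_sub_le_probGeomExpander {d L k m s M : ℕ} {ε p : ℝ} (hM : 1 ≤ M)
    (hL : ∀ (V : Type) [Fintype V] (g : V → Fin d → ℝ), ∀ a : ℕ, d ≤ a → L * a ≤ Fintype.card V →
      ∃ A : Fin (d + 1) → Finset V, (∀ i j, i ≠ j → Disjoint (A i) (A j)) ∧
        (∀ i, a ≤ (A i).card) ∧ ∃ z : Fin d → ℝ, ∀ x : Fin (d + 1) → V, (∀ j, x j ∈ A j) →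
          z ∈ convexHull ℝ (Set.range fun j => g (x j)))
    (hLM : 2 * L * M ≤ m) (hε : 0 ≤ ε) (hs : ε * (k * m : ℕ) ≤ s) (hp0 : 0 ≤ p) (hp1 : p ≤ 1)
    (hpM : p * (m : ℝ) ^ d ≤ (M : ℝ) ^ d) :
    1 - 2 ^ ((d + 1) * m * (d + 1)) * (2 ^ s * (1 - p / 2) ^ M) ^ k ≤
      probGeomExpander d k ((d + 1) * m) ε := by
  set n := (d + 1) * m with hn
  let T := {P : Finset (Finset (Fin n)) // IsPartitionInto n d P}
  have hT : (Fintype.card T : ℝ) = numBlockPartitions d m := by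
    exact_mod_cast card_isPartitionInto d m
  have hTpos : (0 : ℝ) < Fintype.card T := by
    rw [hT]
    exact_mod_cast numBlockPartitions_pos d m
  set b := (d + 1) * M + (d + 1) * M with hb
  have hM' : d + 1 ≤ (d + 1) * M := Nat.le_mul_of_pos_right _ hM
  let 𝒜 : Finset (Fin (d + 1) → Finset (Fin n)) := univ.filter fun A =>
    (∀ i j, i ≠ j → Disjoint (A i) (A j)) ∧ ∀ i, b ≤ (A i).card
  let S : (Fin (d + 1) → Finset (Fin n)) → Finset T := fun A =>
    univ.filter fun P => (P.1.filter (IsTransversal A)).card < s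
  have hS : ∀ A ∈ 𝒜, ((S A).card : ℝ) ≤ 2 ^ s * (1 - p / 2) ^ M * Fintype.card T := by
    intro A hA
    obtain ⟨hdisj, hAb⟩ := (mem_filter.1 hA).2
    rw [hT]
    refine le_trans ?_ (card_filter_card_transversal_lt (n := n) hdisj hp1
      (a := (d + 1) * M) (by omega) ?_ hp0 M m s univ (by simp [hn]) (by simp) ?_)
    · norm_cast
      refine card_le_card_of_injOn Subtype.val (fun P hP => ?_) Subtype.val_injective.injOn
      exact mem_filter.2 ⟨isPartitionInto_iff_mem_blockPartitions.1 P.2, (mem_filter.1 hP).2⟩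
    · rw [hn]
      push_cast
      rw [mul_pow, mul_pow, mul_left_comm]
      exact mul_le_mul_of_nonneg_left hpM (by positivity)
    · simpa using hAb
  have hbad : (((univ : Finset (Fin k → T)).filter fun ω =>
      ¬ IsGeomExpander d ε (blocksOf ω)).card : ℝ) ≤
      2 ^ (n * (d + 1)) * (2 ^ s * (1 - p / 2) ^ M * Fintype.card T) ^ k := by
    have hsub : ((univ : Finset (Fin k → T)).filter fun ω =>
        ¬ IsGeomExpander d ε (blocksOf ω)) ⊆
        𝒜.biUnion fun A => Fintype.piFinset fun _ => S A := by
      intro ω hω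
      obtain ⟨A, hA, hAs⟩ := exists_clusters_of_not_isGeomExpander (b := b) hL (by omega)
        (by
          calc L * b = (d + 1) * (2 * L * M) := by rw [hb]; ring
            _ ≤ _ := Nat.mul_le_mul_left _ hLM) hε hs (mem_filter.1 hω).2
      exact mem_biUnion.2 ⟨A, mem_filter.2 ⟨mem_univ _, hA⟩, Fintype.mem_piFinset.2 fun i =>
        mem_filter.2 ⟨mem_univ _, hAs i⟩⟩
    have hcard : ((𝒜.card : ℕ) : ℝ) ≤ 2 ^ (n * (d + 1)) := by
      have : 𝒜.card ≤ 2 ^ (n * (d + 1)) := by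
        refine (card_filter_le _ _).trans (le_of_eq ?_)
        simp [pow_mul]
      exact_mod_cast this
    have hr : 0 ≤ 1 - p / 2 := by linarith
    calc _ ≤ ((∑ A ∈ 𝒜, (S A).card ^ k : ℕ) : ℝ) := by
          refine Nat.cast_le.2 (((card_le_card hsub).trans card_biUnion_le).trans (le_of_eq ?_))
          simp [Fintype.card_piFinset]
      _ = ∑ A ∈ 𝒜, ((S A).card : ℝ) ^ k := by push_cast; rfl
      _ ≤ ∑ A ∈ 𝒜, (2 ^ s * (1 - p / 2) ^ M * Fintype.card T) ^ k :=
          sum_le_sum fun A hA => pow_le_pow_left₀ (by positivity) (hS A hA) k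
      _ = 𝒜.card * (2 ^ s * (1 - p / 2) ^ M * Fintype.card T) ^ k := by
          rw [sum_const, nsmul_eq_mul]
      _ ≤ _ := mul_le_mul_of_nonneg_right hcard (by positivity)
  have htotal : (((univ : Finset (Fin k → T)).filter fun ω =>
      IsGeomExpander d ε (blocksOf ω)).card : ℝ) + (((univ : Finset (Fin k → T)).filter fun ω =>
      ¬ IsGeomExpander d ε (blocksOf ω)).card : ℝ) = (Fintype.card T : ℝ) ^ k := by
    rw [← Nat.cast_add, card_filter_add_card_filter_not, card_univ, Fintype.card_pi, prod_const,
      card_univ, Fintype.card_fin, Nat.cast_pow]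
  have hden : (Fintype.card (Fin k → T) : ℝ) = (Fintype.card T : ℝ) ^ k := by
    rw [Fintype.card_pi, prod_const, card_univ, Fintype.card_fin]
    exact Nat.cast_pow _ _
  change _ ≤ _ / (Fintype.card (Fin k → T) : ℝ)
  rw [hden, le_div_iff₀ (by positivity)]
  rw [mul_pow] at hbad
  change _ ≤ ((((univ : Finset (Fin k → T)).filter fun ω =>
      IsGeomExpander d ε (blocksOf ω)).card : ℕ) : ℝ)
  linarith

lemma probGeomExpander_le_one (d k n : ℕ) (ε : ℝ) : probGeomExpander d k n ε ≤ 1 :=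
  div_le_one_of_le₀ (Nat.cast_le.2 (card_filter_le _ _)) (Nat.cast_nonneg _)

/-- Fox–Gromov–Lafforgue–Naor–Pach: for every `d ≥ 1` there is `k₀` such
that for every `k ≥ k₀` there is `ε > 0` with: the probability that `Y ∈ Y^d(n,k)` is an
`ε`-geometric expander tends to `1` as `n → ∞` along multiples of `d+1`. -/
theorem random_geometric_expanders (d : ℕ) (hd : 1 ≤ d) :
    ∃ k₀ : ℕ, ∀ k : ℕ, k₀ ≤ k → ∃ ε : ℝ, 0 < ε ∧
      Filter.Tendsto (fun m : ℕ => probGeomExpander d k ((d + 1) * m) ε)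
        Filter.atTop (nhds 1) := by
  obtain ⟨L, hLpos, hL⟩ := exists_homogeneous_clusters hd
  set p : ℝ := (1 / (4 * L)) ^ d with hp
  have hL1 : (1 : ℝ) ≤ L := by exact_mod_cast hLpos
  have hp0 : 0 < p := by positivity
  have hp1 : p ≤ 1 := pow_le_one₀ (by positivity) (by rw [div_le_one (by positivity)]; linarith)
  obtain ⟨t, ht⟩ := exists_pow_lt_of_lt_one (show (0 : ℝ) < 1 / 2 by norm_num)
    (show 1 - p / 2 < 1 by linarith)
  have htpos : 0 < t := by
    refine Nat.pos_of_ne_zero ?_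
    rintro rfl
    norm_num at ht
  set K : ℕ := 16 * L * t with hK
  have hKpos : 0 < K := by positivity
  refine ⟨(d + 1) * (d + 1) * K + 1, fun k hk => ⟨1 / (K * k), ?_, ?_⟩⟩
  · have : 0 < k := by omega
    positivity
  have hkpos : (0 : ℝ) < k := by
    have : 0 < k := by omega
    exact_mod_cast this
  have hlim : Filter.Tendsto (fun m : ℕ => 1 - (1 / 2 : ℝ) ^ (m / (2 * L) / (2 * t)))
      Filter.atTop (nhds 1) := by
    have h1 : Filter.Tendsto (fun m : ℕ => m / (2 * L) / (2 * t)) Filter.atTop Filter.atTop :=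
      (Nat.tendsto_div_const_atTop (by positivity)).comp
        (Nat.tendsto_div_const_atTop (by positivity))
    have h2 := (tendsto_pow_atTop_nhds_zero_of_lt_one (show (0 : ℝ) ≤ 1 / 2 by norm_num)
      (by norm_num)).comp h1
    simpa using h2.const_sub 1
  refine tendsto_of_tendsto_of_tendsto_of_le_of_le' hlim tendsto_const_nhds ?_
    (Filter.Eventually.of_forall fun m => probGeomExpander_le_one d k _ _)
  filter_upwards [Filter.eventually_ge_atTop (2 * L * (2 * t))] with m hm
  set M := m / (2 * L)
  set s := M / (2 * t)
  have hM : 2 * t ≤ M := (Nat.le_div_iff_mul_le (by positivity)).2 (by linarith)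
  have hs1 : 1 ≤ s := (Nat.le_div_iff_mul_le (by positivity)).2 (by linarith)
  have hLM : 2 * L * M ≤ m := Nat.mul_div_le _ _
  have htM : 2 * t * s ≤ M := Nat.mul_div_le _ _
  have hmM : m ≤ 4 * L * M := by
    have h1 : m < 2 * L * (M + 1) := Nat.lt_mul_div_succ _ (by positivity)
    have h2 : 2 * L * 1 ≤ 2 * L * M := Nat.mul_le_mul_left _ (by omega)
    linarith
  have hMs : M ≤ 4 * t * s := by
    have h1 : M < 2 * t * (s + 1) := Nat.lt_mul_div_succ _ (by positivity)
    have h2 : 2 * t * 1 ≤ 2 * t * s := Nat.mul_le_mul_left _ hs1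
    linarith
  have hms : m ≤ K * s := by
    calc m ≤ 4 * L * (4 * t * s) := hmM.trans (Nat.mul_le_mul_left _ hMs)
      _ = K * s := by rw [hK]; ring
  have hmain := one_sub_le_probGeomExpander (k := k) (s := s) (ε := 1 / (K * k)) (by omega) hL hLM
    (by positivity) ?_ hp0.le hp1 ?_
  · refine le_trans (sub_le_sub_left ?_ 1) hmain
    have hr : 0 ≤ 1 - p / 2 := by linarith
    have hq : 2 ^ s * (1 - p / 2) ^ M ≤ (1 / 2 : ℝ) ^ s := by
      calc 2 ^ s * (1 - p / 2) ^ M ≤ 2 ^ s * (1 - p / 2) ^ (2 * t * s) :=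
            mul_le_mul_of_nonneg_left (pow_le_pow_of_le_one hr (by linarith) htM) (by positivity)
        _ = (2 * ((1 - p / 2) ^ t * (1 - p / 2) ^ t)) ^ s := by
            rw [mul_pow, ← pow_add, ← pow_mul, ← two_mul]
        _ ≤ (1 / 2 : ℝ) ^ s := by
            refine pow_le_pow_left₀ (by positivity) ?_ s
            have := mul_le_mul ht.le ht.le (by positivity) (by norm_num)
            linarith
    calc (2 : ℝ) ^ ((d + 1) * m * (d + 1)) * (2 ^ s * (1 - p / 2) ^ M) ^ k
        ≤ 2 ^ ((d + 1) * (d + 1) * K * s) * (1 / 2) ^ (((d + 1) * (d + 1) * K + 1) * s) := by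
          refine mul_le_mul ?_ ?_ (by positivity) (by positivity)
          · refine pow_le_pow_right₀ (by norm_num) ?_
            calc (d + 1) * m * (d + 1) = (d + 1) * (d + 1) * m := by ring
              _ ≤ (d + 1) * (d + 1) * (K * s) := Nat.mul_le_mul_left _ hms
              _ = _ := by ring
          · refine (pow_le_pow_left₀ (by positivity) hq k).trans ?_
            rw [← pow_mul]
            refine pow_le_pow_of_le_one (by norm_num) (by norm_num) ?_
            rw [mul_comm s k]
            exact Nat.mul_le_mul_right _ hk
      _ = (2 * (1 / 2)) ^ ((d + 1) * (d + 1) * K * s) * (1 / 2) ^ s := by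
          rw [add_mul _ 1 s, one_mul, pow_add, mul_pow]
          exact (mul_assoc _ _ _).symm
      _ = (1 / 2) ^ s := by norm_num
  · push_cast
    calc 1 / ((K : ℝ) * k) * (k * m) = m / K := by field_simp
      _ ≤ s := by
        rw [div_le_iff₀ (by positivity), mul_comm]
        exact_mod_cast hms
  · rw [hp, ← mul_pow]
    refine pow_le_pow_left₀ (by positivity) ?_ d
    rw [div_mul_eq_mul_div, one_mul, div_le_iff₀ (by positivity), mul_comm]
    exact_mod_cast hmM
end

section
/- (Alon–Boppana) For every k ≥ 3 and every ε > 0 there exists N such that every finite connected k-regular simple graph with at least N vertices has an eigenvalue λ of its adjacency matrix with λ ≠ k and λ > 2√(k−1) − ε. -/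
open Finset in
/-- If every eigenvector of a real Hermitian matrix with eigenvalue above `μ` is orthogonal to `h`,
then the quadratic form of the matrix at `h` is at most `μ` times the square norm of `h`. -/
theorem Matrix.IsHermitian.dotProduct_mulVec_le {n : Type*} [Fintype n] [DecidableEq n]
    {A : Matrix n n ℝ} (hA : A.IsHermitian) (h : n → ℝ) (μ : ℝ)
    (H : ∀ (lam : ℝ) (e : n → ℝ), e ≠ 0 → A.mulVec e = lam • e → lam ≤ μ ∨ e ⬝ᵥ h = 0) :
    h ⬝ᵥ A.mulVec h ≤ μ * (h ⬝ᵥ h) := by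
  have key (y : n → ℝ) : h ⬝ᵥ y =
      ∑ i, (⇑(hA.eigenvectorBasis i) ⬝ᵥ h) * (⇑(hA.eigenvectorBasis i) ⬝ᵥ y) := by
    have := hA.eigenvectorBasis.sum_inner_mul_inner (WithLp.toLp 2 h) (WithLp.toLp 2 y)
    simp only [EuclideanSpace.inner_eq_star_dotProduct, star_trivial] at this
    rw [dotProduct_comm h y, ← this]
    refine sum_congr rfl fun i _ ↦ ?_
    rw [dotProduct_comm y]
  rw [key, key h, mul_sum]
  refine sum_le_sum fun i _ ↦ ?_
  have hev : ⇑(hA.eigenvectorBasis i) ⬝ᵥ A.mulVec h =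
      hA.eigenvalues i * (⇑(hA.eigenvectorBasis i) ⬝ᵥ h) := by
    have hT : A.transpose = A := by simpa using hA.eq
    rw [Matrix.dotProduct_mulVec, ← Matrix.mulVec_transpose, hT, hA.mulVec_eigenvectorBasis,
      smul_dotProduct, smul_eq_mul]
  have hne : (⇑(hA.eigenvectorBasis i) : n → ℝ) ≠ 0 := fun h0 ↦
    hA.eigenvectorBasis.orthonormal.ne_zero i (by ext j; exact congrFun h0 j)
  rw [hev]
  rcases H _ _ hne (hA.mulVec_eigenvectorBasis i) with hle | h0
  · nlinarith [mul_le_mul_of_nonneg_right hle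
      (mul_self_nonneg (⇑(hA.eigenvectorBasis i) ⬝ᵥ h))]
  · simp [h0]

/-- The radial weight at distance `d` of the test function in the Alon–Boppana theorem. -/
noncomputable def alonBoppanaWeight (s : ℝ) (L d : ℕ) : ℝ :=
  (d + 1 + 1 / s ^ 2) * ((L - d : ℕ) : ℝ) / s ^ d

section Weight

variable {s : ℝ} {L : ℕ}

theorem alonBoppanaWeight_nonneg (hs : 0 < s) (d : ℕ) : 0 ≤ alonBoppanaWeight s L d := by
  unfold alonBoppanaWeight; positivity

theorem alonBoppanaWeight_pos (hs : 0 < s) {d : ℕ} (hd : d < L) :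
    0 < alonBoppanaWeight s L d := by
  have : 0 < L - d := by omega
  unfold alonBoppanaWeight; positivity

theorem alonBoppanaWeight_eq_zero {d : ℕ} (hd : L ≤ d) : alonBoppanaWeight s L d = 0 := by
  simp [alonBoppanaWeight, Nat.sub_eq_zero_of_le hd]

theorem alonBoppanaWeight_succ_le (hs : 1.4 ≤ s) {d : ℕ} (hd : 1 ≤ d) :
    alonBoppanaWeight s L (d + 1) ≤ alonBoppanaWeight s L d := by
  have hs0 : 0 < s := by linarith
  have hd' : (1 : ℝ) ≤ d := by exact_mod_cast hd
  have hsub : ((L - (d + 1) : ℕ) : ℝ) ≤ ((L - d : ℕ) : ℝ) := by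
    exact_mod_cast (by omega : L - (d + 1) ≤ L - d)
  have hcoef : (d : ℝ) + 2 + 1 / s ^ 2 ≤ s * (d + 1 + 1 / s ^ 2) := by
    have h1 : 1 ≤ (s - 1) * (2 + 1 / s ^ 2) := by
      have : (s - 1) * (2 + 1 / s ^ 2) = ((s - 1) * (2 * s ^ 2 + 1)) / s ^ 2 := by
        field_simp
      rw [this, le_div_iff₀ (by positivity)]
      nlinarith [mul_nonneg (sub_nonneg.2 hs) (by nlinarith : 0 ≤ 2 * s ^ 2 - 0.2 * s + 0.72)]
    nlinarith
  unfold alonBoppanaWeight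
  rw [div_le_div_iff₀ (by positivity) (by positivity), pow_succ]
  push_cast
  calc ((d : ℝ) + 1 + 1 + 1 / s ^ 2) * ((L - (d + 1) : ℕ) : ℝ) * s ^ d
      ≤ (s * (d + 1 + 1 / s ^ 2)) * ((L - d : ℕ) : ℝ) * s ^ d := by
        gcongr; linarith
    _ = _ := by ring

theorem alonBoppanaWeight_anti (hs : 1.4 ≤ s) {d e : ℕ} (hd : 1 ≤ d) (hde : d ≤ e) :
    alonBoppanaWeight s L e ≤ alonBoppanaWeight s L d := by
  induction e, hde using Nat.le_induction with
  | base => exact le_rfl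
  | succ e he ih => exact (alonBoppanaWeight_succ_le hs (hd.trans he)).trans ih

theorem le_alonBoppanaWeight_add (hs : 0 < s) (hL : 0 < L) (d : ℕ) :
    (2 - 2 / L) * s * alonBoppanaWeight s L (d + 1) ≤
      alonBoppanaWeight s L d + s ^ 2 * alonBoppanaWeight s L (d + 2) := by
  rcases le_or_gt L (d + 1) with h | h
  · rw [alonBoppanaWeight_eq_zero h, mul_zero]
    have := alonBoppanaWeight_nonneg (L := L) hs d
    have := alonBoppanaWeight_nonneg (L := L) hs (d + 2)
    positivity
  · obtain ⟨m, rfl⟩ := Nat.exists_eq_add_of_lt h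
    unfold alonBoppanaWeight
    rw [show d + 1 + m + 1 - (d + 1) = m + 1 by omega, show d + 1 + m + 1 - d = m + 2 by omega,
      show d + 1 + m + 1 - (d + 2) = m by omega]
    push_cast
    set c : ℝ := 1 / s ^ 2 with hc
    have hc0 : 0 ≤ c := by positivity
    have hl : (2 - 2 / ((d : ℝ) + 1 + m + 1)) * s * ((d + 1 + 1 + c) * (m + 1) / s ^ (d + 1)) =
        (2 - 2 / ((d : ℝ) + 1 + m + 1)) * ((d + 1 + 1 + c) * (m + 1)) / s ^ d := by
      rw [pow_succ]; field_simp
    have hr : ((d : ℝ) + 1 + c) * (m + 2) / s ^ d + s ^ 2 * ((d + 2 + 1 + c) * m / s ^ (d + 2)) =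
        (((d : ℝ) + 1 + c) * (m + 2) + (d + 2 + 1 + c) * m) / s ^ d := by
      rw [pow_add]; field_simp
    rw [hl, hr]
    gcongr
    have hT : 1 ≤ ((d : ℝ) + 1 + 1 + c) * (m + 1) / (d + 1 + m + 1) := by
      rw [one_le_div (by positivity)]
      nlinarith [mul_nonneg (Nat.cast_nonneg (α := ℝ) d) (Nat.cast_nonneg (α := ℝ) m),
        mul_nonneg hc0 (Nat.cast_nonneg (α := ℝ) m), Nat.cast_nonneg (α := ℝ) m]
    have : (2 - 2 / ((d : ℝ) + 1 + m + 1)) * ((d + 1 + 1 + c) * (m + 1)) =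
        2 * ((d + 1 + 1 + c) * (m + 1)) -
          2 * (((d : ℝ) + 1 + 1 + c) * (m + 1) / (d + 1 + m + 1)) := by ring
    rw [this]
    nlinarith

theorem alonBoppanaWeight_zero_le (hs : 0 < s) (hL : 0 < L) :
    (2 - 2 / L) * s * alonBoppanaWeight s L 0 ≤ (s ^ 2 + 1) * alonBoppanaWeight s L 1 := by
  obtain ⟨m, rfl⟩ := Nat.exists_eq_succ_of_ne_zero hL.ne'
  simp only [alonBoppanaWeight, Nat.succ_eq_add_one, Nat.add_sub_cancel, Nat.sub_zero]
  push_cast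
  rw [← sub_nonneg]
  have : (m : ℝ) + 1 ≠ 0 := by positivity
  calc (0 : ℝ) ≤ (s ^ 2 + 1) * m / s ^ 3 := by positivity
    _ = _ := by
      field_simp
      ring

end Weight

namespace SimpleGraph

variable {V : Type*} [Fintype V] [DecidableEq V] {G : SimpleGraph V} [DecidableRel G.Adj] {k : ℕ}

theorem Connected.exists_adj_dist_eq {V : Type*} {G : SimpleGraph V} (hG : G.Connected) {v x : V}
    {d : ℕ} (hx : G.dist v x = d + 1) : ∃ y, G.Adj x y ∧ G.dist v y = d := by
  obtain ⟨p, hp⟩ := hG.exists_walk_length_eq_dist x v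
  rw [dist_comm, hx] at hp
  cases p with
  | nil => simp at hp
  | @cons _ y _ h q =>
    refine ⟨y, h, ?_⟩
    have h1 : G.dist y v ≤ q.length := dist_le q
    have h2 := hG.dist_triangle (u := v) (v := y) (w := x)
    rw [dist_eq_one_iff_adj.2 h.symm, hx] at h2
    rw [dist_comm] at h1
    simp only [Walk.length_cons] at hp
    omega

theorem Connected.card_dist_le (hG : G.Connected) (hreg : G.IsRegularOfDegree k) (v : V) (d : ℕ) :
    Finset.card {x | G.dist v x ≤ d} ≤ (k + 1) ^ d := by
  induction d with
  | zero => simp [hG.dist_eq_zero_iff, Finset.filter_eq]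
  | succ d ih =>
    have hsub : ({x | G.dist v x ≤ d + 1} : Finset V) ⊆
        ({x | G.dist v x ≤ d} : Finset V).biUnion fun y ↦ insert y (G.neighborFinset y) := by
      intro x hx
      simp only [Finset.mem_filter, Finset.mem_univ, true_and, Finset.mem_biUnion,
        Finset.mem_insert, mem_neighborFinset] at hx ⊢
      rcases hx.lt_or_eq with hlt | heq
      · exact ⟨x, by omega, Or.inl rfl⟩
      · obtain ⟨y, hxy, hy⟩ := hG.exists_adj_dist_eq heq
        exact ⟨y, hy.le, Or.inr hxy.symm⟩
    refine (Finset.card_le_card hsub).trans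
      ((Finset.card_biUnion_le_card_mul _ _ (k + 1) ?_).trans ?_)
    · intro y _
      refine (Finset.card_insert_le _ _).trans ?_
      rw [card_neighborFinset_eq_degree, hreg y]
    · rw [pow_succ]; gcongr

/-- An eigenvector of a connected regular graph for the degree eigenvalue is constant. -/
theorem Connected.eq_of_adjMatrix_mulVec_eq (hG : G.Connected) (hreg : G.IsRegularOfDegree k)
    {e : V → ℝ} (he : (G.adjMatrix ℝ).mulVec e = (k : ℝ) • e) (x y : V) : e x = e y := by
  refine (G.lapMatrix_mulVec_eq_zero_iff_forall_reachable (x := e)).1 ?_ x y (hG x y)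
  ext z
  have := congrFun he z
  rw [adjMatrix_mulVec_apply] at this
  rw [lapMatrix_mulVec_apply, this, hreg z]
  simp

/-- If every eigenvalue other than the degree is at most `μ`, the adjacency quadratic form is
bounded by `μ` up to the contribution of the constant vector. -/
theorem Connected.dotProduct_adjMatrix_mulVec_le (hG : G.Connected) (hreg : G.IsRegularOfDegree k)
    (μ : ℝ) (H : ∀ (lam : ℝ) (e : V → ℝ), e ≠ 0 → (G.adjMatrix ℝ).mulVec e = lam • e →
      lam ≠ k → lam ≤ μ) (f : V → ℝ) :
    f ⬝ᵥ (G.adjMatrix ℝ).mulVec f ≤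
      μ * (f ⬝ᵥ f) + (k - μ) * ((∑ x, f x) ^ 2 / Fintype.card V) := by
  have := hG.nonempty
  have hn : (Fintype.card V : ℝ) ≠ 0 := by exact_mod_cast Fintype.card_ne_zero
  set m : ℝ := (∑ x, f x) / Fintype.card V with hm
  have hnm : Fintype.card V * m = ∑ x, f x := by rw [hm]; field_simp
  set h : V → ℝ := f - Function.const V m with hh
  have hsum : ∑ x, h x = 0 := by
    simp [hh, hnm]
  have key := (G.isHermitian_adjMatrix ℝ).dotProduct_mulVec_le h μ fun lam e he0 he ↦ by
    by_cases hk : lam = k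
    · right
      subst hk
      obtain ⟨v⟩ := this
      have hc : e = Function.const V (e v) :=
        funext fun x ↦ hG.eq_of_adjMatrix_mulVec_eq hreg he x v
      rw [hc]
      simp only [dotProduct, Function.const_apply, ← Finset.mul_sum, hsum, mul_zero]
    · exact Or.inl (H lam e he0 he hk)
  have hconst : (G.adjMatrix ℝ).mulVec (Function.const V m) = Function.const V (k * m) :=
    funext fun x ↦ by rw [adjMatrix_mulVec_const_apply_of_regular hreg]; rfl
  have hdc (y : V → ℝ) (a : ℝ) : y ⬝ᵥ Function.const V a = (∑ x, y x) * a := by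
    simp [dotProduct, Finset.sum_mul]
  have hAf : Function.const V m ⬝ᵥ (G.adjMatrix ℝ).mulVec f = k * m * ∑ x, f x := by
    rw [Matrix.dotProduct_mulVec, ← Matrix.mulVec_transpose, transpose_adjMatrix, hconst,
      dotProduct_comm, hdc]
    ring
  have h1 : h ⬝ᵥ (G.adjMatrix ℝ).mulVec h =
      f ⬝ᵥ (G.adjMatrix ℝ).mulVec f - k * m * ∑ x, f x := by
    conv_lhs => rw [show (G.adjMatrix ℝ).mulVec h =
      (G.adjMatrix ℝ).mulVec f - Function.const V (k * m) by rw [hh, Matrix.mulVec_sub, hconst]]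
    rw [dotProduct_sub, hdc, hsum, zero_mul, sub_zero, hh, sub_dotProduct, hAf]
  have h2 : h ⬝ᵥ h = f ⬝ᵥ f - m * ∑ x, f x := by
    conv_lhs => rhs; rw [hh]
    rw [dotProduct_sub, hdc, hsum, zero_mul, sub_zero, hh, sub_dotProduct,
      dotProduct_comm (Function.const V m) f, hdc]
    ring
  rw [h1, h2] at key
  have h3 : (∑ x, f x) ^ 2 / Fintype.card V = m * ∑ x, f x := by rw [hm]; ring
  rw [h3]
  linarith

theorem Connected.le_adjMatrix_mulVec_alonBoppanaWeight (hG : G.Connected)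
    (hreg : G.IsRegularOfDegree k) {s : ℝ} (hs : 1.4 ≤ s) (hsk : s ^ 2 + 1 = k) {L : ℕ}
    (hL : 0 < L) (v x : V) :
    (2 - 2 / L) * s * alonBoppanaWeight s L (G.dist v x) ≤
      (G.adjMatrix ℝ).mulVec (fun y ↦ alonBoppanaWeight s L (G.dist v y)) x := by
  have hs0 : 0 < s := by linarith
  have hcard : (G.neighborFinset x).card = k := by rw [card_neighborFinset_eq_degree, hreg x]
  rw [adjMatrix_mulVec_apply]
  rcases hd : G.dist v x with _ | d
  · obtain rfl := hG.dist_eq_zero_iff.1 hd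
    refine (alonBoppanaWeight_zero_le hs0 hL).trans ?_
    rw [hsk, ← hcard, ← nsmul_eq_mul]
    refine Finset.card_nsmul_le_sum _ _ _ fun y hy ↦ ?_
    rw [dist_eq_one_iff_adj.2 ((G.mem_neighborFinset _ _).1 hy)]
  · obtain ⟨y₀, hxy, hy₀⟩ := hG.exists_adj_dist_eq hd
    have hmem : y₀ ∈ G.neighborFinset x := (G.mem_neighborFinset _ _).2 hxy
    rw [← Finset.add_sum_erase _ _ hmem, hy₀]
    refine (le_alonBoppanaWeight_add hs0 hL d).trans ?_
    gcongr
    have hc : (((G.neighborFinset x).erase y₀).card : ℝ) = s ^ 2 := by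
      rw [Finset.card_erase_of_mem hmem, hcard, Nat.cast_pred, ← hsk]
      · ring
      · rw [← hcard]; exact Finset.card_pos.2 ⟨_, hmem⟩
    rw [← hc, ← nsmul_eq_mul]
    refine Finset.card_nsmul_le_sum _ _ _ fun y hy ↦ ?_
    obtain ⟨hne, hy⟩ := Finset.mem_erase.1 hy
    have hadj := (G.mem_neighborFinset _ _).1 hy
    have htri := hG.dist_triangle (u := v) (v := x) (w := y)
    have htri' := hG.dist_triangle (u := v) (v := y) (w := x)
    rw [dist_eq_one_iff_adj.2 hadj, hd] at htri
    rw [dist_eq_one_iff_adj.2 hadj.symm, hd] at htri'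
    refine alonBoppanaWeight_anti hs ?_ htri
    by_contra! h0
    have hy0 : G.dist v y = 0 := by omega
    obtain rfl := hG.dist_eq_zero_iff.1 hy0
    have : d = 0 := by omega
    exact hne (hG.dist_eq_zero_iff.1 (hy₀.trans this))

/-- A connected regular graph whose eigenvalues other than the degree are all at most `μ` satisfies
a quantitative Alon–Boppana bound. -/
theorem Connected.two_sub_mul_sqrt_le (hG : G.Connected)
    (hreg : G.IsRegularOfDegree k) {s : ℝ} (hs : 1.4 ≤ s) (hsk : s ^ 2 + 1 = k) {L : ℕ}
    (hL : 0 < L) {μ : ℝ} (hμ : μ ≤ k) (H : ∀ (lam : ℝ) (e : V → ℝ), e ≠ 0 →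
      (G.adjMatrix ℝ).mulVec e = lam • e → lam ≠ k → lam ≤ μ) :
    (2 - 2 / L) * s ≤ μ + (k - μ) * ((k + 1) ^ L / Fintype.card V) := by
  have hs0 : 0 < s := by linarith
  obtain ⟨v⟩ := hG.nonempty
  set f : V → ℝ := fun y ↦ alonBoppanaWeight s L (G.dist v y) with hf
  have hf0 (x : V) : 0 ≤ f x := alonBoppanaWeight_nonneg hs0 _
  have hpos : 0 < f ⬝ᵥ f := by
    refine Finset.sum_pos' (fun x _ ↦ mul_self_nonneg _) ⟨v, Finset.mem_univ _, ?_⟩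
    have : 0 < f v := by simpa [hf] using alonBoppanaWeight_pos hs0 hL
    positivity
  have hlow : (2 - 2 / L) * s * (f ⬝ᵥ f) ≤ f ⬝ᵥ (G.adjMatrix ℝ).mulVec f := by
    rw [dotProduct, dotProduct, Finset.mul_sum]
    refine Finset.sum_le_sum fun x _ ↦ ?_
    have := mul_le_mul_of_nonneg_left
      (hG.le_adjMatrix_mulVec_alonBoppanaWeight hreg hs hsk hL v x) (hf0 x)
    calc _ = f x * ((2 - 2 / L) * s * alonBoppanaWeight s L (G.dist v x)) := by ring
      _ ≤ _ := this
  have hCS : (∑ x, f x) ^ 2 ≤ (k + 1) ^ L * (f ⬝ᵥ f) := by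
    have hsupp : ∑ x, f x = ∑ x with G.dist v x ≤ L, f x := by
      refine (Finset.sum_subset (Finset.subset_univ _) fun x _ hx ↦ ?_).symm
      simp only [Finset.mem_filter, Finset.mem_univ, true_and, not_le] at hx
      exact alonBoppanaWeight_eq_zero hx.le
    have hc : (Finset.card {x | G.dist v x ≤ L} : ℝ) ≤ (k + 1) ^ L := by
      exact_mod_cast hG.card_dist_le hreg v L
    rw [hsupp]
    refine sq_sum_le_card_mul_sum_sq.trans (mul_le_mul hc ?_ (by positivity) (by positivity))
    simp only [dotProduct, ← sq]
    exact Finset.sum_le_sum_of_subset_of_nonneg (Finset.subset_univ _) fun x _ _ ↦ sq_nonneg _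
  have hup := hG.dotProduct_adjMatrix_mulVec_le hreg μ H f
  refine le_of_mul_le_mul_right (hlow.trans (hup.trans ?_)) hpos
  calc μ * (f ⬝ᵥ f) + (k - μ) * ((∑ x, f x) ^ 2 / Fintype.card V)
      ≤ μ * (f ⬝ᵥ f) + (k - μ) * (((k + 1) ^ L * (f ⬝ᵥ f)) / Fintype.card V) := by
        have := sub_nonneg.2 hμ
        gcongr
    _ = _ := by ring

end SimpleGraph

/-- Alon–Boppana: for every `k ≥ 3` and `ε > 0` there is `N` such that
every finite connected `k`-regular graph on at least `N` vertices has an eigenvalue `λ`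
of its adjacency matrix with `λ ≠ k` and `λ > 2√(k-1) - ε`. -/
theorem alon_boppana (k : ℕ) (hk : 3 ≤ k) (ε : ℝ) (hε : 0 < ε) :
    ∃ N : ℕ, ∀ (V : Type) [Fintype V] [DecidableEq V]
      (G : SimpleGraph V) [DecidableRel G.Adj],
      G.Connected → G.IsRegularOfDegree k → N ≤ Fintype.card V →
      ∃ lam : ℝ, (∃ f : V → ℝ, f ≠ 0 ∧ (G.adjMatrix ℝ).mulVec f = lam • f) ∧
        lam ≠ (k : ℝ) ∧ 2 * Real.sqrt ((k : ℝ) - 1) - ε < lam := by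
  have hk' : (3 : ℝ) ≤ k := by exact_mod_cast hk
  set s := Real.sqrt ((k : ℝ) - 1) with hs_def
  have hsq : s ^ 2 = k - 1 := Real.sq_sqrt (by linarith)
  have hs : 1.4 ≤ s := Real.le_sqrt_of_sq_le (by norm_num; linarith)
  set μ := 2 * s - ε with hμ_def
  have hμ : μ ≤ k := by nlinarith [sq_nonneg (s - 1)]
  obtain ⟨L, hL⟩ := exists_nat_gt (4 * s / ε)
  have hL0 : (0 : ℝ) < L := lt_of_le_of_lt (by positivity) hL
  obtain ⟨N, hN⟩ := exists_nat_gt (2 * ((k - μ) * (k + 1) ^ L) / ε)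
  refine ⟨N, fun V _ _ G _ hG hreg hcard ↦ ?_⟩
  by_contra! hcon
  have hbound := hG.two_sub_mul_sqrt_le hreg hs (by linarith) (Nat.cast_pos.1 hL0) hμ
    fun lam e he0 he hlam ↦ hcon lam ⟨e, he0, he⟩ hlam
  have hcard' : (N : ℝ) ≤ Fintype.card V := by exact_mod_cast hcard
  have hNpos : (0 : ℝ) < Fintype.card V := by
    have := hG.nonempty
    exact_mod_cast Fintype.card_pos
  have h1 : 2 / L * s < ε / 2 := by
    rw [div_lt_iff₀ hε] at hL
    rw [div_mul_eq_mul_div, div_lt_iff₀ hL0]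
    linarith
  have h2 : (k - μ) * ((k + 1) ^ L / Fintype.card V) < ε / 2 := by
    have := hN.trans_le hcard'
    rw [div_lt_iff₀ hε] at this
    rw [← mul_div_assoc, div_lt_iff₀ hNpos]
    linarith
  nlinarith
end

section
/- (Kesten) Let k ≥ 2 and let T be an infinite connected acyclic k-regular simple graph (the k-regular tree). Let A be the adjacency operator on ℓ²(V(T)) given by (Af)(u) = Σ_{v adjacent to u} f(v); A is a bounded self-adjoint operator, and its spectrum is exactly the interval [−2√(k−1), 2√(k−1)]. -/
open scoped ENNReal

open Filter Topology

open scoped Finset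

namespace SimpleGraph

variable {V : Type*} {G : SimpleGraph V}

lemma Connected.exists_adj_dist_eq_s18 (hG : G.Connected) {o v : V} {n : ℕ}
    (hv : G.dist o v = n + 1) : ∃ u, G.Adj v u ∧ G.dist o u = n := by
  obtain ⟨p, hp⟩ := hG.exists_walk_length_eq_dist v o
  rw [dist_comm, hv] at hp
  cases p with
  | nil => simp at hp
  | @cons _ u _ h p =>
    have h1 : G.dist o u ≤ n := by
      rw [dist_comm]
      simp only [Walk.length_cons, add_left_inj] at hp
      exact hp ▸ G.dist_le p
    have h2 := h.diff_dist_adj (u := o)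
    exact ⟨u, h, by omega⟩

lemma Connected.finite_setOf_dist_eq [G.LocallyFinite] (hG : G.Connected) (o : V) (n : ℕ) :
    {v | G.dist o v = n}.Finite := by
  induction n with
  | zero => simp [hG.dist_eq_zero_iff]
  | succ n ih =>
    refine (ih.biUnion fun u _ => (G.neighborFinset u).finite_toSet).subset fun v hv => ?_
    obtain ⟨w, hw, hdw⟩ := hG.exists_adj_dist_eq_s18 (show G.dist o v = n + 1 from hv)
    simp only [Set.mem_iUnion]
    exact ⟨w, hdw, by simpa using hw.symm⟩

/-- The finite set of vertices at distance `n` from `o`. -/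
noncomputable def distSphere [G.LocallyFinite] (hG : G.Connected) (o : V) (n : ℕ) : Finset V :=
  (hG.finite_setOf_dist_eq o n).toFinset

@[simp]
lemma mem_distSphere [G.LocallyFinite] (hG : G.Connected) {o v : V} {n : ℕ} :
    v ∈ distSphere hG o n ↔ G.dist o v = n := by
  simp [distSphere]

lemma distSphere_zero [G.LocallyFinite] (hG : G.Connected) (o : V) : distSphere hG o 0 = {o} := by
  ext v
  simp [hG.dist_eq_zero_iff, eq_comm]

lemma IsTree.eq_of_adj_of_dist_eq (hG : G.IsTree) {o v u w : V} (hu : G.Adj u v)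
    (hw : G.Adj w v) (hdu : G.dist o v = G.dist o u + 1) (hdw : G.dist o v = G.dist o w + 1) :
    u = w := by
  obtain ⟨p, hp⟩ := hG.connected.exists_walk_length_eq_dist o u
  obtain ⟨q, hq⟩ := hG.connected.exists_walk_length_eq_dist o w
  have h1 : (p.concat hu).IsPath := Walk.isPath_of_length_eq_dist _ (by simp [hp, hdu])
  have h2 : (q.concat hw).IsPath := Walk.isPath_of_length_eq_dist _ (by simp [hq, hdw])
  have h3 := congrArg (fun r : G.Path o v => r.1.penultimate)
    ((hG.isAcyclic.subsingleton_path o v).elim ⟨_, h1⟩ ⟨_, h2⟩)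
  simpa using h3

section Tree

variable [G.LocallyFinite] {k : ℕ}

lemma IsTree.card_filter_parent (hG : G.IsTree) {o v : V} {n : ℕ} (hv : G.dist o v = n + 1) :
    #{u ∈ G.neighborFinset v | G.dist o u = n} = 1 := by
  obtain ⟨w, hw, hdw⟩ := hG.connected.exists_adj_dist_eq_s18 hv
  rw [Finset.card_eq_one]
  refine ⟨w, ?_⟩
  ext u
  simp only [Finset.mem_filter, mem_neighborFinset, Finset.mem_singleton]
  refine ⟨fun hu => hG.eq_of_adj_of_dist_eq (o := o) hu.1.symm hw.symm (by omega) (by omega), ?_⟩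
  rintro rfl
  exact ⟨hw, hdw⟩

lemma IsTree.card_filter_child_add (hG : G.IsTree) (hk : G.IsRegularOfDegree k) {o v : V} {n : ℕ}
    (hv : G.dist o v = n + 1) :
    #{u ∈ G.neighborFinset v | G.dist o u = n + 2} + 1 = k := by
  rw [← hG.card_filter_parent hv, ← hk v, ← card_neighborFinset_eq_degree,
    ← Finset.card_filter_add_card_filter_not (s := G.neighborFinset v) (fun u => G.dist o u = n + 2)]
  congr 2
  refine Finset.filter_congr fun u hu => ?_
  have := hG.dist_eq_dist_add_one_of_adj o ((G.mem_neighborFinset v u).1 hu)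
  omega

lemma card_filter_child_root (hk : G.IsRegularOfDegree k) (o : V) :
    #{u ∈ G.neighborFinset o | G.dist o u = 1} = k := by
  rw [← hk o, ← card_neighborFinset_eq_degree, Finset.filter_true_of_mem]
  intro u hu
  simpa [dist_eq_one_iff_adj] using hu

lemma sum_distSphere_filter_neighbor {R : Type*} [Semiring R] (hG : G.Connected) (o : V)
    (n m : ℕ) (f : V → R) :
    ∑ u ∈ distSphere hG o n, ∑ v ∈ G.neighborFinset u with G.dist o v = m, f v =
      ∑ v ∈ distSphere hG o m, (#{u ∈ G.neighborFinset v | G.dist o u = n} : R) * f v := by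
  rw [Finset.sum_comm' (t' := distSphere hG o m)
    (s' := fun v => {u ∈ G.neighborFinset v | G.dist o u = n})]
  · simp
  · intro u v
    simp only [mem_distSphere, Finset.mem_filter, mem_neighborFinset, G.adj_comm u v]
    tauto

lemma IsTree.sum_neighbor_eq (hG : G.IsTree) {R : Type*} [AddCommMonoid R] {o u : V} {n : ℕ}
    (hu : G.dist o u = n + 1) (f : V → R) :
    ∑ v ∈ G.neighborFinset u, f v = ∑ v ∈ G.neighborFinset u with G.dist o v = n + 2, f v +
      ∑ v ∈ G.neighborFinset u with G.dist o v = n, f v := by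
  rw [← Finset.sum_filter_add_sum_filter_not (G.neighborFinset u) (fun v => G.dist o v = n + 2)]
  congr 1
  refine Finset.sum_congr (Finset.filter_congr fun v hv => ?_) fun _ _ => rfl
  have := hG.dist_eq_dist_add_one_of_adj o ((G.mem_neighborFinset u v).1 hv)
  omega

lemma sum_neighbor_root {R : Type*} [AddCommMonoid R] (hG : G.Connected) (o : V) (f : V → R) :
    ∑ v ∈ G.neighborFinset o, f v = ∑ v ∈ distSphere hG o 1, f v := by
  refine Finset.sum_congr ?_ fun _ _ => rfl
  ext v
  simp [dist_eq_one_iff_adj]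

lemma IsTree.sum_distSphere_one_neighbor {R : Type*} [Semiring R] (hG : G.IsTree)
    (hk : G.IsRegularOfDegree k) (o : V) (f : V → R) :
    ∑ u ∈ distSphere hG.connected o 1, ∑ v ∈ G.neighborFinset u, f v =
      ∑ v ∈ distSphere hG.connected o 2, f v + k * f o := by
  rw [Finset.sum_congr rfl fun u hu =>
      hG.sum_neighbor_eq (n := 0) ((mem_distSphere hG.connected).1 hu) f, Finset.sum_add_distrib,
    sum_distSphere_filter_neighbor, sum_distSphere_filter_neighbor, distSphere_zero,
    Finset.sum_singleton, card_filter_child_root hk]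
  congr 1
  refine Finset.sum_congr rfl fun v hv => ?_
  rw [hG.card_filter_parent (by simpa using hv)]
  simp

lemma IsTree.sum_distSphere_add_two_neighbor {R : Type*} [Ring R] (hG : G.IsTree)
    (hk : G.IsRegularOfDegree k) (o : V) (n : ℕ) (f : V → R) :
    ∑ u ∈ distSphere hG.connected o (n + 2), ∑ v ∈ G.neighborFinset u, f v =
      ∑ v ∈ distSphere hG.connected o (n + 3), f v +
        (k - 1) * ∑ v ∈ distSphere hG.connected o (n + 1), f v := by
  rw [Finset.sum_congr rfl fun u hu =>
      hG.sum_neighbor_eq (n := n + 1) ((mem_distSphere hG.connected).1 hu) f, Finset.sum_add_distrib,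
    sum_distSphere_filter_neighbor, sum_distSphere_filter_neighbor, Finset.mul_sum]
  congr 1
  · refine Finset.sum_congr rfl fun v hv => ?_
    rw [hG.card_filter_parent (by simpa using hv)]
    simp
  · refine Finset.sum_congr rfl fun v hv => ?_
    rw [← hG.card_filter_child_add hk ((mem_distSphere hG.connected).1 hv)]
    simp

lemma IsTree.card_distSphere_le (hG : G.IsTree) (hk : G.IsRegularOfDegree k) (h2 : 2 ≤ k)
    (o : V) (n : ℕ) : (#(distSphere hG.connected o n) : ℝ) ≤ 2 * ((k : ℝ) - 1) ^ n := by
  have h2' : (2 : ℝ) ≤ k := by exact_mod_cast h2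
  have key (n : ℕ) : (#(distSphere hG.connected o (n + 1)) : ℝ) =
      ∑ u ∈ distSphere hG.connected o n, (#{v ∈ G.neighborFinset u | G.dist o v = n + 1} : ℝ) := by
    have := sum_distSphere_filter_neighbor hG.connected o n (n + 1) (fun _ => (1 : ℝ))
    simp only [Finset.sum_const, nsmul_eq_mul, mul_one] at this
    rw [this, Finset.sum_congr rfl fun v hv => by
      rw [hG.card_filter_parent ((mem_distSphere hG.connected).1 hv)]]
    simp
  induction n with
  | zero => simp [distSphere_zero]
  | succ n ih =>
    rw [key]
    cases n with
    | zero =>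
      rw [distSphere_zero, Finset.sum_singleton, zero_add, card_filter_child_root hk]
      linarith
    | succ n =>
      have hc (u : V) (hu : u ∈ distSphere hG.connected o (n + 1)) :
          (#{v ∈ G.neighborFinset u | G.dist o v = n + 1 + 1} : ℝ) = k - 1 := by
        rw [← hG.card_filter_child_add hk ((mem_distSphere hG.connected).1 hu)]
        simp
      rw [Finset.sum_congr rfl hc, Finset.sum_const, nsmul_eq_mul, pow_succ _ (n + 1)]
      nlinarith

/-- The function `v ↦ ρ⁻ᵈ`, with `ρ = √(k - 1)` and `d` the distance to a root, is a positive
superharmonic function on the `k`-regular tree for the eigenvalue `2 * ρ`. -/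
lemma IsTree.sum_neighbor_pow_dist_le (hG : G.IsTree) (hk : G.IsRegularOfDegree k) (h2 : 2 ≤ k)
    (o u : V) :
    ∑ v ∈ G.neighborFinset u, (√((k : ℝ) - 1))⁻¹ ^ G.dist o v ≤
      2 * √((k : ℝ) - 1) * (√((k : ℝ) - 1))⁻¹ ^ G.dist o u := by
  have h2' : (2 : ℝ) ≤ k := by exact_mod_cast h2
  set ρ := √((k : ℝ) - 1) with hρ
  have hρ2 : ρ ^ 2 = k - 1 := Real.sq_sqrt (by linarith)
  have hρ0 : 0 < ρ := Real.sqrt_pos.2 (by linarith)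
  have hsum (m : ℕ) : ∑ v ∈ G.neighborFinset u with G.dist o v = m, ρ⁻¹ ^ G.dist o v =
      #{v ∈ G.neighborFinset u | G.dist o v = m} * ρ⁻¹ ^ m := by
    rw [Finset.sum_congr rfl fun v hv => by rw [(Finset.mem_filter.1 hv).2], Finset.sum_const,
      nsmul_eq_mul]
  rcases hn : G.dist o u with _ | n
  · obtain rfl := hG.connected.dist_eq_zero_iff.1 hn
    rw [Finset.sum_congr rfl fun v hv => by
      rw [dist_eq_one_iff_adj.2 ((G.mem_neighborFinset o v).1 hv)], Finset.sum_const,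
      card_neighborFinset_eq_degree, hk o, nsmul_eq_mul, pow_one, pow_zero, mul_one,
      ← div_eq_mul_inv, div_le_iff₀ hρ0]
    nlinarith
  · rw [hG.sum_neighbor_eq hn, hsum, hsum, hG.card_filter_parent hn]
    have : (#{v ∈ G.neighborFinset u | G.dist o v = n + 2} : ℝ) = ρ ^ 2 := by
      rw [hρ2, ← hG.card_filter_child_add hk hn]
      simp
    rw [this]
    rw [inv_pow, inv_pow, inv_pow]
    refine le_of_eq ?_
    field_simp
    push_cast
    ring

end Tree

section Operator

variable [G.LocallyFinite]

/-- Schur test for the adjacency operator of a locally finite graph. -/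
lemma sum_norm_sq_sum_neighbor_le {h : V → ℝ} {C : ℝ} (h0 : ∀ v, 0 < h v) (hC : 0 ≤ C)
    (hh : ∀ u, ∑ v ∈ G.neighborFinset u, h v ≤ C * h u) (f : lp (fun _ : V => ℂ) 2)
    (s : Finset V) :
    ∑ u ∈ s, ‖∑ v ∈ G.neighborFinset u, f v‖ ^ 2 ≤ (C * ‖f‖) ^ 2 := by
  classical
  have hf (t : Finset V) : ∑ v ∈ t, ‖f v‖ ^ 2 ≤ ‖f‖ ^ 2 := by
    simpa using lp.sum_rpow_le_norm_rpow (p := 2) (by simp) f t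
  calc ∑ u ∈ s, ‖∑ v ∈ G.neighborFinset u, f v‖ ^ 2
      ≤ ∑ u ∈ s, (C * h u) * ∑ v ∈ G.neighborFinset u, ‖f v‖ ^ 2 / h v := by
        refine Finset.sum_le_sum fun u _ => ?_
        calc ‖∑ v ∈ G.neighborFinset u, f v‖ ^ 2
            ≤ (∑ v ∈ G.neighborFinset u, ‖f v‖) ^ 2 := by
              gcongr
              exact norm_sum_le _ _
          _ ≤ (∑ v ∈ G.neighborFinset u, h v) * ∑ v ∈ G.neighborFinset u, ‖f v‖ ^ 2 / h v := by
              refine Finset.sum_sq_le_sum_mul_sum_of_sq_le_mul _ (fun v _ => (h0 v).le)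
                (fun v _ => div_nonneg (sq_nonneg _) (h0 v).le) fun v _ => ?_
              rw [mul_div_cancel₀ _ (h0 v).ne']
          _ ≤ _ := by
              gcongr
              · exact Finset.sum_nonneg fun v _ => div_nonneg (sq_nonneg _) (h0 v).le
              · exact hh u
    _ = ∑ v ∈ (s.biUnion fun u => G.neighborFinset u),
          ∑ u ∈ s with G.Adj v u, C * h u * (‖f v‖ ^ 2 / h v) := by
        simp_rw [Finset.mul_sum]
        refine Finset.sum_comm' fun u v => ?_
        simp only [mem_neighborFinset, Finset.mem_filter, Finset.mem_biUnion, G.adj_comm v u]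
        exact ⟨fun h => ⟨h, u, h⟩, fun h => h.1⟩
    _ ≤ ∑ v ∈ (s.biUnion fun u => G.neighborFinset u), C ^ 2 * ‖f v‖ ^ 2 := by
        refine Finset.sum_le_sum fun v _ => ?_
        rw [← Finset.sum_mul, ← Finset.mul_sum]
        have hv := h0 v
        have : ∑ u ∈ s with G.Adj v u, h u ≤ C * h v :=
          (Finset.sum_le_sum_of_subset_of_nonneg (fun u hu => by
            simpa using (Finset.mem_filter.1 hu).2) fun u _ _ => (h0 u).le).trans (hh v)
        calc (C * ∑ u ∈ s with G.Adj v u, h u) * (‖f v‖ ^ 2 / h v)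
            ≤ C * (C * h v) * (‖f v‖ ^ 2 / h v) := by
              gcongr
          _ = C ^ 2 * ‖f v‖ ^ 2 := by
              field_simp
    _ ≤ (C * ‖f‖) ^ 2 := by
        rw [← Finset.mul_sum, mul_pow]
        gcongr
        exact hf _

lemma exists_adjacency_operator {h : V → ℝ} {C : ℝ} (h0 : ∀ v, 0 < h v) (hC : 0 ≤ C)
    (hh : ∀ u, ∑ v ∈ G.neighborFinset u, h v ≤ C * h u) :
    ∃ A : lp (fun _ : V => ℂ) 2 →L[ℂ] lp (fun _ : V => ℂ) 2,
      (∀ f u, A f u = ∑ v ∈ G.neighborFinset u, f v) ∧ ‖A‖ ≤ C := by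
  have hS := sum_norm_sq_sum_neighbor_le h0 hC hh
  let L : lp (fun _ : V => ℂ) 2 →ₗ[ℂ] lp (fun _ : V => ℂ) 2 :=
    { toFun := fun f => ⟨fun u => ∑ v ∈ G.neighborFinset u, f v,
        memℓp_gen' (C := (C * ‖f‖) ^ 2) fun s => by simpa using hS f s⟩
      map_add' := fun f g => by
        ext u
        exact Finset.sum_add_distrib
      map_smul' := fun c f => by
        ext u
        exact (Finset.mul_sum _ _ _).symm }
  refine ⟨L.mkContinuous C fun f => ?_, fun f u => rfl, L.mkContinuous_norm_le hC _⟩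
  refine lp.norm_le_of_forall_sum_le (by simp) (by positivity) fun s => ?_
  simpa [L] using hS f s

lemma isSelfAdjoint_of_adjacency {A : lp (fun _ : V => ℂ) 2 →L[ℂ] lp (fun _ : V => ℂ) 2}
    (hA : ∀ f u, A f u = ∑ v ∈ G.neighborFinset u, f v) : IsSelfAdjoint A := by
  classical
  rw [ContinuousLinearMap.isSelfAdjoint_iff']
  ext f u
  have h1 : (ContinuousLinearMap.adjoint A f) u =
      inner ℂ (A (lp.single 2 u (1 : ℂ))) f := by
    rw [← ContinuousLinearMap.adjoint_inner_right, lp.inner_single_left]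
    simp
  rw [h1, hA, lp.inner_eq_tsum, tsum_eq_sum (s := G.neighborFinset u)]
  · refine Finset.sum_congr rfl fun v hv => ?_
    rw [hA]
    simp [lp.single_apply, Pi.single_apply, ((G.mem_neighborFinset u v).1 hv).symm]
  · intro v hv
    rw [hA]
    have : ¬ G.Adj v u := fun h => hv (by simpa using h.symm)
    simp [lp.single_apply, Pi.single_apply, this]

lemma tendsto_sum_distSphere {a : V → ℝ} (ha : Summable a) (hG : G.Connected) (o : V) :
    Tendsto (fun n => ∑ v ∈ distSphere hG o n, a v) atTop (𝓝 0) := by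
  rw [Metric.tendsto_atTop]
  intro ε hε
  obtain ⟨s, hs⟩ := summable_iff_vanishing_norm.1 ha ε hε
  refine ⟨s.sup (G.dist o) + 1, fun n hn => ?_⟩
  rw [dist_zero_right]
  refine hs _ (Finset.disjoint_left.2 fun v hv hvs => ?_)
  have h1 := Finset.le_sup (f := G.dist o) hvs
  have h2 := (mem_distSphere hG).1 hv
  omega

end Operator

end SimpleGraph

/-- A solution of `g (n + 2) = t g (n + 1) - g n` with `|t| ≤ 2` that tends to zero vanishes. -/
lemma eq_zero_of_recurrence_of_tendsto_zero {g : ℕ → ℝ} {t : ℝ} (ht : |t| ≤ 2)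
    (hg : ∀ n, g (n + 2) = t * g (n + 1) - g n) (h0 : Tendsto g atTop (𝓝 0)) (n : ℕ) :
    g n = 0 := by
  have ht' : t ^ 2 ≤ 4 := by
    have := sq_le_sq' (abs_le.1 ht).1 (abs_le.1 ht).2
    linarith
  have hQ (n : ℕ) : g n ^ 2 + g (n + 1) ^ 2 - t * g n * g (n + 1) =
      g 0 ^ 2 + g 1 ^ 2 - t * g 0 * g 1 := by
    induction n with
    | zero => rfl
    | succ n ih =>
      rw [← ih, hg n]
      ring
  have h1 : Tendsto (fun n => g (n + 1)) atTop (𝓝 0) := h0.comp (tendsto_add_atTop_nat 1)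
  have hlim : Tendsto (fun n => g n ^ 2 + g (n + 1) ^ 2 - t * g n * g (n + 1)) atTop (𝓝 0) := by
    simpa using ((h0.pow 2).add (h1.pow 2)).sub ((h0.const_mul t).mul h1)
  have hQ0 : g 0 ^ 2 + g 1 ^ 2 - t * g 0 * g 1 = 0 := by
    simp_rw [hQ] at hlim
    exact tendsto_nhds_unique tendsto_const_nhds hlim
  have hmono : Monotone fun n => g n ^ 2 := monotone_nat_of_le_succ fun n => by
    have h2 := (hQ n).trans hQ0
    have h3 : g n - t / 2 * g (n + 1) = 0 := by
      nlinarith [sq_nonneg (g n - t / 2 * g (n + 1)), sq_nonneg (g (n + 1))]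
    have h4 : g n = t / 2 * g (n + 1) := by linarith
    rw [h4]
    nlinarith [sq_nonneg (g (n + 1))]
  have h5 : g n ^ 2 ≤ 0 := hmono.ge_of_tendsto (by simpa using h0.pow 2) n
  exact pow_eq_zero_iff two_ne_zero |>.1 (le_antisymm h5 (sq_nonneg _))

namespace SimpleGraph

/-- On a regular tree no square-summable function `f` satisfies `r f - A f = δ_o` for `r` in the
Kesten interval: the sums of `f` over spheres around `o` satisfy a linear recurrence whose nonzero
solutions do not decay fast enough. -/
lemma IsTree.not_exists_green_function {V : Type*} {G : SimpleGraph V} [G.LocallyFinite]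
    [DecidableEq V] {k : ℕ} (hG : G.IsTree) (hk : G.IsRegularOfDegree k) (h2 : 2 ≤ k) {r : ℝ}
    (hr : |r| ≤ 2 * √((k : ℝ) - 1)) (o : V) (f : V → ℝ) (hf : Summable fun v => f v ^ 2)
    (hfo : ∀ u, r * f u - ∑ v ∈ G.neighborFinset u, f v = if u = o then 1 else 0) : False := by
  have h2' : (2 : ℝ) ≤ k := by exact_mod_cast h2
  set ρ := √((k : ℝ) - 1) with hρ
  have hρ2 : ρ ^ 2 = k - 1 := Real.sq_sqrt (by linarith)
  have hρ0 : 0 < ρ := Real.sqrt_pos.2 (by linarith)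
  let X : ℕ → ℝ := fun n => ∑ v ∈ distSphere hG.connected o n, f v
  have hX (n : ℕ) : r * X (n + 1) =
      ∑ u ∈ distSphere hG.connected o (n + 1), ∑ v ∈ G.neighborFinset u, f v := by
    rw [Finset.mul_sum, ← sub_eq_zero, ← Finset.sum_sub_distrib]
    refine Finset.sum_eq_zero fun u hu => ?_
    rw [hfo, if_neg]
    rintro rfl
    simp at hu
  have hX0 : r * f o - X 1 = 1 := by
    have := hfo o
    rwa [sum_neighbor_root hG.connected, if_pos rfl] at this
  have hX1 : r * X 1 = X 2 + k * f o := by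
    rw [hX 0]
    exact hG.sum_distSphere_one_neighbor hk o f
  have hX2 (n : ℕ) : r * X (n + 2) = X (n + 3) + (k - 1) * X (n + 1) := by
    rw [hX (n + 1)]
    exact hG.sum_distSphere_add_two_neighbor hk o n f
  have hlim : Tendsto (fun n => X n / ρ ^ n) atTop (𝓝 0) := by
    have h1 : Tendsto (fun n => (X n / ρ ^ n) ^ 2) atTop (𝓝 0) := by
      refine squeeze_zero (fun n => sq_nonneg _) (fun n => ?_)
        (by simpa using (tendsto_sum_distSphere hf hG.connected o).const_mul 2)
      rw [div_pow, div_le_iff₀ (by positivity)]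
      have hc : X n ^ 2 ≤ (distSphere hG.connected o n).card *
          ∑ v ∈ distSphere hG.connected o n, f v ^ 2 := sq_sum_le_card_mul_sum_sq
      have hcard := hG.card_distSphere_le hk h2 o n
      rw [← hρ2, ← pow_mul, mul_comm 2 n, pow_mul] at hcard
      refine hc.trans ((mul_le_mul_of_nonneg_right hcard
        (Finset.sum_nonneg fun v _ => sq_nonneg _)).trans_eq ?_)
      ring
    have h3 := h1.sqrt
    simp only [Real.sqrt_sq_eq_abs, Real.sqrt_zero] at h3
    exact (tendsto_zero_iff_abs_tendsto_zero _).2 h3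
  have hzero := eq_zero_of_recurrence_of_tendsto_zero (g := fun n => X (n + 1) / ρ ^ (n + 1))
    (t := r / ρ) (by rwa [abs_div, abs_of_pos hρ0, div_le_iff₀ hρ0]) (fun n => by
      have h3 : X (n + 3) = r * X (n + 2) - ρ ^ 2 * X (n + 1) := by
        rw [hρ2, hX2]
        ring
      simp only [show n + 2 + 1 = n + 3 by rfl, show n + 1 + 1 = n + 2 by rfl, h3]
      field_simp
      ring) (hlim.comp (tendsto_add_atTop_nat 1))
  have hX1' : X 1 = 0 := by simpa [hρ0.ne'] using hzero 0
  have hX2' : X 2 = 0 := by simpa [hρ0.ne'] using hzero 1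
  have hfo0 : f o = 0 := by
    have : (k : ℝ) * f o = 0 := by linarith [hX1, hX1', hX2', mul_zero r, congrArg (r * ·) hX1']
    rcases mul_eq_zero.1 this with h | h
    · linarith
    · exact h
  rw [hfo0, hX1'] at hX0
  norm_num at hX0

lemma IsTree.spectrum_adjacency {V : Type*} {G : SimpleGraph V} [G.LocallyFinite] {k : ℕ}
    (hG : G.IsTree) (hk : G.IsRegularOfDegree k) (h2 : 2 ≤ k)
    {A : lp (fun _ : V => ℂ) 2 →L[ℂ] lp (fun _ : V => ℂ) 2}
    (hA : ∀ f u, A f u = ∑ v ∈ G.neighborFinset u, f v) (hnorm : ‖A‖ ≤ 2 * √((k : ℝ) - 1)) :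
    spectrum ℂ A =
      (fun r : ℝ => (r : ℂ)) '' Set.Icc (-(2 * √((k : ℝ) - 1))) (2 * √((k : ℝ) - 1)) := by
  classical
  obtain ⟨o⟩ := hG.connected.nonempty
  refine Set.Subset.antisymm (fun z hz => ?_) ?_
  · have hre := (isSelfAdjoint_of_adjacency hA).mem_spectrum_eq_re hz
    refine ⟨z.re, abs_le.1 ?_, hre.symm⟩
    refine (Complex.abs_re_le_norm z).trans ((spectrum.norm_le_norm_mul_of_mem hz).trans ?_)
    exact (mul_le_of_le_one_right (norm_nonneg _) ContinuousLinearMap.norm_id_le).trans hnorm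
  · rintro _ ⟨r, hr, rfl⟩ hunit
    obtain ⟨B, hB⟩ := (show IsUnit _ from hunit).exists_right_inv
    let f : lp (fun _ : V => ℂ) 2 := B (lp.single 2 o (1 : ℂ))
    have hf : (r : ℂ) • f - A f = lp.single 2 o (1 : ℂ) := by
      exact congrArg (fun L => L (lp.single 2 o (1 : ℂ))) hB
    refine hG.not_exists_green_function hk h2 (abs_le.2 hr) o (fun v => (f v).re) ?_ fun u => ?_
    · refine Summable.of_nonneg_of_le (fun v => sq_nonneg _) (fun v => ?_)
        (by simpa using (lp.memℓp f).summable (by simp))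
      rw [← sq_abs]
      gcongr
      exact Complex.abs_re_le_norm _
    · have h1 := congrArg (fun g : lp (fun _ : V => ℂ) 2 => (g u).re) hf
      simp only [lp.coeFn_sub, lp.coeFn_smul, Pi.sub_apply, Pi.smul_apply, hA, smul_eq_mul,
        Complex.sub_re, Complex.re_ofReal_mul, Complex.re_sum, lp.single_apply, Pi.single_apply]
        at h1
      rw [h1]
      split_ifs <;> simp

end SimpleGraph

/-- Kesten: let `T` be the `k`-regular tree (`k ≥ 2`), i.e. an infinite
connected acyclic simple graph all of whose vertices have exactly `k` neighbors.  Then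
there is a bounded operator `A` on `ℓ²(V(T))` acting by `(Af)(u) = ∑_{v ~ u} f(v)`,
`A` is self-adjoint, and its spectrum is exactly the real interval
`[-2√(k-1), 2√(k-1)]`. -/
theorem kesten_spectrum (k : ℕ) (hk : 2 ≤ k)
    (V : Type) [Infinite V] (T : SimpleGraph V)
    (hconn : T.Connected) (hacyclic : T.IsAcyclic)
    (hreg : ∀ v : V, (T.neighborSet v).ncard = k) :
    ∃ A : lp (fun _ : V => ℂ) 2 →L[ℂ] lp (fun _ : V => ℂ) 2,
      (∀ f : lp (fun _ : V => ℂ) 2, ∀ u : V,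
        (A f : ∀ _ : V, ℂ) u = ∑ᶠ v ∈ T.neighborSet u, (f : ∀ _ : V, ℂ) v) ∧
      IsSelfAdjoint A ∧
      spectrum ℂ A =
        (fun r : ℝ => (r : ℂ)) ''
          Set.Icc (-(2 * Real.sqrt ((k : ℝ) - 1))) (2 * Real.sqrt ((k : ℝ) - 1)) := by
  classical
  have hfin (v : V) : (T.neighborSet v).Finite :=
    Set.finite_of_ncard_ne_zero (by rw [hreg v]; omega)
  let : T.LocallyFinite := fun v => (hfin v).fintype
  have hT : T.IsTree := ⟨hconn, hacyclic⟩
  have hdeg : T.IsRegularOfDegree k := fun v => by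
    rw [← hreg v, ← T.coe_neighborFinset, Set.ncard_coe_finset, T.card_neighborFinset_eq_degree]
  obtain ⟨o⟩ := hconn.nonempty
  have hρ : 0 < √((k : ℝ) - 1) := Real.sqrt_pos.2 <| sub_pos.2 <| by exact_mod_cast hk
  obtain ⟨A, hA, hnorm⟩ := SimpleGraph.exists_adjacency_operator
    (fun v => pow_pos (inv_pos.2 hρ) (T.dist o v)) (mul_nonneg zero_le_two hρ.le)
    (hT.sum_neighbor_pow_dist_le hdeg hk o)
  refine ⟨A, fun f u => ?_, SimpleGraph.isSelfAdjoint_of_adjacency hA,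
    hT.spectrum_adjacency hdeg hk hA hnorm⟩
  rw [hA, ← finsum_mem_coe_finset, T.coe_neighborFinset]
end
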